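/- Let f ∈ M_p, 1<p<∞, 0<α₁<β₁, 0<α₂<β₂, δ₁,δ₂ ∈ (0,1/2). Then ω_{α₁,α₂}(f,δ₁,δ₂)_p ≍ δ₁^{α₁} δ₂^{α₂} {∫_{δ₁}¹∫_{δ₂}¹ [t₁^{−α₁} t₂^{−α₂} ω_{β₁,β₂}(f,t₁,t₂)_p]^p (dt₁/t₁)(dt₂/t₂)}^{1/p}, with constants independent of f, δ₁, δ₂. -/

import Mathlib

open MeasureTheory Real
open scoped ENNReal

noncomputable section

/-- The `L_p` norm of a function of two variables over the period square `(0,2π]²`. -/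
def Lp2Norm (p : ℝ) (f : ℝ → ℝ → ℝ) : ℝ≥0∞ :=
  (∫⁻ x in Set.Ioc (0:ℝ) (2*π), ∫⁻ y in Set.Ioc (0:ℝ) (2*π),
      ENNReal.ofReal (|f x y| ^ p)) ^ (1/p)

/-- `f ∈ L_p^0(T²)`: measurable, `2π`-periodic in each variable, finite `L_p` norm,
and zero mean in each variable separately. -/
structure MemLp0 (p : ℝ) (f : ℝ → ℝ → ℝ) : Prop where
  meas : Measurable (Function.uncurry f)
  periodic_x : ∀ y, Function.Periodic (fun x => f x y) (2*π)
  periodic_y : ∀ x, Function.Periodic (f x) (2*π)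
  norm_ne_top : Lp2Norm p f ≠ ⊤
  mean_x : ∀ᵐ (y : ℝ) ∂volume, (∫ x in (0:ℝ)..(2*π), f x y) = 0
  mean_y : ∀ᵐ (x : ℝ) ∂volume, (∫ y in (0:ℝ)..(2*π), f x y) = 0

/-- Generalized (fractional) binomial coefficient `C(α,ν) = α(α-1)⋯(α-ν+1)/ν!`. -/
def fracBinom (α : ℝ) : ℕ → ℝ
  | 0 => 1
  | n+1 => fracBinom α n * (α - (n : ℝ)) / ((n : ℝ) + 1)

/-- Fractional difference of order `α` with step `h` in the first variable. -/
def diffX (α h : ℝ) (f : ℝ → ℝ → ℝ) : ℝ → ℝ → ℝ :=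
  fun x y => ∑' ν : ℕ, (-1 : ℝ) ^ ν * fracBinom α ν * f (x + (α - (ν : ℝ)) * h) y

/-- Fractional difference of order `α` with step `h` in the second variable. -/
def diffY (α h : ℝ) (f : ℝ → ℝ → ℝ) : ℝ → ℝ → ℝ :=
  fun x y => ∑' ν : ℕ, (-1 : ℝ) ^ ν * fracBinom α ν * f x (y + (α - (ν : ℝ)) * h)

/-- The mixed (fractional) modulus of smoothness `ω_{α₁,α₂}(f, δ₁, δ₂)_p`. -/
def mixedMod (p α₁ α₂ δ₁ δ₂ : ℝ) (f : ℝ → ℝ → ℝ) : ℝ≥0∞ :=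
  ⨆ (h₁ : ℝ) (_ : |h₁| ≤ δ₁) (h₂ : ℝ) (_ : |h₂| ≤ δ₂),
    Lp2Norm p (diffX α₁ h₁ (diffY α₂ h₂ f))

/-- `δ₁^{α₁} δ₂^{α₂} {∫_{δ₁}^1 ∫_{δ₂}^1 [t₁^{-α₁} t₂^{-α₂} ω_{β₁,β₂}(f,t₁,t₂)_p]^s (dt₁/t₁)(dt₂/t₂)}^{1/s}`. -/
def marchaudInt (p α₁ α₂ β₁ β₂ δ₁ δ₂ s : ℝ) (f : ℝ → ℝ → ℝ) : ℝ≥0∞ :=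
  ENNReal.ofReal (δ₁ ^ α₁ * δ₂ ^ α₂) *
    (∫⁻ t₁ in Set.Ioo δ₁ 1, ∫⁻ t₂ in Set.Ioo δ₂ 1,
      ENNReal.ofReal ((t₁ ^ (-α₁) * t₂ ^ (-α₂)) ^ s / (t₁ * t₂)) *
        mixedMod p β₁ β₂ t₁ t₂ f ^ s) ^ (1/s)

/-- Cosine-cosine Fourier coefficient `a_{n₁,n₂}` of `f`. -/
def fourierCC (f : ℝ → ℝ → ℝ) (n₁ n₂ : ℕ) : ℝ :=
  (1/π^2) * ∫ x in (0:ℝ)..(2*π), ∫ y in (0:ℝ)..(2*π),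
    f x y * Real.cos ((n₁ : ℝ) * x) * Real.cos ((n₂ : ℝ) * y)

/-- Sine-cosine Fourier coefficient `b_{n₁,n₂}` of `f`. -/
def fourierSC (f : ℝ → ℝ → ℝ) (n₁ n₂ : ℕ) : ℝ :=
  (1/π^2) * ∫ x in (0:ℝ)..(2*π), ∫ y in (0:ℝ)..(2*π),
    f x y * Real.sin ((n₁ : ℝ) * x) * Real.cos ((n₂ : ℝ) * y)

/-- Cosine-sine Fourier coefficient `c_{n₁,n₂}` of `f`. -/
def fourierCS (f : ℝ → ℝ → ℝ) (n₁ n₂ : ℕ) : ℝ :=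
  (1/π^2) * ∫ x in (0:ℝ)..(2*π), ∫ y in (0:ℝ)..(2*π),
    f x y * Real.cos ((n₁ : ℝ) * x) * Real.sin ((n₂ : ℝ) * y)

/-- Sine-sine Fourier coefficient `d_{n₁,n₂}` of `f`. -/
def fourierSS (f : ℝ → ℝ → ℝ) (n₁ n₂ : ℕ) : ℝ :=
  (1/π^2) * ∫ x in (0:ℝ)..(2*π), ∫ y in (0:ℝ)..(2*π),
    f x y * Real.sin ((n₁ : ℝ) * x) * Real.sin ((n₂ : ℝ) * y)

/-- The class `M_p`: `f ∈ L_p^0(T²)` with a pure cosine-cosine Fourier series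
`Σ a_{ν₁,ν₂} cos ν₁x cos ν₂y` whose coefficients have nonnegative mixed differences. -/
def InMclass (p : ℝ) (f : ℝ → ℝ → ℝ) (a : ℕ → ℕ → ℝ) : Prop :=
  MemLp0 p f ∧
  (∀ ν₁ ν₂ : ℕ, 1 ≤ ν₁ → 1 ≤ ν₂ → fourierCC f ν₁ ν₂ = a ν₁ ν₂) ∧
  (∀ n₁ n₂ : ℕ, fourierSC f n₁ n₂ = 0 ∧ fourierCS f n₁ n₂ = 0 ∧ fourierSS f n₁ n₂ = 0) ∧
  (∀ ν₁ ν₂ : ℕ, 1 ≤ ν₁ → 1 ≤ ν₂ →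
    0 ≤ a ν₁ ν₂ - a (ν₁+1) ν₂ - a ν₁ (ν₂+1) + a (ν₁+1) (ν₂+1))

section

/-- The signed coefficient `(-1)^ν C(α,ν)` of the fractional difference of order `α`. -/
def diffCoeff (α : ℝ) (ν : ℕ) : ℝ := (-1 : ℝ) ^ ν * fracBinom α ν

theorem diffCoeff_zero (α : ℝ) : diffCoeff α 0 = 1 := by simp [diffCoeff, fracBinom]

theorem diffCoeff_succ (α : ℝ) (ν : ℕ) :
    diffCoeff α (ν + 1) = diffCoeff α ν * ((ν : ℝ) - α) / ((ν : ℝ) + 1) := by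
  simp only [diffCoeff, fracBinom]
  ring

theorem summable_abs_diffCoeff {α : ℝ} (hα : 0 < α) : Summable fun ν => |diffCoeff α ν| := by
  obtain ⟨N, hN⟩ := exists_nat_ge α
  rw [← summable_nat_add_iff N]
  have key : ∀ K : ℕ, α * ∑ k ∈ Finset.range K, |diffCoeff α (k + N)| =
      N * |diffCoeff α N| - ((K : ℝ) + N) * |diffCoeff α (K + N)| := by
    intro K
    induction K with
    | zero => simp
    | succ K ih =>
      rw [Finset.sum_range_succ, mul_add, ih, show K + 1 + N = (K + N) + 1 by ring,
        diffCoeff_succ, abs_div, abs_mul]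
      have h1 : (0 : ℝ) ≤ ((K + N : ℕ) : ℝ) - α := by push_cast; linarith [K.cast_nonneg (α := ℝ)]
      have h2 : (0 : ℝ) < ((K + N : ℕ) : ℝ) + 1 := by positivity
      rw [abs_of_nonneg h1, abs_of_pos h2]
      field_simp
      push_cast
      ring
  refine summable_of_sum_range_le (c := N * |diffCoeff α N| / α) (fun _ => abs_nonneg _) fun K => ?_
  rw [le_div_iff₀ hα, mul_comm, key]
  have : 0 ≤ ((K : ℝ) + N) * |diffCoeff α (K + N)| := by positivity
  linarith

theorem fracBinom_eq_choose (α : ℝ) (n : ℕ) : fracBinom α n = Ring.choose α n := by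
  induction n with
  | zero => simp [fracBinom]
  | succ n ih =>
    rw [fracBinom, ih, Ring.choose_eq_smul, Ring.choose_eq_smul, descPochhammer_succ_right,
      Polynomial.smeval_mul]
    simp only [Polynomial.smeval_sub, Polynomial.smeval_X, pow_one, Polynomial.smeval_natCast,
      Nat.factorial_succ, smul_eq_mul, nsmul_eq_mul]
    push_cast
    have : ((n.factorial : ℕ) : ℝ) ≠ 0 := by positivity
    have : (n : ℝ) + 1 ≠ 0 := by positivity
    field_simp

theorem hasSum_diffCoeff_of_norm_lt_one (α : ℝ) {z : ℂ} (hz : ‖z‖ < 1) :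
    HasSum (fun ν => (diffCoeff α ν : ℂ) * z ^ ν) ((1 - z) ^ (α : ℂ)) := by
  have h := (Complex.one_add_cpow_hasFPowerSeriesOnBall_zero (a := (α : ℂ))).hasSum (y := -z)
    (by
      rw [Metric.mem_eball, edist_zero_right, enorm_neg, ← ofReal_norm, ENNReal.ofReal_lt_one]
      exact hz)
  simp only [binomialSeries_apply, List.ofFn_const, List.prod_replicate, zero_sub,
    ← sub_eq_add_neg] at h
  have e : (fun ν => (diffCoeff α ν : ℂ) * z ^ ν) =
      fun ν => Ring.choose (α : ℂ) ν • (-z) ^ ν := by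
    funext ν
    rw [neg_pow z, ← Complex.ofReal_choose, ← fracBinom_eq_choose]
    simp only [diffCoeff]
    push_cast
    rw [smul_eq_mul]
    ring
  rw [e]
  exact h

theorem summable_diffCoeff_mul {α : ℝ} (hα : 0 < α) {u : ℕ → ℂ} (hu : ∀ ν, ‖u ν‖ ≤ 1) :
    Summable fun ν => (diffCoeff α ν : ℂ) * u ν := by
  refine Summable.of_norm_bounded (summable_abs_diffCoeff hα) fun ν => ?_
  rw [norm_mul, Complex.norm_real, Real.norm_eq_abs]
  exact mul_le_of_le_one_right (abs_nonneg _) (hu ν)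

theorem tsum_diffCoeff_pow {α : ℝ} (hα : 0 < α) {z : ℂ} (hz : ‖z‖ ≤ 1) :
    ∑' ν, (diffCoeff α ν : ℂ) * z ^ ν = (1 - z) ^ (α : ℂ) := by
  have hl : Filter.Tendsto (fun r : ℝ => ∑' ν, (diffCoeff α ν : ℂ) * ((r : ℂ) * z) ^ ν)
      (nhdsWithin 1 (Set.Ioo 0 1)) (nhds (∑' ν, (diffCoeff α ν : ℂ) * z ^ ν)) := by
    refine tendsto_tsum_of_dominated_convergence (summable_abs_diffCoeff hα) (fun ν => ?_) ?_
    · have : Continuous fun r : ℝ => (diffCoeff α ν : ℂ) * ((r : ℂ) * z) ^ ν := by fun_prop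
      simpa using (this.tendsto 1).mono_left nhdsWithin_le_nhds
    · filter_upwards [self_mem_nhdsWithin] with r hr ν
      rw [norm_mul, Complex.norm_real, Real.norm_eq_abs, norm_pow, norm_mul, Complex.norm_real,
        Real.norm_eq_abs, abs_of_pos hr.1]
      refine mul_le_of_le_one_right (abs_nonneg _) (pow_le_one₀ (by have := hr.1; positivity) ?_)
      exact mul_le_one₀ hr.2.le (norm_nonneg _) hz
  have hr : Filter.Tendsto (fun r : ℝ => (1 - (r : ℂ) * z) ^ (α : ℂ))
      (nhdsWithin 1 (Set.Ioo 0 1)) (nhds ((1 - z) ^ (α : ℂ))) := by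
    have hc : ContinuousAt (fun x : ℂ => x ^ (α : ℂ)) (1 - z) := by
      refine Complex.continuousAt_cpow_const_of_re_pos (Or.inl ?_) (by simpa using hα)
      have := (Complex.re_le_norm z).trans hz
      simpa using this
    have h2 : Continuous fun r : ℝ => 1 - (r : ℂ) * z := by fun_prop
    have h3 := (h2.tendsto 1).mono_left (nhdsWithin_le_nhds (s := Set.Ioo 0 1))
    simp only [Complex.ofReal_one, one_mul] at h3
    exact hc.tendsto.comp h3
  have : (nhdsWithin (1 : ℝ) (Set.Ioo 0 1)).NeBot := by
    rw [nhdsWithin_Ioo_eq_nhdsLT zero_lt_one]; infer_instance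
  refine tendsto_nhds_unique hl (hr.congr' ?_)
  filter_upwards [self_mem_nhdsWithin] with r hr
  refine (hasSum_diffCoeff_of_norm_lt_one α ?_).tsum_eq.symm
  rw [norm_mul, Complex.norm_real, Real.norm_eq_abs, abs_of_pos hr.1]
  exact (mul_le_of_le_one_right hr.1.le hz).trans_lt hr.2

theorem one_sub_cexp_neg (θ : ℝ) :
    1 - Complex.exp (-(θ * Complex.I)) =
      ((2 * sin (θ / 2) : ℝ) : ℂ) * Complex.exp (((π - θ) / 2 : ℝ) * Complex.I) := by
  have h1 : Complex.exp (((π - θ) / 2 : ℝ) * Complex.I) =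
      Complex.I * Complex.exp (-(θ / 2 * Complex.I)) := by
    nth_rewrite 2 [← Complex.exp_pi_div_two_mul_I]
    rw [← Complex.exp_add]
    congr 1
    push_cast; ring
  rw [h1]
  push_cast
  rw [Complex.sin]
  have h2 : Complex.exp (-(θ * Complex.I)) =
      Complex.exp (-(θ / 2 * Complex.I)) * Complex.exp (-(θ / 2 * Complex.I)) := by
    rw [← Complex.exp_add]; ring_nf
  have h4 : Complex.exp (-(θ / 2 : ℂ) * Complex.I) = Complex.exp (-(θ / 2 * Complex.I)) := by
    rw [neg_mul]
  have h3 : Complex.exp (θ / 2 * Complex.I) * Complex.exp (-(θ / 2 * Complex.I)) = 1 := by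
    rw [← Complex.exp_add]; simp
  rw [h2, h4]
  linear_combination (-1 : ℂ) * h3 +
    (Complex.exp (θ / 2 * Complex.I) - Complex.exp (-(θ / 2 * Complex.I))) *
      Complex.exp (-(θ / 2 * Complex.I)) * Complex.I_sq

theorem tsum_diffCoeff_cexp {α : ℝ} (hα : 0 < α) {θ : ℝ} (h0 : 0 ≤ θ) (h1 : θ ≤ 1) :
    ∑' ν : ℕ, (diffCoeff α ν : ℂ) * Complex.exp (-((ν * θ : ℝ) * Complex.I)) =
      (((2 * sin (θ / 2)) ^ α : ℝ) : ℂ) * Complex.exp ((α * ((π - θ) / 2) : ℝ) * Complex.I) := by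
  have hz : ‖Complex.exp (-(θ * Complex.I))‖ ≤ 1 := by
    rw [← neg_mul, ← Complex.ofReal_neg, Complex.norm_exp_ofReal_mul_I]
  have h := tsum_diffCoeff_pow hα hz
  have e : ∀ ν : ℕ, Complex.exp (-((ν * θ : ℝ) * Complex.I)) =
      Complex.exp (-(θ * Complex.I)) ^ ν := by
    intro ν
    rw [← Complex.exp_nat_mul]; push_cast; ring_nf
  simp_rw [e, h, one_sub_cexp_neg]
  rcases h0.eq_or_lt with rfl | h0
  · simp [hα.ne', Real.zero_rpow]
  have hs : 0 < sin (θ / 2) := sin_pos_of_pos_of_lt_pi (by positivity) (by linarith [pi_gt_three])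
  have hs2 : (0 : ℝ) < 2 * sin (θ / 2) := by positivity
  have hne : ((2 * sin (θ / 2) : ℝ) : ℂ) * Complex.exp (((π - θ) / 2 : ℝ) * Complex.I) ≠ 0 :=
    mul_ne_zero (by exact_mod_cast hs2.ne') (Complex.exp_ne_zero _)
  rw [Complex.cpow_def_of_ne_zero hne, Complex.log_ofReal_mul hs2 (Complex.exp_ne_zero _),
    Complex.log_exp (by simp; linarith [pi_pos, pi_gt_three])
      (by simp; linarith [pi_pos, pi_gt_three]), add_mul, Complex.exp_add,
    Complex.ofReal_cpow hs2.le, Complex.cpow_def_of_ne_zero (by exact_mod_cast hs2.ne'),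
    Complex.ofReal_log hs2.le]
  congr 2
  push_cast; ring

end

section

/-- A `2π`-periodic majorant, comparable to `min N (1/|sin (x/2)|)`, of Dirichlet-type kernels. -/
def kernelEnvelope (N x : ℝ) : ℝ := N / (1 + N * |sin (x / 2)|)

theorem kernelEnvelope_nonneg {N : ℝ} (hN : 0 ≤ N) (x : ℝ) : 0 ≤ kernelEnvelope N x := by
  unfold kernelEnvelope; positivity

theorem kernelEnvelope_mono {N M : ℝ} (hN : 0 ≤ N) (h : N ≤ M) (x : ℝ) :
    kernelEnvelope N x ≤ kernelEnvelope M x := by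
  unfold kernelEnvelope
  have hM := hN.trans h
  rw [div_le_div_iff₀ (by positivity) (by positivity)]
  nlinarith [abs_nonneg (sin (x / 2))]

theorem kernelEnvelope_two_mul {N : ℝ} (hN : 0 ≤ N) (x : ℝ) :
    kernelEnvelope (2 * N) x ≤ 2 * kernelEnvelope N x := by
  unfold kernelEnvelope
  rw [← mul_div_assoc]
  gcongr
  linarith

theorem kernelEnvelope_neg (N x : ℝ) : kernelEnvelope N (-x) = kernelEnvelope N x := by
  simp [kernelEnvelope, neg_div]

theorem continuous_kernelEnvelope {N : ℝ} (hN : 0 ≤ N) : Continuous (kernelEnvelope N) := by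
  unfold kernelEnvelope
  refine Continuous.div (by fun_prop) (by fun_prop) fun x => ?_
  positivity

theorem periodic_kernelEnvelope (N : ℝ) : Function.Periodic (kernelEnvelope N) (2 * π) := by
  intro x
  rw [kernelEnvelope, show (x + 2 * π) / 2 = x / 2 + π by ring, sin_add_pi, abs_neg,
    kernelEnvelope]

theorem norm_sum_cexp_le (n : ℕ) (x : ℝ) :
    ‖∑ k ∈ Finset.range n, Complex.exp (((k + 1 : ℕ) * x : ℝ) * Complex.I)‖ ≤
      2 * kernelEnvelope n x := by
  set S := ∑ k ∈ Finset.range n, Complex.exp (((k + 1 : ℕ) * x : ℝ) * Complex.I) with hS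
  have h1 : ‖S‖ ≤ n := by
    refine (norm_sum_le _ _).trans ?_
    simp only [Complex.norm_exp_ofReal_mul_I]
    simp
  have h2 : ‖S‖ * |sin (x / 2)| ≤ 1 := by
    set z := Complex.exp (x * Complex.I) with hz
    have e : S = z * ∑ k ∈ Finset.range n, z ^ k := by
      rw [hS, Finset.mul_sum]
      refine Finset.sum_congr rfl fun k _ => ?_
      rw [← pow_succ', hz, ← Complex.exp_nat_mul]
      push_cast; ring_nf
    have hz1 : ‖z‖ = 1 := Complex.norm_exp_ofReal_mul_I x
    have g := geom_sum_mul z n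
    have hn : ‖z - 1‖ = 2 * |sin (x / 2)| := by
      have := one_sub_cexp_neg (-x)
      rw [Complex.ofReal_neg, neg_mul, neg_neg, ← hz] at this
      rw [← norm_neg, neg_sub, this, norm_mul, Complex.norm_exp_ofReal_mul_I, Complex.norm_real]
      simp [neg_div]
    have : ‖S‖ * ‖z - 1‖ ≤ 2 := by
      rw [e, norm_mul, hz1, one_mul, ← norm_mul, g]
      refine (norm_sub_le _ _).trans ?_
      rw [norm_pow, hz1]; norm_num
    rw [hn] at this
    linarith
  have hn : (0 : ℝ) ≤ n := n.cast_nonneg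
  rw [kernelEnvelope, ← mul_div_assoc, le_div_iff₀ (by positivity)]
  nlinarith

theorem norm_sum_mul_le_of_partial_sums {n : ℕ} (μ z : ℕ → ℂ) {B : ℝ}
    (hB : ∀ j ≤ n + 1, ‖∑ k ∈ Finset.range j, z k‖ ≤ B) :
    ‖∑ k ∈ Finset.range (n + 1), μ k * z k‖ ≤
      (‖μ n‖ + ∑ k ∈ Finset.range n, ‖μ (k + 1) - μ k‖) * B := by
  have h := Finset.sum_range_by_parts μ z (n + 1)
  simp only [smul_eq_mul, Nat.add_sub_cancel] at h
  rw [h, add_mul, Finset.sum_mul]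
  refine (norm_sub_le _ _).trans (add_le_add ?_ ((norm_sum_le _ _).trans ?_))
  · rw [norm_mul]
    exact mul_le_mul_of_nonneg_left (hB _ le_rfl) (norm_nonneg _)
  · refine Finset.sum_le_sum fun k hk => ?_
    rw [norm_mul]
    exact mul_le_mul_of_nonneg_left (hB _ (by have := Finset.mem_range.1 hk; omega))
      (norm_nonneg _)

/-- The fractional difference of order `α` and step `h` of `∑_{k=1}^n cos kx`. -/
def diffDirichlet (α h : ℝ) (n : ℕ) (x : ℝ) : ℝ :=
  ∑ k ∈ Finset.range n, ∑' ν : ℕ, diffCoeff α ν * cos ((k + 1 : ℕ) * (x + (α - ν) * h))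

theorem diffDirichlet_neg (α h : ℝ) (n : ℕ) (x : ℝ) :
    diffDirichlet α (-h) n x = diffDirichlet α h n (-x) := by
  unfold diffDirichlet
  refine Finset.sum_congr rfl fun k _ => tsum_congr fun ν => ?_
  rw [← cos_neg]
  ring_nf

theorem tsum_diffCoeff_cos {α : ℝ} (hα : 0 < α) {θ : ℝ} (h0 : 0 ≤ θ) (h1 : θ ≤ 1) (ψ : ℝ) :
    ∑' ν : ℕ, diffCoeff α ν * cos (ψ - ν * θ) =
      (2 * sin (θ / 2)) ^ α * cos (ψ + α * ((π - θ) / 2)) := by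
  have h := congrArg (fun z => (Complex.exp (ψ * Complex.I) * z).re)
    (tsum_diffCoeff_cexp hα h0 h1)
  rw [← tsum_mul_left, Complex.re_tsum] at h
  · rw [← mul_assoc, mul_comm (Complex.exp _), mul_assoc, ← Complex.exp_add, ← add_mul,
      ← Complex.ofReal_add, Complex.re_ofReal_mul, Complex.exp_ofReal_mul_I_re] at h
    rw [← h]
    refine tsum_congr fun ν => ?_
    rw [← mul_assoc, mul_comm (Complex.exp _), mul_assoc, ← Complex.exp_add, ← neg_mul,
      ← Complex.ofReal_neg, ← add_mul, ← Complex.ofReal_add, Complex.re_ofReal_mul,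
      Complex.exp_ofReal_mul_I_re, ← sub_eq_add_neg]
  · refine (summable_diffCoeff_mul hα fun ν => ?_).mul_left _
    rw [← neg_mul, ← Complex.ofReal_neg, Complex.norm_exp_ofReal_mul_I]

theorem summable_diffCoeff_mul_cos {α : ℝ} (hα : 0 < α) (u : ℕ → ℝ) :
    Summable fun ν => diffCoeff α ν * cos (u ν) := by
  refine Summable.of_norm_bounded (summable_abs_diffCoeff hα) fun ν => ?_
  rw [norm_mul, Real.norm_eq_abs]
  exact mul_le_of_le_one_right (abs_nonneg _) (abs_cos_le_one _)

theorem norm_mul_cexp_sub_le {r s a b : ℝ} (hr : 0 ≤ r) (hrs : r ≤ s) :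
    ‖(s : ℂ) * Complex.exp (b * Complex.I) - (r : ℂ) * Complex.exp (a * Complex.I)‖ ≤
      (s - r) + r * |b - a| := by
  have e : (s : ℂ) * Complex.exp (b * Complex.I) - (r : ℂ) * Complex.exp (a * Complex.I) =
      ((s - r : ℝ) : ℂ) * Complex.exp (b * Complex.I) +
        (r : ℂ) * (Complex.exp (a * Complex.I) * (Complex.exp (Complex.I * (b - a : ℝ)) - 1)) := by
    have : Complex.exp (b * Complex.I) =
        Complex.exp (a * Complex.I) * Complex.exp (Complex.I * (b - a : ℝ)) := by
      rw [← Complex.exp_add]; push_cast; ring_nf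
    rw [this]; push_cast; ring
  rw [e]
  refine (norm_add_le _ _).trans (add_le_add ?_ ?_)
  · rw [norm_mul, Complex.norm_exp_ofReal_mul_I, Complex.norm_real, Real.norm_eq_abs,
      abs_of_nonneg (by linarith), mul_one]
  · rw [norm_mul, norm_mul, Complex.norm_exp_ofReal_mul_I, Complex.norm_real, Real.norm_eq_abs,
      abs_of_nonneg hr, one_mul]
    exact mul_le_mul_of_nonneg_left (Real.norm_exp_I_mul_ofReal_sub_one_le) hr

theorem abs_diffDirichlet_le_of_nonneg {α : ℝ} (hα : 0 < α) {h : ℝ} (hh : 0 ≤ h) {n : ℕ}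
    (hn : n * h ≤ 1) (x : ℝ) :
    |diffDirichlet α h n x| ≤ (4 + α) * (n * h) ^ α * kernelEnvelope n x := by
  rcases n with _ | n
  · simp [diffDirichlet, kernelEnvelope]
  set θ : ℕ → ℝ := fun k => (k + 1 : ℕ) * h with hθ
  have hθ0 : ∀ k, 0 ≤ θ k := fun k => by simp only [hθ]; positivity
  have hθn : ∀ k ≤ n, θ k ≤ (n + 1 : ℕ) * h := fun k hk => by
    simp only [hθ]; gcongr
  have hθ1 : ∀ k ≤ n, θ k ≤ 1 := fun k hk => (hθn k hk).trans hn
  set r : ℕ → ℝ := fun k => (2 * sin (θ k / 2)) ^ α with hr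
  have hs0 : ∀ k ≤ n, 0 ≤ sin (θ k / 2) := fun k hk => by
    refine sin_nonneg_of_nonneg_of_le_pi ?_ ?_
    · linarith [hθ0 k]
    · linarith [hθ1 k hk, pi_gt_three]
  have hr0 : ∀ k ≤ n, 0 ≤ r k := fun k hk =>
    rpow_nonneg (mul_nonneg zero_le_two (hs0 k hk)) _
  have hrT : ∀ k ≤ n, r k ≤ ((n + 1 : ℕ) * h) ^ α := fun k hk => by
    refine rpow_le_rpow (mul_nonneg zero_le_two (hs0 k hk)) ?_ hα.le
    have := sin_le (show 0 ≤ θ k / 2 by linarith [hθ0 k])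
    linarith [hθn k hk]
  have hrm : ∀ k < n, r k ≤ r (k + 1) := fun k hk => by
    refine rpow_le_rpow (mul_nonneg zero_le_two (hs0 k hk.le)) ?_ hα.le
    have : θ k ≤ θ (k + 1) := by simp only [hθ]; push_cast; nlinarith
    have := sin_le_sin_of_le_of_le_pi_div_two (x := θ k / 2) (y := θ (k + 1) / 2)
      (by linarith [hθ0 k, pi_gt_three]) (by linarith [hθ1 (k + 1) hk, pi_gt_three]) (by linarith)
    linarith
  set μ : ℕ → ℂ := fun k => (r k : ℂ) * Complex.exp ((α * ((π + θ k) / 2) : ℝ) * Complex.I) with hμ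
  have hE : diffDirichlet α h (n + 1) x = (∑ k ∈ Finset.range (n + 1),
      μ k * Complex.exp (((k + 1 : ℕ) * x : ℝ) * Complex.I)).re := by
    rw [diffDirichlet, Complex.re_sum]
    refine Finset.sum_congr rfl fun k hk => ?_
    have hk : k ≤ n := by have := Finset.mem_range.1 hk; omega
    have := tsum_diffCoeff_cos hα (hθ0 k) (hθ1 k hk) ((k + 1 : ℕ) * x + α * θ k)
    rw [hμ]
    simp only
    rw [mul_assoc, ← Complex.exp_add, ← add_mul, ← Complex.ofReal_add, Complex.re_ofReal_mul,
      Complex.exp_ofReal_mul_I_re]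
    convert this using 3
    · simp only [hθ]; ring_nf
    · ring_nf
  rw [hE]
  refine (Complex.abs_re_le_norm _).trans ?_
  have hB : ∀ j ≤ n + 1, ‖∑ k ∈ Finset.range j,
      Complex.exp (((k + 1 : ℕ) * x : ℝ) * Complex.I)‖ ≤ 2 * kernelEnvelope (n + 1 : ℕ) x := by
    intro j hj
    refine (norm_sum_cexp_le j x).trans ?_
    have := kernelEnvelope_mono (N := j) (M := (n + 1 : ℕ)) j.cast_nonneg (by exact_mod_cast hj) x
    linarith
  refine (norm_sum_mul_le_of_partial_sums μ _ hB).trans ?_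
  set T := ((n + 1 : ℕ) * h) ^ α with hT
  have hT0 : 0 ≤ T := rpow_nonneg (by positivity) _
  have hv : ‖μ n‖ + ∑ k ∈ Finset.range n, ‖μ (k + 1) - μ k‖ ≤ (2 + α / 2) * T := by
    have h1 : ‖μ n‖ ≤ T := by
      rw [hμ]
      simp only
      rw [norm_mul, Complex.norm_exp_ofReal_mul_I, Complex.norm_real, Real.norm_eq_abs,
        abs_of_nonneg (hr0 n le_rfl), mul_one]
      exact hrT n le_rfl
    have h2 : ∑ k ∈ Finset.range n, ‖μ (k + 1) - μ k‖ ≤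
        ∑ k ∈ Finset.range n, ((r (k + 1) - r k) + T * (α * h / 2)) := by
      refine Finset.sum_le_sum fun k hk => ?_
      have hk := Finset.mem_range.1 hk
      refine (norm_mul_cexp_sub_le (hr0 k hk.le) (hrm k hk)).trans ?_
      have e : α * ((π + θ (k + 1)) / 2) - α * ((π + θ k) / 2) = α * h / 2 := by
        simp only [hθ]; push_cast; ring
      rw [e, abs_of_nonneg (by positivity)]
      have := mul_le_mul_of_nonneg_right (hrT k hk.le) (show 0 ≤ α * h / 2 by positivity)
      linarith
    rw [Finset.sum_add_distrib, Finset.sum_range_sub, Finset.sum_const, Finset.card_range,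
      nsmul_eq_mul] at h2
    have h3 := hrT n le_rfl
    have h4 := hr0 0 (Nat.zero_le _)
    have h5 : (n : ℝ) * (T * (α * h / 2)) ≤ T * (α / 2) := by
      have : (n : ℝ) * h ≤ 1 := by push_cast at hn; linarith
      have h6 : 0 ≤ T * (α / 2) := by positivity
      nlinarith
    linarith
  refine (mul_le_mul_of_nonneg_right hv ?_).trans (le_of_eq (by ring))
  have := kernelEnvelope_nonneg (N := (n + 1 : ℕ)) (Nat.cast_nonneg _) x
  positivity

theorem abs_diffDirichlet_le {α : ℝ} (hα : 0 < α) {h : ℝ} {n : ℕ}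
    (hn : n * |h| ≤ 1) (x : ℝ) :
    |diffDirichlet α h n x| ≤ (4 + α) * (n * |h|) ^ α * kernelEnvelope n x := by
  rcases le_total 0 h with hh | hh
  · rw [abs_of_nonneg hh] at *
    exact abs_diffDirichlet_le_of_nonneg hα hh hn x
  · rw [abs_of_nonpos hh] at *
    have := abs_diffDirichlet_le_of_nonneg hα (neg_nonneg.2 hh) hn (-x)
    rwa [diffDirichlet_neg, neg_neg, kernelEnvelope_neg] at this

theorem abs_sum_cos_le (n : ℕ) (x : ℝ) :
    |∑ k ∈ Finset.range n, cos ((k + 1 : ℕ) * x)| ≤ 2 * kernelEnvelope n x := by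
  refine le_trans ?_ (norm_sum_cexp_le n x)
  refine le_trans (le_of_eq ?_) (Complex.abs_re_le_norm _)
  rw [Complex.re_sum]
  simp only [Complex.exp_ofReal_mul_I_re]

theorem kernelEnvelope_le {N : ℝ} (hN : 0 ≤ N) (x : ℝ) : kernelEnvelope N x ≤ N := by
  unfold kernelEnvelope
  refine div_le_self hN ?_
  have : 0 ≤ N * |sin (x / 2)| := by positivity
  linarith

theorem summable_abs_diffCoeff_mul_kernelEnvelope {α : ℝ} (hα : 0 < α) {N : ℝ} (hN : 0 ≤ N)
    (u : ℕ → ℝ) : Summable fun ν => |diffCoeff α ν| * kernelEnvelope N (u ν) := by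
  refine Summable.of_nonneg_of_le
    (fun ν => mul_nonneg (abs_nonneg _) (kernelEnvelope_nonneg hN _))
    (fun ν => mul_le_mul_of_nonneg_left (kernelEnvelope_le hN _) (abs_nonneg _))
    ((summable_abs_diffCoeff hα).mul_right N)

theorem abs_diffDirichlet_le_tsum {α : ℝ} (hα : 0 < α) (h : ℝ) (n : ℕ) (x : ℝ) :
    |diffDirichlet α h n x| ≤
      2 * ∑' ν : ℕ, |diffCoeff α ν| * kernelEnvelope n (x + (α - ν) * h) := by
  rw [diffDirichlet, ← Summable.tsum_finsetSum fun k _ => summable_diffCoeff_mul_cos hα _,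
    ← tsum_mul_left]
  have hs := (summable_abs_diffCoeff_mul_kernelEnvelope hα n.cast_nonneg
    fun ν => x + (α - ν) * h).mul_left 2
  rw [← Real.norm_eq_abs]
  refine tsum_of_norm_bounded hs.hasSum fun ν => ?_
  rw [← Finset.mul_sum, norm_mul, Real.norm_eq_abs, Real.norm_eq_abs]
  have := mul_le_mul_of_nonneg_left (abs_sum_cos_le n (x + (α - ν) * h))
    (abs_nonneg (diffCoeff α ν))
  linarith

/-- Weights of the translates dominating a fractional difference. -/
def shiftWeight (α : ℝ) : ℕ → ℝ
  | 0 => 1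
  | ν + 1 => |diffCoeff α ν|

/-- Translates dominating a fractional difference. -/
def shiftStep (α h : ℝ) : ℕ → ℝ
  | 0 => 0
  | ν + 1 => (α - ν) * h

theorem shiftWeight_zero (α : ℝ) : shiftWeight α 0 = 1 := rfl

theorem shiftStep_zero (α h : ℝ) : shiftStep α h 0 = 0 := rfl

theorem shiftWeight_nonneg (α : ℝ) (ν : ℕ) : 0 ≤ shiftWeight α ν := by
  cases ν <;> simp [shiftWeight]

theorem summable_shiftWeight {α : ℝ} (hα : 0 < α) : Summable (shiftWeight α) :=
  (summable_nat_add_iff 1).1 (summable_abs_diffCoeff hα)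

theorem summable_shiftWeight_mul {α : ℝ} (hα : 0 < α) {N : ℝ} (hN : 0 ≤ N) (u : ℕ → ℝ) :
    Summable fun ν => shiftWeight α ν * kernelEnvelope N (u ν) :=
  Summable.of_nonneg_of_le
    (fun _ => mul_nonneg (shiftWeight_nonneg _ _) (kernelEnvelope_nonneg hN _))
    (fun _ => mul_le_mul_of_nonneg_left (kernelEnvelope_le hN _) (shiftWeight_nonneg _ _))
    ((summable_shiftWeight hα).mul_right N)

theorem abs_diffDirichlet_le_shift {α : ℝ} (hα : 0 < α) {δ h : ℝ} (hδ : 0 < δ) (hh : |h| ≤ δ)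
    (n : ℕ) (x : ℝ) :
    |diffDirichlet α h n x| ≤ (4 + α) * (min 1 (n * δ)) ^ α *
      ∑' ν : ℕ, shiftWeight α ν * kernelEnvelope n (x + shiftStep α h ν) := by
  have hs := summable_shiftWeight_mul hα n.cast_nonneg fun ν => x + shiftStep α h ν
  have hnn : ∀ ν, 0 ≤ shiftWeight α ν * kernelEnvelope n (x + shiftStep α h ν) := fun ν =>
    mul_nonneg (shiftWeight_nonneg _ _) (kernelEnvelope_nonneg n.cast_nonneg _)
  rcases le_total (n * δ) 1 with h1 | h1
  · rw [min_eq_right h1]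
    have hle : n * |h| ≤ n * δ := by gcongr
    refine (abs_diffDirichlet_le hα (hle.trans h1) x).trans ?_
    have hx := hs.le_tsum 0 fun ν _ => hnn ν
    rw [shiftWeight_zero, shiftStep_zero, add_zero, one_mul] at hx
    have hk := kernelEnvelope_nonneg n.cast_nonneg x
    gcongr
  · rw [min_eq_left h1, one_rpow, mul_one]
    refine (abs_diffDirichlet_le_tsum hα h n x).trans ?_
    have hx : ∑' ν : ℕ, |diffCoeff α ν| * kernelEnvelope n (x + (α - ν) * h) ≤
        ∑' ν : ℕ, shiftWeight α ν * kernelEnvelope n (x + shiftStep α h ν) := by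
      rw [hs.tsum_eq_zero_add]
      exact le_add_of_nonneg_left (hnn 0)
    have h0 : 0 ≤ ∑' ν : ℕ, |diffCoeff α ν| * kernelEnvelope n (x + (α - ν) * h) :=
      tsum_nonneg fun ν => mul_nonneg (abs_nonneg _) (kernelEnvelope_nonneg n.cast_nonneg _)
    nlinarith

end

section

theorem ENNReal.rpow_tsum_mul_le {ι : Type*} {p : ℝ} (hp : 1 < p) (w g : ι → ℝ≥0∞) :
    (∑' i, w i * g i) ^ p ≤ (∑' i, w i) ^ (p - 1) * ∑' i, w i * g i ^ p := by
  have hp0 : 0 < p := by linarith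
  have h : ∑' i, w i * g i ≤ (∑' i, w i) ^ (1 - p⁻¹) * (∑' i, w i * g i ^ p) ^ p⁻¹ := by
    rw [ENNReal.tsum_eq_iSup_sum]
    refine iSup_le fun s => (ENNReal.inner_le_weight_mul_Lp_of_nonneg s hp.le w g).trans ?_
    have : p⁻¹ ≤ 1 := inv_le_one_of_one_le₀ hp.le
    have : 0 ≤ 1 - p⁻¹ := by linarith
    gcongr <;> exact ENNReal.sum_le_tsum s
  refine (ENNReal.rpow_le_rpow h hp0.le).trans (le_of_eq ?_)
  rw [ENNReal.mul_rpow_of_nonneg _ _ hp0.le, ← ENNReal.rpow_mul, ← ENNReal.rpow_mul,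
    inv_mul_cancel₀ hp0.ne', ENNReal.rpow_one, sub_mul, one_mul, inv_mul_cancel₀ hp0.ne']

theorem lintegral_Ioc_rpow {a r : ℝ} (ha : 0 < a) (hr : -1 < r) :
    ∫⁻ x in Set.Ioc 0 a, ENNReal.ofReal (x ^ r) = ENNReal.ofReal (a ^ (r + 1) / (r + 1)) := by
  have hi := (intervalIntegral.intervalIntegrable_rpow' (a := 0) (b := a) hr)
  rw [intervalIntegrable_iff_integrableOn_Ioc_of_le ha.le] at hi
  rw [← ofReal_integral_eq_lintegral_ofReal hi, ← intervalIntegral.integral_of_le ha.le,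
    integral_rpow (Or.inl hr), zero_rpow (by linarith), sub_zero]
  filter_upwards [ae_restrict_mem measurableSet_Ioc] with x hx
  exact rpow_nonneg hx.1.le _

theorem lintegral_Ioi_rpow {a r : ℝ} (ha : 0 < a) (hr : r < -1) :
    ∫⁻ x in Set.Ioi a, ENNReal.ofReal (x ^ r) = ENNReal.ofReal (a ^ (r + 1) / -(r + 1)) := by
  rw [← ofReal_integral_eq_lintegral_ofReal (integrableOn_Ioi_rpow_of_lt hr ha),
    integral_Ioi_rpow_of_lt hr ha, div_neg, neg_div]
  filter_upwards [ae_restrict_mem measurableSet_Ioi] with x hx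
  exact rpow_nonneg (ha.trans hx).le _

theorem tsum_two_pow_div_le {θ : ℝ} (h0 : 0 < θ) (h1 : θ < 1) :
    ∃ C : ℝ, 0 < C ∧ ∀ t : ℝ, 0 < t → t ≤ 1 →
      ∑' i : ℕ, ENNReal.ofReal ((2 : ℝ) ^ i / (1 + 2 ^ i * t) * ((2 : ℝ) ^ i) ^ (-θ)) ≤
        ENNReal.ofReal (C * t ^ (θ - 1)) := by
  set ρ : ℝ := 2 ^ (1 - θ) with hρ
  set σ : ℝ := 2 ^ (-θ) with hσ
  have hρ1 : 1 < ρ := one_lt_rpow one_lt_two (by linarith)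
  have hσ1 : σ < 1 := rpow_lt_one_of_one_lt_of_neg one_lt_two (by linarith)
  have hσ0 : 0 < σ := by positivity
  have hρ1' : 0 < ρ - 1 := by linarith
  have hσ1' : 0 < 1 - σ := by linarith
  refine ⟨ρ / (ρ - 1) + 1 / (1 - σ), by positivity, fun t ht ht1 => ?_⟩
  have eσ : ∀ i : ℕ, ((2 : ℝ) ^ i) ^ (-θ) = σ ^ i := fun i => by
    rw [← rpow_natCast, ← rpow_mul zero_le_two, mul_comm, rpow_mul zero_le_two, rpow_natCast]
  have eρ : ∀ i : ℕ, ((2 : ℝ) ^ i) ^ (1 - θ) = ρ ^ i := fun i => by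
    rw [← rpow_natCast, ← rpow_mul zero_le_two, mul_comm, rpow_mul zero_le_two, rpow_natCast]
  have eρσ : ∀ i : ℕ, (2 : ℝ) ^ i * σ ^ i = ρ ^ i := fun i => by
    rw [← eσ, ← eρ, sub_eq_add_neg, rpow_add (by positivity), rpow_one]
  set f : ℕ → ℝ := fun i => (2 : ℝ) ^ i / (1 + 2 ^ i * t) * σ ^ i with hf
  have hf0 : ∀ i, 0 ≤ f i := fun i => by simp only [hf]; positivity
  have hf1 : ∀ i, f i ≤ ρ ^ i := fun i => by
    rw [← eρσ]
    simp only [hf]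
    gcongr
    exact div_le_self (by positivity) (le_add_of_nonneg_right (by positivity))
  have hf2 : ∀ i, f i ≤ σ ^ i * t⁻¹ := fun i => by
    simp only [hf]
    rw [mul_comm]
    gcongr
    rw [div_le_iff₀ (by positivity), inv_mul_eq_div, le_div_iff₀ ht]
    linarith
  have hg : Summable fun i => σ ^ i * t⁻¹ := (summable_geometric_of_lt_one hσ0.le hσ1).mul_right _
  have hs : Summable f := Summable.of_nonneg_of_le hf0 hf2 hg
  simp_rw [eσ]
  rw [← ENNReal.ofReal_tsum_of_nonneg hf0 hs]
  refine ENNReal.ofReal_le_ofReal ?_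
  obtain ⟨m, hm1, hm2⟩ := exists_nat_pow_near (one_le_inv₀ ht |>.2 ht1) one_lt_two
  rw [← hs.sum_add_tsum_nat_add (m + 1), add_mul]
  refine add_le_add ?_ ?_
  · calc ∑ i ∈ Finset.range (m + 1), f i ≤ ∑ i ∈ Finset.range (m + 1), ρ ^ i :=
          Finset.sum_le_sum fun i _ => hf1 i
      _ = (ρ ^ (m + 1) - 1) / (ρ - 1) := geom_sum_eq hρ1.ne' _
      _ ≤ ρ ^ (m + 1) / (ρ - 1) := by gcongr; linarith
      _ = ρ / (ρ - 1) * ρ ^ m := by ring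
      _ ≤ ρ / (ρ - 1) * t ^ (θ - 1) := by
          gcongr
          rw [← eρ, show θ - 1 = -(1 - θ) by ring, rpow_neg ht.le, ← inv_rpow ht.le]
          exact rpow_le_rpow (by positivity) hm1 (by linarith)
  · have hg' : Summable fun i => σ ^ (i + (m + 1)) * t⁻¹ :=
      (summable_nat_add_iff (m + 1)).2 hg
    calc ∑' i, f (i + (m + 1)) ≤ ∑' i, σ ^ (i + (m + 1)) * t⁻¹ :=
          ((summable_nat_add_iff (m + 1)).2 hs).tsum_le_tsum (fun i => hf2 _) hg'
      _ = 1 / (1 - σ) * (σ ^ (m + 1) * t⁻¹) := by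
          simp_rw [pow_add σ _ (m + 1), mul_assoc]
          rw [tsum_mul_right, tsum_geometric_of_lt_one hσ0.le hσ1, one_div]
      _ ≤ 1 / (1 - σ) * t ^ (θ - 1) := by
          gcongr
          rw [← eσ, rpow_sub_one ht.ne', div_eq_mul_inv]
          gcongr
          rw [rpow_neg (by positivity), ← inv_rpow (by positivity)]
          refine rpow_le_rpow (by positivity) ?_ h0.le
          rw [inv_le_comm₀ (by positivity) ht]
          exact hm2.le

theorem lintegral_rpow_mul_kernelEnvelope_half_le {s N : ℝ} (h0 : 0 < s) (h1 : s < 1)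
    (hN : 1 ≤ N) :
    ∫⁻ x in Set.Ioc 0 π, ENNReal.ofReal (|sin (x / 2)| ^ (-s) * kernelEnvelope N x) ≤
      ENNReal.ofReal (π * (1 / (1 - s) + 1 / s) * N ^ s) := by
  have hN0 : 0 < N := by linarith
  have hπ := pi_pos
  have h1s : 0 < 1 - s := by linarith
  set a : ℝ := π / N with ha
  have ha0 : 0 < a := by positivity
  have hsub : Set.Ioc 0 π ⊆ Set.Ioc 0 a ∪ Set.Ioi a ∩ Set.Ioc 0 π := fun x hx => by
    rcases le_or_gt x a with h | h
    · exact Or.inl ⟨hx.1, h⟩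
    · exact Or.inr ⟨h, hx⟩
  have hsin : ∀ x ∈ Set.Ioc 0 π, x / π ≤ |sin (x / 2)| := fun x hx => by
    refine le_trans ?_ (le_abs_self _)
    have := mul_le_sin (show 0 ≤ x / 2 by linarith [hx.1]) (by linarith [hx.2])
    refine le_trans (le_of_eq ?_) this
    field_simp
  have hpow : ∀ x ∈ Set.Ioc 0 π, |sin (x / 2)| ^ (-s) ≤ π ^ s * x ^ (-s) := fun x hx => by
    have hx0 := hx.1
    refine (rpow_le_rpow_of_nonpos (by positivity) (hsin x hx) (by linarith)).trans (le_of_eq ?_)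
    rw [div_rpow hx0.le hπ.le, rpow_neg hπ.le, div_inv_eq_mul, mul_comm]
  refine (lintegral_mono_set hsub).trans ((lintegral_union_le _ _ _).trans ?_)
  have b1 : ∫⁻ x in Set.Ioc 0 a, ENNReal.ofReal (|sin (x / 2)| ^ (-s) * kernelEnvelope N x) ≤
      ENNReal.ofReal (π * (1 / (1 - s)) * N ^ s) := by
    calc _ ≤ ∫⁻ x in Set.Ioc 0 a, ENNReal.ofReal (N * π ^ s) * ENNReal.ofReal (x ^ (-s)) := by
          refine setLIntegral_mono' measurableSet_Ioc fun x hx => ?_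
          rw [← ENNReal.ofReal_mul (by positivity)]
          refine ENNReal.ofReal_le_ofReal ?_
          have hx' : x ∈ Set.Ioc 0 π := ⟨hx.1, hx.2.trans (div_le_self hπ.le hN)⟩
          have := mul_le_mul (hpow x hx') (kernelEnvelope_le hN0.le x)
            (kernelEnvelope_nonneg hN0.le x)
            (mul_nonneg (by positivity) (rpow_nonneg hx.1.le _))
          linarith
      _ = _ := by
          rw [lintegral_const_mul' _ _ ENNReal.ofReal_ne_top, lintegral_Ioc_rpow ha0 (by linarith),
            ← ENNReal.ofReal_mul (by positivity)]
          congr 1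
          rw [ha, div_rpow hπ.le hN0.le, show -s + 1 = 1 - s by ring, rpow_sub hπ, rpow_sub hN0,
            rpow_one, rpow_one]
          field_simp
  have b2 : ∫⁻ x in Set.Ioi a ∩ Set.Ioc 0 π,
      ENNReal.ofReal (|sin (x / 2)| ^ (-s) * kernelEnvelope N x) ≤
      ENNReal.ofReal (π * (1 / s) * N ^ s) := by
    calc _ ≤ ∫⁻ x in Set.Ioi a ∩ Set.Ioc 0 π,
          ENNReal.ofReal (π * π ^ s) * ENNReal.ofReal (x ^ (-s - 1)) := by
          refine setLIntegral_mono' (measurableSet_Ioi.inter measurableSet_Ioc) fun x hx => ?_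
          rw [← ENNReal.ofReal_mul (by positivity)]
          refine ENNReal.ofReal_le_ofReal ?_
          have hx0 := hx.2.1
          have hk : kernelEnvelope N x ≤ π / x := by
            have := hsin x hx.2
            rw [div_le_iff₀ hπ] at this
            unfold kernelEnvelope
            rw [div_le_div_iff₀ (by positivity) hx0]
            nlinarith
          have := mul_le_mul (hpow x hx.2) hk (kernelEnvelope_nonneg hN0.le x)
            (mul_nonneg (by positivity) (rpow_nonneg hx0.le _))
          refine this.trans (le_of_eq ?_)
          rw [rpow_sub_one hx0.ne']
          ring
      _ ≤ ∫⁻ x in Set.Ioi a, ENNReal.ofReal (π * π ^ s) * ENNReal.ofReal (x ^ (-s - 1)) :=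
          lintegral_mono_set Set.inter_subset_left
      _ = _ := by
          rw [lintegral_const_mul' _ _ ENNReal.ofReal_ne_top, lintegral_Ioi_rpow ha0 (by linarith),
            ← ENNReal.ofReal_mul (by positivity)]
          congr 1
          rw [ha, show -s - 1 + 1 = -s by ring, div_rpow hπ.le hN0.le, rpow_neg hπ.le,
            rpow_neg hN0.le]
          have : (0 : ℝ) < π ^ s := by positivity
          have : (0 : ℝ) < N ^ s := by positivity
          field_simp
  refine (add_le_add b1 b2).trans (le_of_eq ?_)
  rw [← ENNReal.ofReal_add (by positivity) (by positivity)]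
  ring_nf

theorem lintegral_rpow_mul_kernelEnvelope_le {s N : ℝ} (h0 : 0 < s) (h1 : s < 1)
    (hN : 1 ≤ N) :
    ∫⁻ x in Set.Ioc 0 (2 * π), ENNReal.ofReal (|sin (x / 2)| ^ (-s) * kernelEnvelope N x) ≤
      ENNReal.ofReal (2 * (π * (1 / (1 - s) + 1 / s)) * N ^ s) := by
  set F : ℝ → ℝ≥0∞ := fun x => ENNReal.ofReal (|sin (x / 2)| ^ (-s) * kernelEnvelope N x) with hF
  have hsymm : ∀ x, F (2 * π - x) = F x := fun x => by
    simp only [hF, kernelEnvelope]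
    rw [show (2 * π - x) / 2 = π - x / 2 by ring, sin_pi_sub]
  have hsub : Set.Ioc 0 (2 * π) ⊆ Set.Ioc 0 π ∪ Set.Ioc π (2 * π) := fun x hx => by
    rcases le_or_gt x π with h | h
    · exact Or.inl ⟨hx.1, h⟩
    · exact Or.inr ⟨h, hx.2⟩
  have hrefl : ∫⁻ x in Set.Ioc π (2 * π), F x = ∫⁻ x in Set.Ioc 0 π, F x := by
    have hmp := Measure.measurePreserving_sub_left (volume : Measure ℝ) (2 * π)
    have hme : MeasurableEmbedding fun x : ℝ => 2 * π - x :=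
      (MeasurableEquiv.subLeft (2 * π)).measurableEmbedding
    rw [← hmp.setLIntegral_comp_preimage_emb hme]
    simp_rw [hsymm]
    rw [Set.preimage_const_sub_Ioc, restrict_Ico_eq_restrict_Ioc, sub_self,
      show 2 * π - π = π by ring]
  have hNs : 0 ≤ N ^ s := by positivity
  have h1s : 0 < 1 - s := by linarith
  have hπ := pi_pos
  refine (lintegral_mono_set hsub).trans ((lintegral_union_le _ _ _).trans ?_)
  rw [hrefl]
  have hh := lintegral_rpow_mul_kernelEnvelope_half_le h0 h1 hN
  refine (add_le_add hh hh).trans (le_of_eq ?_)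
  rw [← ENNReal.ofReal_add (by positivity) (by positivity)]
  ring_nf

theorem exists_kernelEnvelope_weights {p : ℝ} (hp : 1 < p) :
    ∃ C : ℝ, 0 < C ∧ ∃ (e E : ℕ → ℝ≥0∞) (F : ℕ → ℝ → ℝ≥0∞), (∀ i, e i * E i = 1) ∧
      (∀ i, Measurable (F i)) ∧
      (∀ x ∈ Set.Ioo 0 (2 * π), ∀ i,
        (∑' k, ENNReal.ofReal (kernelEnvelope (2 ^ k) x) * e k) ^ (p - 1) *
          (ENNReal.ofReal (kernelEnvelope (2 ^ i) x) * e i) * E i ^ p ≤ F i x) ∧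
      ∀ i, ∫⁻ x in Set.Ioc 0 (2 * π), F i x ≤ ENNReal.ofReal (C * (2 ^ i) ^ (p - 1)) := by
  have hp0 : 0 < p := by linarith
  set θ : ℝ := 1 - p⁻¹ with hθ
  have hpi : p⁻¹ < 1 := inv_lt_one_of_one_lt₀ hp
  have hθ0 : 0 < θ := by linarith
  have hpi0 : 0 < p⁻¹ := by positivity
  have hθ1 : θ < 1 := by linarith
  have hθp : θ * p = p - 1 := by rw [hθ, sub_mul, inv_mul_cancel₀ hp0.ne', one_mul]
  obtain ⟨K, hK, hKt⟩ := tsum_two_pow_div_le hθ0 hθ1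
  set A : ℝ := 2 * (π * (1 / (1 - θ) + 1 / θ)) with hA
  have hA0 : 0 < A := by
    have : 0 < 1 - θ := by linarith
    have := pi_pos
    positivity
  refine ⟨K ^ (p - 1) * A, by positivity, fun i => ENNReal.ofReal ((2 ^ i) ^ (-θ)),
    fun i => ENNReal.ofReal ((2 ^ i) ^ θ),
    fun i x => ENNReal.ofReal (K ^ (p - 1) * (2 ^ i) ^ (p - 1 - θ)) *
      ENNReal.ofReal (|sin (x / 2)| ^ (-θ) * kernelEnvelope (2 ^ i) x), fun i => ?_, fun i => ?_,
    fun x hx i => ?_, fun i => ?_⟩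
  · rw [← ENNReal.ofReal_mul (by positivity), ← rpow_add (by positivity), neg_add_cancel,
      rpow_zero, ENNReal.ofReal_one]
  · have := (continuous_kernelEnvelope (N := 2 ^ i) (by positivity)).measurable
    fun_prop
  · have hs : 0 < |sin (x / 2)| :=
      abs_pos.2 (sin_pos_of_pos_of_lt_pi (by linarith [hx.1]) (by linarith [hx.2])).ne'
    have h1 := hKt _ hs (abs_sin_le_one _)
    have h2 : (∑' k : ℕ, ENNReal.ofReal (kernelEnvelope (2 ^ k) x) *
        ENNReal.ofReal ((2 ^ k) ^ (-θ))) ^ (p - 1) ≤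
        ENNReal.ofReal (K ^ (p - 1) * |sin (x / 2)| ^ (-θ)) := by
      refine (ENNReal.rpow_le_rpow (le_trans (le_of_eq ?_) h1) (by linarith)).trans (le_of_eq ?_)
      · refine tsum_congr fun k => ?_
        rw [← ENNReal.ofReal_mul (kernelEnvelope_nonneg (by positivity) _)]
        rfl
      · rw [ENNReal.ofReal_rpow_of_nonneg (by positivity) (by linarith),
          mul_rpow hK.le (by positivity), ← rpow_mul hs.le]
        congr 3
        rw [mul_sub, mul_one, sub_mul, hθp]
        ring
    refine (mul_le_mul_left (mul_le_mul_left h2 _) _).trans (le_of_eq ?_)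
    have hk := kernelEnvelope_nonneg (N := 2 ^ i) (by positivity) x
    beta_reduce
    rw [ENNReal.ofReal_rpow_of_nonneg (by positivity) hp0.le, ← rpow_mul (by positivity), hθp,
      ← ENNReal.ofReal_mul (by positivity), ← ENNReal.ofReal_mul (by positivity),
      ← ENNReal.ofReal_mul (by positivity), ← ENNReal.ofReal_mul (by positivity),
      show p - 1 - θ = -θ + (p - 1) by ring, rpow_add (by positivity)]
    congr 1
    ring
  · rw [lintegral_const_mul' _ _ ENNReal.ofReal_ne_top]
    refine (mul_le_mul_right (lintegral_rpow_mul_kernelEnvelope_le hθ0 hθ1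
      (one_le_pow₀ one_le_two)) _).trans (le_of_eq ?_)
    have e : ((2 : ℝ) ^ i) ^ (p - 1 - θ) * (2 ^ i) ^ θ = (2 ^ i) ^ (p - 1) := by
      rw [← rpow_add (by positivity), sub_add_cancel]
    rw [← ENNReal.ofReal_mul (by positivity), ← e]
    simp only [hA]
    congr 1
    ring

theorem lintegral_tsum_kernelEnvelope_le {p : ℝ} (hp : 1 < p) :
    ∃ C : ℝ, 0 < C ∧ ∀ b : ℕ × ℕ → ℝ≥0∞,
      ∫⁻ x in Set.Ioc 0 (2 * π), ∫⁻ y in Set.Ioc 0 (2 * π),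
        (∑' i, b i * (ENNReal.ofReal (kernelEnvelope (2 ^ i.1) x) *
          ENNReal.ofReal (kernelEnvelope (2 ^ i.2) y))) ^ p ≤
      ENNReal.ofReal C * ∑' i, b i ^ p * ENNReal.ofReal ((2 ^ i.1 * 2 ^ i.2) ^ (p - 1)) := by
  have hp0 : 0 < p := by linarith
  obtain ⟨C, hC, e, E, F, heE, hFm, hF, hFi⟩ := exists_kernelEnvelope_weights hp
  refine ⟨C * C, by positivity, fun b => ?_⟩
  have key : ∀ x ∈ Set.Ioo 0 (2 * π), ∀ y ∈ Set.Ioo 0 (2 * π),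
      (∑' i, b i * (ENNReal.ofReal (kernelEnvelope (2 ^ i.1) x) *
          ENNReal.ofReal (kernelEnvelope (2 ^ i.2) y))) ^ p ≤
        ∑' i, b i ^ p * (F i.1 x * F i.2 y) := by
    intro x hx y hy
    set u : ℕ → ℝ≥0∞ := fun i => ENNReal.ofReal (kernelEnvelope (2 ^ i) x) * e i with hu
    set v : ℕ → ℝ≥0∞ := fun i => ENNReal.ofReal (kernelEnvelope (2 ^ i) y) * e i with hv
    have h1 := ENNReal.rpow_tsum_mul_le hp (fun i : ℕ × ℕ => u i.1 * v i.2)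
      (fun i : ℕ × ℕ => b i * (E i.1 * E i.2))
    have h2 : ∑' i : ℕ × ℕ, u i.1 * v i.2 = (∑' i, u i) * ∑' j, v j := by
      rw [ENNReal.tsum_prod (f := fun i j => u i * v j)]
      simp_rw [ENNReal.tsum_mul_left, ENNReal.tsum_mul_right]
    rw [h2, ENNReal.mul_rpow_of_nonneg _ _ (by linarith : 0 ≤ p - 1), ← ENNReal.tsum_mul_left] at h1
    refine le_trans (le_of_eq ?_) (h1.trans (ENNReal.tsum_le_tsum fun i => ?_))
    · congr 1
      refine tsum_congr fun i => ?_
      simp only [hu, hv]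
      calc _ = b i * (ENNReal.ofReal (kernelEnvelope (2 ^ i.1) x) *
          ENNReal.ofReal (kernelEnvelope (2 ^ i.2) y)) * ((e i.1 * E i.1) * (e i.2 * E i.2)) := by
            rw [heE, heE, mul_one, mul_one]
        _ = _ := by ring
    · rw [ENNReal.mul_rpow_of_nonneg _ _ hp0.le, ENNReal.mul_rpow_of_nonneg _ _ hp0.le]
      calc _ = b i ^ p * (((∑' k, u k) ^ (p - 1) * u i.1 * E i.1 ^ p) *
            ((∑' k, v k) ^ (p - 1) * v i.2 * E i.2 ^ p)) := by ring
        _ ≤ _ := by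
          gcongr
          · exact hF x hx i.1
          · exact hF y hy i.2
  rw [← restrict_Ioo_eq_restrict_Ioc]
  calc _ ≤ ∫⁻ x in Set.Ioo 0 (2 * π), ∫⁻ y in Set.Ioo 0 (2 * π),
        ∑' i, b i ^ p * (F i.1 x * F i.2 y) :=
        setLIntegral_mono' measurableSet_Ioo fun x hx =>
          setLIntegral_mono' measurableSet_Ioo fun y hy => key x hx y hy
    _ = ∑' i, b i ^ p * ((∫⁻ x in Set.Ioo 0 (2 * π), F i.1 x) *
          ∫⁻ y in Set.Ioo 0 (2 * π), F i.2 y) := by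
        have h1 : ∀ x, ∫⁻ y in Set.Ioo 0 (2 * π), ∑' i, b i ^ p * (F i.1 x * F i.2 y) =
            ∑' i, b i ^ p * F i.1 x * ∫⁻ y in Set.Ioo 0 (2 * π), F i.2 y := fun x => by
          rw [lintegral_tsum (f := fun (i : ℕ × ℕ) y => b i ^ p * (F i.1 x * F i.2 y))
            fun i => (((hFm i.2).const_mul _).const_mul _).aemeasurable]
          refine tsum_congr fun i => ?_
          rw [← lintegral_const_mul _ (hFm i.2)]
          simp_rw [mul_assoc]
        simp_rw [h1]
        rw [lintegral_tsum (f := fun (i : ℕ × ℕ) x => b i ^ p * F i.1 x *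
          ∫⁻ y in Set.Ioo 0 (2 * π), F i.2 y) fun i =>
            (((hFm i.1).const_mul _).mul_const _).aemeasurable]
        refine tsum_congr fun i => ?_
        rw [lintegral_mul_const _ ((hFm i.1).const_mul _), lintegral_const_mul _ (hFm i.1), mul_assoc]
    _ ≤ ∑' i, ENNReal.ofReal (C * C) * (b i ^ p * ENNReal.ofReal ((2 ^ i.1 * 2 ^ i.2) ^ (p - 1))) := by
        refine ENNReal.tsum_le_tsum fun i => ?_
        rw [restrict_Ioo_eq_restrict_Ioc]
        calc _ ≤ b i ^ p * (ENNReal.ofReal (C * (2 ^ i.1) ^ (p - 1)) *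
              ENNReal.ofReal (C * (2 ^ i.2) ^ (p - 1))) := by
              gcongr
              · exact hFi _
              · exact hFi _
          _ = _ := by
              rw [← ENNReal.ofReal_mul (by positivity),
                mul_left_comm (ENNReal.ofReal (C * C)), ← ENNReal.ofReal_mul (by positivity),
                mul_rpow (by positivity) (by positivity)]
              congr 2
              ring
    _ = _ := ENNReal.tsum_mul_left

end

section

/-- Lebesgue measure on the period `(0, 2π]`. -/
abbrev periodMeasure : Measure ℝ := volume.restrict (Set.Ioc 0 (2 * π))

/-- Lebesgue measure on the period square `(0, 2π]²`. -/
abbrev squareMeasure : Measure (ℝ × ℝ) := periodMeasure.prod periodMeasure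

/-- `2π`-periodicity in each variable. -/
structure TorusPeriodic {β : Type*} (F : ℝ × ℝ → β) : Prop where
  fst : ∀ x y, F (x + 2 * π, y) = F (x, y)
  snd : ∀ x y, F (x, y + 2 * π) = F (x, y)

theorem TorusPeriodic.comp {β γ : Type*} {F : ℝ × ℝ → β} (hF : TorusPeriodic F) (g : β → γ) :
    TorusPeriodic fun z => g (F z) :=
  ⟨fun x y => by rw [hF.fst], fun x y => by rw [hF.snd]⟩

theorem lintegral_period_add {g : ℝ → ℝ≥0∞} (hg : Function.Periodic g (2 * π)) (s : ℝ) :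
    ∫⁻ x, g (x + s) ∂periodMeasure = ∫⁻ x, g x ∂periodMeasure := by
  have hmp := measurePreserving_add_right (volume : Measure ℝ) s
  have h1 : ∫⁻ x in Set.Ioc 0 (2 * π), g (x + s) = ∫⁻ x in Set.Ioc s (s + 2 * π), g x := by
    have := hmp.setLIntegral_comp_preimage_emb (measurableEmbedding_addRight s) g
      (Set.Ioc s (s + 2 * π))
    simpa using this
  rw [h1]
  have h2 := (isAddFundamentalDomain_Ioc two_pi_pos s).setLIntegral_eq
    (isAddFundamentalDomain_Ioc two_pi_pos 0) g hg.map_vadd_zmultiples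
  simpa using h2

theorem integral_period_add {g : ℝ → ℝ} (hg : Function.Periodic g (2 * π)) (s : ℝ) :
    ∫ x, g (x + s) ∂periodMeasure = ∫ x, g x ∂periodMeasure := by
  rw [← intervalIntegral.integral_of_le two_pi_pos.le,
    ← intervalIntegral.integral_of_le two_pi_pos.le,
    intervalIntegral.integral_comp_add_right, zero_add, add_comm (2 * π) s,
    hg.intervalIntegral_add_eq s 0, zero_add]

theorem lintegral_square_add {F : ℝ × ℝ → ℝ≥0∞} (hm : Measurable F) (hF : TorusPeriodic F)
    (s t : ℝ) :
    ∫⁻ z, F (z.1 + s, z.2 + t) ∂squareMeasure = ∫⁻ z, F z ∂squareMeasure := by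
  rw [lintegral_prod _ (by fun_prop), lintegral_prod _ (by fun_prop)]
  have h1 : ∀ x, ∫⁻ y, F (x + s, y + t) ∂periodMeasure = ∫⁻ y, F (x + s, y) ∂periodMeasure :=
    fun x => lintegral_period_add (g := fun y => F (x + s, y)) (fun y => hF.snd _ _) t
  simp_rw [h1]
  exact lintegral_period_add (g := fun x => ∫⁻ y, F (x, y) ∂periodMeasure)
    (fun x => by simp_rw [hF.fst]) s

theorem integrable_square_add {F : ℝ × ℝ → ℝ} (hm : Measurable F) (hF : TorusPeriodic F)
    (hi : Integrable F squareMeasure) (s t : ℝ) :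
    Integrable (fun z : ℝ × ℝ => F (z.1 + s, z.2 + t)) squareMeasure := by
  refine ⟨(by fun_prop : Measurable fun z : ℝ × ℝ => F (z.1 + s, z.2 + t)).aestronglyMeasurable, ?_⟩
  rw [HasFiniteIntegral, lintegral_square_add hm.enorm (hF.comp _) s t]
  exact hi.2

theorem integral_square_add {F : ℝ × ℝ → ℝ} (hm : Measurable F) (hF : TorusPeriodic F)
    (hi : Integrable F squareMeasure) (s t : ℝ) :
    ∫ z, F (z.1 + s, z.2 + t) ∂squareMeasure = ∫ z, F z ∂squareMeasure := by
  rw [integral_prod _ (integrable_square_add hm hF hi s t), integral_prod _ hi]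
  have h1 : ∀ x, ∫ y, F (x + s, y + t) ∂periodMeasure = ∫ y, F (x + s, y) ∂periodMeasure :=
    fun x => integral_period_add (g := fun y => F (x + s, y)) (fun y => hF.snd _ _) t
  simp_rw [h1]
  exact integral_period_add (g := fun x => ∫ y, F (x, y) ∂periodMeasure)
    (fun x => by simp_rw [hF.fst]) s

theorem lintegral_rpow_tsum_shift_le {ι : Type*} [Countable ι] {p : ℝ} (hp : 1 < p)
    (w : ι → ℝ≥0∞) (s t : ι → ℝ) {G : ℝ × ℝ → ℝ≥0∞} (hm : Measurable G) (hG : TorusPeriodic G) :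
    ∫⁻ z, (∑' k, w k * G (z.1 + s k, z.2 + t k)) ^ p ∂squareMeasure ≤
      (∑' k, w k) ^ p * ∫⁻ z, G z ^ p ∂squareMeasure := by
  have hmk : ∀ k, Measurable fun z : ℝ × ℝ => w k * G (z.1 + s k, z.2 + t k) ^ p := fun k => by
    fun_prop
  calc _ ≤ ∫⁻ z, (∑' k, w k) ^ (p - 1) * ∑' k, w k * G (z.1 + s k, z.2 + t k) ^ p ∂squareMeasure :=
        lintegral_mono fun z => ENNReal.rpow_tsum_mul_le hp _ _
    _ = (∑' k, w k) ^ (p - 1) * ∑' k, w k * ∫⁻ z, G z ^ p ∂squareMeasure := by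
        rw [lintegral_const_mul _ (Measurable.tsum hmk),
          lintegral_tsum fun k => (hmk k).aemeasurable]
        congr 1
        refine tsum_congr fun k => ?_
        rw [lintegral_const_mul _ (by fun_prop),
          lintegral_square_add (F := fun z => G z ^ p) (by fun_prop) (hG.comp (· ^ p))]
    _ = _ := by
        rw [ENNReal.tsum_mul_right, ← mul_assoc]
        congr 1
        nth_rw 2 [← ENNReal.rpow_one (∑' k, w k)]
        rw [← ENNReal.rpow_add_of_nonneg _ _ (by linarith) zero_le_one, sub_add_cancel]

theorem ENNReal.summable_norm_of_tsum_enorm_ne_top {ι : Type*} {u : ι → ℝ}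
    (h : ∑' k, ‖u k‖ₑ ≠ ⊤) : Summable fun k => ‖u k‖ := by
  have := ENNReal.tsum_coe_ne_top_iff_summable.1 h
  exact NNReal.summable_coe.2 this

theorem tsum_enorm_ne_top_of_summable_abs {ι : Type*} {u : ι → ℝ}
    (h : Summable fun k => |u k|) : ∑' k, ‖u k‖ₑ ≠ ⊤ := by
  refine ENNReal.tsum_coe_ne_top_iff_summable.2 (NNReal.summable_coe.1 ?_)
  simpa using h

/-- The sum of weighted translates of a function of two variables. -/
def shiftSum {ι : Type*} (C s t : ι → ℝ) (F : ℝ × ℝ → ℝ) (z : ℝ × ℝ) : ℝ :=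
  ∑' k, C k * F (z.1 + s k, z.2 + t k)

theorem summable_shiftSum_ae {ι : Type*} [Countable ι] {C s t : ι → ℝ}
    (hC : Summable fun k => |C k|) {F : ℝ × ℝ → ℝ} (hm : Measurable F) (hF : TorusPeriodic F)
    (hi : Integrable F squareMeasure) :
    ∀ᵐ z ∂squareMeasure, Summable fun k => ‖C k * F (z.1 + s k, z.2 + t k)‖ := by
  have hmk : ∀ k, Measurable fun z : ℝ × ℝ => ‖C k * F (z.1 + s k, z.2 + t k)‖ₑ := fun k => by
    fun_prop
  have h : ∫⁻ z, ∑' k, ‖C k * F (z.1 + s k, z.2 + t k)‖ₑ ∂squareMeasure ≠ ⊤ := by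
    rw [lintegral_tsum fun k => (hmk k).aemeasurable]
    have : ∀ k, ∫⁻ z, ‖C k * F (z.1 + s k, z.2 + t k)‖ₑ ∂squareMeasure =
        ‖C k‖ₑ * ∫⁻ z, ‖F z‖ₑ ∂squareMeasure := fun k => by
      simp_rw [enorm_mul]
      rw [lintegral_const_mul _ (by fun_prop),
        lintegral_square_add (F := fun z => ‖F z‖ₑ) (by fun_prop) (hF.comp _)]
    simp_rw [this]
    rw [ENNReal.tsum_mul_right]
    exact ENNReal.mul_ne_top (tsum_enorm_ne_top_of_summable_abs hC) hi.2.ne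
  filter_upwards [ae_lt_top (Measurable.tsum hmk) h] with z hz
  exact ENNReal.summable_norm_of_tsum_enorm_ne_top hz.ne

theorem aemeasurable_shiftSum {ι : Type*} [Countable ι] {C s t : ι → ℝ}
    (hC : Summable fun k => |C k|) {F : ℝ × ℝ → ℝ} (hm : Measurable F) (hF : TorusPeriodic F)
    (hi : Integrable F squareMeasure) : AEMeasurable (shiftSum C s t F) squareMeasure := by
  refine aemeasurable_of_tendsto_metrizable_ae (Filter.atTop : Filter (Finset ι))
    (f := fun S z => ∑ k ∈ S, C k * F (z.1 + s k, z.2 + t k)) (fun S => ?_) ?_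
  · exact (Finset.measurable_fun_sum _ fun k _ => by fun_prop).aemeasurable
  · filter_upwards [summable_shiftSum_ae (s := s) (t := t) hC hm hF hi] with z hz
    exact hz.of_norm.hasSum

theorem lintegral_rpow_shiftSum_le {ι : Type*} [Countable ι] {p : ℝ} (hp : 1 < p)
    {C s t : ι → ℝ} {F : ℝ × ℝ → ℝ} (hm : Measurable F)
    (hF : TorusPeriodic F) :
    ∫⁻ z, ‖shiftSum C s t F z‖ₑ ^ p ∂squareMeasure ≤
      (∑' k, ‖C k‖ₑ) ^ p * ∫⁻ z, ‖F z‖ₑ ^ p ∂squareMeasure := by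
  refine le_trans (lintegral_mono fun z => ?_) (lintegral_rpow_tsum_shift_le hp (fun k => ‖C k‖ₑ) s t
    (G := fun z => ‖F z‖ₑ) (by fun_prop) (hF.comp _))
  refine ENNReal.rpow_le_rpow ?_ (by linarith)
  refine enorm_tsum_le_tsum_enorm.trans (le_of_eq (tsum_congr fun k => enorm_mul _ _))

theorem integral_shiftSum_mul {ι : Type*} [Countable ι] {C s t : ι → ℝ}
    (hC : Summable fun k => |C k|) {F : ℝ × ℝ → ℝ} (hm : Measurable F) (hF : TorusPeriodic F)
    (hi : Integrable F squareMeasure) {g : ℝ × ℝ → ℝ} (hg : Measurable g) {B : ℝ}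
    (hB : ∀ z, |g z| ≤ B) :
    ∫ z, shiftSum C s t F z * g z ∂squareMeasure =
      ∑' k, C k * ∫ z, F (z.1 + s k, z.2 + t k) * g z ∂squareMeasure := by
  have hik : ∀ k, Integrable (fun z : ℝ × ℝ => F (z.1 + s k, z.2 + t k) * g z) squareMeasure :=
    fun k => (integrable_square_add hm hF hi _ _).mul_bdd (c := B) hg.aestronglyMeasurable
      (Filter.Eventually.of_forall hB)
  have h := hasSum_integral_of_summable_integral_norm (μ := squareMeasure)
    (F := fun k (z : ℝ × ℝ) => C k * (F (z.1 + s k, z.2 + t k) * g z))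
    (fun k => (hik k).const_mul _) ?_
  · have h2 := h.tsum_eq
    simp_rw [integral_const_mul] at h2
    rw [h2]
    refine integral_congr_ae (Filter.Eventually.of_forall fun z => ?_)
    simp only [shiftSum]
    rw [← tsum_mul_right]
    simp_rw [mul_assoc]
  · refine Summable.of_nonneg_of_le (fun k => integral_nonneg fun z => norm_nonneg _) (fun k => ?_)
      (hC.mul_right (∫ z, |F z| * B ∂squareMeasure))
    simp_rw [norm_mul, norm_eq_abs]
    rw [integral_const_mul]
    refine mul_le_mul_of_nonneg_left ?_ (abs_nonneg _)
    rw [← integral_square_add (F := fun z => |F z| * B) (by fun_prop) (hF.comp (fun u => |u| * B))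
      (hi.abs.mul_const B) (s k) (t k)]
    refine integral_mono_of_nonneg (Filter.Eventually.of_forall fun z => by positivity)
      (((integrable_square_add hm hF hi _ _).abs).mul_const B)
      (Filter.Eventually.of_forall fun z => ?_)
    exact mul_le_mul_of_nonneg_left (hB z) (abs_nonneg _)

end

section

theorem cos_nat_mul_add_two_pi (n : ℕ) (x ψ : ℝ) :
    cos (n * (x + 2 * π) + ψ) = cos (n * x + ψ) := by
  rw [show n * (x + 2 * π) + ψ = n * x + ψ + n * (2 * π) by ring, cos_add_nat_mul_two_pi]

/-- All moments of `F` against `cos (n x + ψ) cos (m y + φ)` are those of the pure cosine series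
with coefficients `a`. -/
def HasCosCoeff (F : ℝ × ℝ → ℝ) (a : ℕ → ℕ → ℝ) : Prop :=
  ∀ (n m : ℕ) (ψ φ : ℝ), ∫ z, F z * (cos (n * z.1 + ψ) * cos (m * z.2 + φ)) ∂squareMeasure =
    π ^ 2 * a n m * (cos ψ * cos φ)

theorem abs_cos_mul_cos_le (x y : ℝ) : |cos x * cos y| ≤ 1 := by
  rw [abs_mul]
  exact mul_le_one₀ (abs_cos_le_one _) (abs_nonneg _) (abs_cos_le_one _)

theorem integrable_mul_cos_mul_cos {F : ℝ × ℝ → ℝ} (hi : Integrable F squareMeasure)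
    (n m : ℕ) (ψ φ : ℝ) :
    Integrable (fun z : ℝ × ℝ => F z * (cos (n * z.1 + ψ) * cos (m * z.2 + φ))) squareMeasure :=
  hi.mul_bdd (c := 1) (by fun_prop : Measurable fun z : ℝ × ℝ =>
    cos (n * z.1 + ψ) * cos (m * z.2 + φ)).aestronglyMeasurable
    (Filter.Eventually.of_forall fun _ => abs_cos_mul_cos_le _ _)

theorem HasCosCoeff.integral_shift {F : ℝ × ℝ → ℝ} {a : ℕ → ℕ → ℝ} (h : HasCosCoeff F a)
    (hm : Measurable F) (hF : TorusPeriodic F) (hi : Integrable F squareMeasure) (n m : ℕ)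
    (ψ φ s t : ℝ) :
    ∫ z : ℝ × ℝ, F (z.1 + s, z.2 + t) * (cos (n * z.1 + ψ) * cos (m * z.2 + φ)) ∂squareMeasure =
      π ^ 2 * a n m * (cos (ψ - n * s) * cos (φ - m * t)) := by
  rw [← h n m, ← integral_square_add (F := fun z => F z * (cos (n * z.1 + (ψ - n * s)) *
    cos (m * z.2 + (φ - m * t)))) (by fun_prop)
    ⟨fun x y => by simp only [hF.fst, cos_nat_mul_add_two_pi],
      fun x y => by simp only [hF.snd, cos_nat_mul_add_two_pi]⟩
    (integrable_mul_cos_mul_cos hi _ _ _ _) s t]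
  refine integral_congr_ae (Filter.Eventually.of_forall fun z => ?_)
  beta_reduce
  congr 3 <;> ring

theorem HasCosCoeff.integral_shiftSum {ι : Type*} [Countable ι] {C s t : ι → ℝ}
    (hC : Summable fun k => |C k|) {F : ℝ × ℝ → ℝ} {a : ℕ → ℕ → ℝ} (h : HasCosCoeff F a)
    (hm : Measurable F) (hF : TorusPeriodic F) (hi : Integrable F squareMeasure) (n m : ℕ)
    (ψ φ : ℝ) :
    ∫ z, shiftSum C s t F z * (cos (n * z.1 + ψ) * cos (m * z.2 + φ)) ∂squareMeasure =
      π ^ 2 * a n m * ∑' k, C k * (cos (ψ - n * s k) * cos (φ - m * t k)) := by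
  rw [integral_shiftSum_mul hC hm hF hi (by fun_prop) (fun z => abs_cos_mul_cos_le _ _)]
  simp_rw [h.integral_shift hm hF hi]
  rw [← tsum_mul_left]
  refine tsum_congr fun k => by ring

/-- The mixed fractional difference as one sum of weighted translates. -/
def mixedDiff (α₁ α₂ h₁ h₂ : ℝ) : (ℝ × ℝ → ℝ) → ℝ × ℝ → ℝ :=
  shiftSum (fun k : ℕ × ℕ => diffCoeff α₁ k.1 * diffCoeff α₂ k.2)
    (fun k => (α₁ - k.1) * h₁) (fun k => (α₂ - k.2) * h₂)

/-- The Fourier multiplier of the fractional difference, with a phase. -/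
def diffMult (α h : ℝ) (n : ℕ) (ψ : ℝ) : ℝ :=
  ∑' ν : ℕ, diffCoeff α ν * cos (ψ - n * ((α - ν) * h))

theorem summable_mixedCoeff {α₁ α₂ : ℝ} (h1 : 0 < α₁) (h2 : 0 < α₂) :
    Summable fun k : ℕ × ℕ => |diffCoeff α₁ k.1 * diffCoeff α₂ k.2| := by
  simp_rw [abs_mul]
  exact (summable_abs_diffCoeff h1).mul_of_nonneg (summable_abs_diffCoeff h2)
    (fun _ => abs_nonneg _) (fun _ => abs_nonneg _)

theorem HasCosCoeff.integral_mixedDiff {α₁ α₂ : ℝ} (h1 : 0 < α₁) (h2 : 0 < α₂) (h₁ h₂ : ℝ)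
    {F : ℝ × ℝ → ℝ} {a : ℕ → ℕ → ℝ} (h : HasCosCoeff F a)
    (hm : Measurable F) (hF : TorusPeriodic F) (hi : Integrable F squareMeasure) (n m : ℕ)
    (ψ φ : ℝ) :
    ∫ z, mixedDiff α₁ α₂ h₁ h₂ F z * (cos (n * z.1 + ψ) * cos (m * z.2 + φ)) ∂squareMeasure =
      π ^ 2 * a n m * (diffMult α₁ h₁ n ψ * diffMult α₂ h₂ m φ) := by
  rw [mixedDiff, h.integral_shiftSum (summable_mixedCoeff h1 h2) hm hF hi, diffMult, diffMult,
    tsum_mul_tsum_of_summable_norm (summable_diffCoeff_mul_cos h1 _).norm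
      (summable_diffCoeff_mul_cos h2 _).norm]
  congr 1
  refine tsum_congr fun k => by ring

theorem diffX_diffY_eq_mixedDiff {α₁ α₂ h₁ h₂ : ℝ} {f : ℝ → ℝ → ℝ} {z : ℝ × ℝ}
    (hs : Summable fun k : ℕ × ℕ => diffCoeff α₁ k.1 * diffCoeff α₂ k.2 *
      Function.uncurry f (z.1 + (α₁ - k.1) * h₁, z.2 + (α₂ - k.2) * h₂)) :
    diffX α₁ h₁ (diffY α₂ h₂ f) z.1 z.2 = mixedDiff α₁ α₂ h₁ h₂ (Function.uncurry f) z := by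
  rw [mixedDiff, shiftSum, hs.tsum_prod]
  simp only [diffX, diffY]
  refine tsum_congr fun ν => ?_
  rw [← tsum_mul_left]
  refine tsum_congr fun μ => ?_
  simp only [diffCoeff, Function.uncurry]
  ring

theorem Lp2Norm_eq {p : ℝ} (hp : 0 < p) {f : ℝ → ℝ → ℝ} {u : ℝ × ℝ → ℝ}
    (hu : AEMeasurable u squareMeasure) (h : ∀ᵐ z ∂squareMeasure, f z.1 z.2 = u z) :
    Lp2Norm p f = (∫⁻ z, ‖u z‖ₑ ^ p ∂squareMeasure) ^ (1 / p) := by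
  have hf : AEMeasurable (fun z : ℝ × ℝ => f z.1 z.2) squareMeasure := hu.congr (by
    filter_upwards [h] with z hz using hz.symm)
  have h1 : ∫⁻ z, ‖u z‖ₑ ^ p ∂squareMeasure = ∫⁻ z, ‖f z.1 z.2‖ₑ ^ p ∂squareMeasure :=
    lintegral_congr_ae (by filter_upwards [h] with z hz; rw [hz])
  rw [h1, lintegral_prod _ (hf.enorm.pow_const p), Lp2Norm]
  congr 1
  refine lintegral_congr fun x => lintegral_congr fun y => ?_
  rw [Real.enorm_eq_ofReal_abs, ENNReal.ofReal_rpow_of_nonneg (abs_nonneg _) hp.le]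

theorem Lp2Norm_diff_eq {p α₁ α₂ : ℝ} (hp : 0 < p) (h1 : 0 < α₁) (h2 : 0 < α₂) (h₁ h₂ : ℝ)
    {f : ℝ → ℝ → ℝ} (hm : Measurable (Function.uncurry f))
    (hF : TorusPeriodic (Function.uncurry f)) (hi : Integrable (Function.uncurry f) squareMeasure) :
    Lp2Norm p (diffX α₁ h₁ (diffY α₂ h₂ f)) =
      (∫⁻ z, ‖mixedDiff α₁ α₂ h₁ h₂ (Function.uncurry f) z‖ₑ ^ p ∂squareMeasure) ^ (1 / p) := by
  have hC := summable_mixedCoeff h1 h2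
  refine Lp2Norm_eq hp (aemeasurable_shiftSum hC hm hF hi) ?_
  filter_upwards [summable_shiftSum_ae (s := fun k : ℕ × ℕ => (α₁ - k.1) * h₁)
    (t := fun k : ℕ × ℕ => (α₂ - k.2) * h₂) hC hm hF hi] with z hz
  exact diffX_diffY_eq_mixedDiff hz.of_norm

section MemLp0

variable {p : ℝ} {f : ℝ → ℝ → ℝ}

theorem MemLp0.torusPeriodic (h : MemLp0 p f) : TorusPeriodic (Function.uncurry f) :=
  ⟨fun x y => h.periodic_x y x, fun x y => h.periodic_y x y⟩

theorem MemLp0.lintegral_ne_top (h : MemLp0 p f) (hp : 1 < p) :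
    ∫⁻ z, ‖Function.uncurry f z‖ₑ ^ p ∂squareMeasure ≠ ⊤ := by
  have h1 := h.norm_ne_top
  rw [Lp2Norm_eq (by linarith) h.meas.aemeasurable (Filter.Eventually.of_forall fun _ => rfl)] at h1
  intro h2
  rw [h2, ENNReal.top_rpow_of_pos (by positivity)] at h1
  exact h1 rfl

theorem memLp_of_lintegral_ne_top {X : Type*} [MeasurableSpace X] {μ : Measure X} (hp : 1 < p)
    {u : X → ℝ} (hu : AEMeasurable u μ) (h : ∫⁻ z, ‖u z‖ₑ ^ p ∂μ ≠ ⊤) :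
    MemLp u (ENNReal.ofReal p) μ := by
  refine ⟨hu.aestronglyMeasurable, ?_⟩
  rw [eLpNorm_lt_top_iff_lintegral_rpow_enorm_lt_top (by simp; linarith) (by simp),
    ENNReal.toReal_ofReal (by linarith)]
  exact h.lt_top

theorem integrable_of_lintegral_ne_top {X : Type*} [MeasurableSpace X] {μ : Measure X}
    [IsFiniteMeasure μ] (hp : 1 < p)
    {u : X → ℝ} (hu : AEMeasurable u μ) (h : ∫⁻ z, ‖u z‖ₑ ^ p ∂μ ≠ ⊤) :
    Integrable u μ :=
  (memLp_of_lintegral_ne_top hp hu h).integrable (by simp; linarith)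

theorem MemLp0.integrable (h : MemLp0 p f) (hp : 1 < p) :
    Integrable (Function.uncurry f) squareMeasure :=
  integrable_of_lintegral_ne_top hp h.meas.aemeasurable (h.lintegral_ne_top hp)

/-- Extension of a coefficient array by zero to the axes. -/
def axisZero (a : ℕ → ℕ → ℝ) (n m : ℕ) : ℝ := if n = 0 ∨ m = 0 then 0 else a n m

theorem integral_square_eq {F : ℝ × ℝ → ℝ} (hi : Integrable F squareMeasure) :
    ∫ z, F z ∂squareMeasure = ∫ x in (0:ℝ)..(2*π), ∫ y in (0:ℝ)..(2*π), F (x, y) := by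
  rw [integral_prod _ hi, intervalIntegral.integral_of_le two_pi_pos.le]
  simp_rw [intervalIntegral.integral_of_le two_pi_pos.le]

theorem InMclass.hasCosCoeff {a : ℕ → ℕ → ℝ} (h : InMclass p f a) (hp : 1 < p) :
    HasCosCoeff (Function.uncurry f) (axisZero a) := by
  obtain ⟨hf, hCC, hS, -⟩ := h
  have hi := hf.integrable hp
  have hπ := pi_pos
  intro n m ψ φ
  by_cases hn : n = 0
  · subst hn
    rw [integral_prod_symm _ (integrable_mul_cos_mul_cos hi _ _ _ _)]
    simp only [axisZero, true_or, if_true, mul_zero, zero_mul]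
    refine integral_eq_zero_of_ae ?_
    filter_upwards [ae_restrict_of_ae hf.mean_x] with y hy
    rw [intervalIntegral.integral_of_le two_pi_pos.le] at hy
    simp only [Function.uncurry, CharP.cast_eq_zero, zero_mul, Pi.zero_apply]
    rw [integral_mul_const, hy, zero_mul]
  by_cases hm : m = 0
  · subst hm
    rw [integral_prod _ (integrable_mul_cos_mul_cos hi _ _ _ _)]
    simp only [axisZero, or_true, if_true, mul_zero, zero_mul]
    refine integral_eq_zero_of_ae ?_
    filter_upwards [ae_restrict_of_ae hf.mean_y] with x hx
    rw [intervalIntegral.integral_of_le two_pi_pos.le] at hx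
    simp only [Function.uncurry, CharP.cast_eq_zero, zero_mul, Pi.zero_apply]
    rw [integral_mul_const, hx, zero_mul]
  have hsin : ∀ t : ℝ, sin t = cos (t + -(π / 2)) := fun t => by
    rw [← sub_eq_add_neg, cos_sub_pi_div_two]
  have i1 := integrable_mul_cos_mul_cos hi n m 0 0
  have i2 := integrable_mul_cos_mul_cos hi n m (-(π / 2)) 0
  have i3 := integrable_mul_cos_mul_cos hi n m 0 (-(π / 2))
  have i4 := integrable_mul_cos_mul_cos hi n m (-(π / 2)) (-(π / 2))
  simp_rw [← hsin, add_zero] at i1 i2 i3 i4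
  have e1 := hCC n m (Nat.one_le_iff_ne_zero.2 hn) (Nat.one_le_iff_ne_zero.2 hm)
  obtain ⟨e2, e3, e4⟩ := hS n m
  have hπ2 : (1 / π ^ 2 : ℝ) ≠ 0 := by positivity
  simp only [fourierCC, fourierSC, fourierCS, fourierSS, mul_assoc] at e1 e2 e3 e4
  have q1 := integral_square_eq i1
  have q2 := integral_square_eq i2
  have q3 := integral_square_eq i3
  have q4 := integral_square_eq i4
  simp only [Function.uncurry] at q1 q2 q3 q4
  rw [← q1] at e1
  rw [← q2] at e2
  rw [← q3] at e3
  rw [← q4] at e4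
  have e2' := (mul_eq_zero.1 e2).resolve_left hπ2
  have e3' := (mul_eq_zero.1 e3).resolve_left hπ2
  have e4' := (mul_eq_zero.1 e4).resolve_left hπ2
  simp only [axisZero, hn, hm, or_self, if_false, ← e1]
  have hexp : ∀ z : ℝ × ℝ, Function.uncurry f z * (cos (n * z.1 + ψ) * cos (m * z.2 + φ)) =
      (cos ψ * cos φ) * (Function.uncurry f z * (cos (n * z.1) * cos (m * z.2))) -
      (sin ψ * cos φ) * (Function.uncurry f z * (sin (n * z.1) * cos (m * z.2))) -
      (cos ψ * sin φ) * (Function.uncurry f z * (cos (n * z.1) * sin (m * z.2))) +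
      (sin ψ * sin φ) * (Function.uncurry f z * (sin (n * z.1) * sin (m * z.2))) := fun z => by
    rw [cos_add, cos_add]
    ring
  simp_rw [hexp]
  have j1 := i1.const_mul (cos ψ * cos φ)
  have j2 := i2.const_mul (sin ψ * cos φ)
  have j3 := i3.const_mul (cos ψ * sin φ)
  have j4 := i4.const_mul (sin ψ * sin φ)
  rw [integral_add ?_ j4, integral_sub ?_ j3, integral_sub j1 j2]
  rotate_left
  · exact j1.sub j2
  · exact (j1.sub j2).sub j3
  simp_rw [integral_const_mul]
  simp only [Function.uncurry]
  rw [e2', e3', e4']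
  field_simp
  ring

end MemLp0

end

section

theorem enorm_integral_mul_le {X : Type*} [MeasurableSpace X] {μ : Measure X} {p q : ℝ}
    (hpq : p.HolderConjugate q) {u g : X → ℝ} (hu : AEMeasurable u μ) (hg : AEMeasurable g μ) :
    ‖∫ z, u z * g z ∂μ‖ₑ ≤
      (∫⁻ z, ‖u z‖ₑ ^ p ∂μ) ^ (1 / p) * (∫⁻ z, ‖g z‖ₑ ^ q ∂μ) ^ (1 / q) := by
  refine (enorm_integral_le_lintegral_enorm _).trans ?_
  simp_rw [enorm_mul]
  exact ENNReal.lintegral_mul_le_Lp_mul_Lq μ hpq hu.enorm hg.enorm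

theorem eLpNorm_ofReal_eq {X : Type*} [MeasurableSpace X] {μ : Measure X} {q : ℝ} (hq : 0 < q)
    (g : X → ℝ) : eLpNorm g (ENNReal.ofReal q) μ = (∫⁻ z, ‖g z‖ₑ ^ q ∂μ) ^ (1 / q) := by
  rw [eLpNorm_eq_lintegral_rpow_enorm_toReal (by simpa using hq) (by simp),
    ENNReal.toReal_ofReal hq.le]

theorem lintegral_rpow_le_of_tendsto {X : Type*} [MeasurableSpace X] {μ : Measure X}
    {p q : ℝ} (hpq : p.HolderConjugate q) {𝒢 : Set (X → ℝ)}
    (hmem : ∀ φ ∈ 𝒢, MemLp φ (ENNReal.ofReal q) μ)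
    (hdense : ∀ g, MemLp g (ENNReal.ofReal q) μ → ∀ ε : ℝ≥0∞, ε ≠ 0 →
      ∃ φ ∈ 𝒢, eLpNorm (φ - g) (ENNReal.ofReal q) μ ≤ ε)
    {u : X → ℝ} (hu : MemLp u (ENNReal.ofReal p) μ) {v : ℕ → X → ℝ} {B : ℝ≥0∞}
    (hv : ∀ R, AEMeasurable (v R) μ) (hvB : ∀ R, ∫⁻ z, ‖v R z‖ₑ ^ p ∂μ ≤ B)
    (hlim : ∀ φ ∈ 𝒢, Filter.Tendsto (fun R => ∫ z, v R z * φ z ∂μ) Filter.atTop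
      (nhds (∫ z, u z * φ z ∂μ))) :
    ∫⁻ z, ‖u z‖ₑ ^ p ∂μ ≤ B := by
  have hp := hpq.pos
  have hq := hpq.symm.pos
  have hq1 := hpq.symm.lt
  rcases eq_or_ne B ⊤ with rfl | hB
  · exact le_top
  set T := ∫⁻ z, ‖u z‖ₑ ^ p ∂μ with hT
  have hum := hu.1.aemeasurable
  have hTtop : T ≠ ⊤ := by
    have := hu.2
    rw [eLpNorm_ofReal_eq hp] at this
    exact fun h => by simp [← hT, h, hp] at this
  set g : X → ℝ := fun z => |u z| ^ (p - 2) * u z with hg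
  have hgm : AEMeasurable g μ := by
    exact ((continuous_abs.measurable.comp_aemeasurable hum).pow_const _).mul hum
  have hug : ∀ z, u z * g z = |u z| ^ p := fun z => by
    rcases eq_or_ne (u z) 0 with h | h
    · simp [hg, h, zero_rpow hp.ne']
    · have : |u z| ≠ 0 := abs_ne_zero.2 h
      have h2 : |u z| ^ p = |u z| ^ (p - 2) * |u z| ^ (2 : ℝ) := by
        rw [← rpow_add (abs_pos.2 h), sub_add_cancel]
      rw [h2, rpow_two, sq_abs, hg]
      ring
  have hgq : ∀ z, ‖g z‖ₑ ^ q = ‖u z‖ₑ ^ p := fun z => by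
    rw [enorm_eq_ofReal_abs, enorm_eq_ofReal_abs, ENNReal.ofReal_rpow_of_nonneg (abs_nonneg _) hp.le,
      ENNReal.ofReal_rpow_of_nonneg (abs_nonneg _) hq.le]
    congr 1
    rcases eq_or_ne (u z) 0 with h | h
    · simp [hg, h, zero_rpow hp.ne', zero_rpow hq.ne']
    · have h0 := abs_pos.2 h
      rw [hg, abs_mul, abs_of_nonneg (rpow_nonneg (abs_nonneg _) _), ← rpow_add_one h0.ne',
        ← rpow_mul h0.le]
      congr 1
      have := hpq.sub_one_mul_conj
      linarith
  have hTq : ∫⁻ z, ‖g z‖ₑ ^ q ∂μ = T := by simp_rw [hgq, hT]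
  have hgL : MemLp g (ENNReal.ofReal q) μ :=
    memLp_of_lintegral_ne_top hq1 hgm (by rw [hTq]; exact hTtop)
  have hint : ‖∫ z, u z * g z ∂μ‖ₑ = T := by
    simp_rw [hug]
    have hnn : 0 ≤ ∫ z, |u z| ^ p ∂μ := integral_nonneg fun z => by positivity
    rw [Real.enorm_eq_ofReal hnn, ofReal_integral_eq_lintegral_ofReal]
    · rw [hT]
      refine lintegral_congr fun z => ?_
      rw [enorm_eq_ofReal_abs, ENNReal.ofReal_rpow_of_nonneg (abs_nonneg _) hp.le]
    · have := hu.integrable_norm_rpow (by simpa using hp) (by simp)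
      simpa [ENNReal.toReal_ofReal hp.le] using this
    · exact Filter.Eventually.of_forall fun z => by positivity
  set b := B ^ (1 / p) with hb
  have hbtop : b ≠ ⊤ := ENNReal.rpow_ne_top_of_nonneg (by positivity) hB
  have hUtop : T ^ (1 / p) ≠ ⊤ := ENNReal.rpow_ne_top_of_nonneg (by positivity) hTtop
  have : ENNReal.HolderConjugate (ENNReal.ofReal p) (ENNReal.ofReal q) := hpq.ennrealOfReal
  have hmul : ∀ φ, MemLp φ (ENNReal.ofReal q) μ → Integrable (fun z => u z * φ z) μ := fun φ hφ =>
    hu.integrable_mul hφ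
  have key : ∀ ε : ℝ≥0∞, ε ≠ 0 → T ≤ b * (T ^ (1 / q) + ε) + T ^ (1 / p) * ε := by
    intro ε hε
    obtain ⟨φ, hφ, hφε⟩ := hdense g hgL ε hε
    have hφL := hmem φ hφ
    have h1 : ‖∫ z, u z * φ z ∂μ‖ₑ ≤ b * (T ^ (1 / q) + ε) := by
      refine le_of_tendsto' ((hlim φ hφ).enorm) fun R => ?_
      refine (enorm_integral_mul_le hpq (hv R) hφL.1.aemeasurable).trans ?_
      refine mul_le_mul' (ENNReal.rpow_le_rpow (hvB R) (by positivity)) ?_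
      rw [← eLpNorm_ofReal_eq hq]
      calc eLpNorm φ (ENNReal.ofReal q) μ = eLpNorm (g + (φ - g)) (ENNReal.ofReal q) μ := by
            rw [add_sub_cancel]
        _ ≤ eLpNorm g (ENNReal.ofReal q) μ + eLpNorm (φ - g) (ENNReal.ofReal q) μ :=
            eLpNorm_add_le hgL.1 (hφL.1.sub hgL.1) (by simpa using hq1.le)
        _ ≤ _ := by
            gcongr
            rw [eLpNorm_ofReal_eq hq, hTq]
    have h2 : ‖∫ z, u z * (φ - g) z ∂μ‖ₑ ≤ T ^ (1 / p) * ε := by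
      refine (enorm_integral_mul_le hpq hum (hφL.sub hgL).1.aemeasurable).trans ?_
      rw [← eLpNorm_ofReal_eq hq]
      gcongr
    have h3 : ∫ z, u z * g z ∂μ = ∫ z, u z * φ z ∂μ - ∫ z, u z * (φ - g) z ∂μ := by
      rw [← integral_sub (hmul _ hφL) (hmul _ (hφL.sub hgL))]
      refine integral_congr_ae (Filter.Eventually.of_forall fun z => ?_)
      simp only [Pi.sub_apply]
      ring
    calc T = ‖∫ z, u z * g z ∂μ‖ₑ := hint.symm
      _ = ‖∫ z, u z * φ z ∂μ - ∫ z, u z * (φ - g) z ∂μ‖ₑ := by rw [h3]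
      _ ≤ _ := enorm_sub_le.trans (add_le_add h1 h2)
  have hle : T ≤ b * T ^ (1 / q) := by
    refine ENNReal.le_of_forall_pos_le_add fun ε hε _ => ?_
    have hc : b + T ^ (1 / p) + 1 ≠ ⊤ :=
      ENNReal.add_ne_top.2 ⟨ENNReal.add_ne_top.2 ⟨hbtop, hUtop⟩, ENNReal.one_ne_top⟩
    refine (key (ε / (b + T ^ (1 / p) + 1)) (ENNReal.div_ne_zero.2 ⟨by simpa using hε.ne', hc⟩)).trans ?_
    rw [mul_add, add_assoc, ← add_mul]
    gcongr
    rw [← mul_div_assoc]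
    refine ENNReal.div_le_of_le_mul ?_
    rw [mul_comm]
    exact mul_le_mul' le_rfl le_self_add
  rcases eq_or_ne T 0 with h0 | h0
  · rw [h0]
    exact zero_le
  have hTT : T = T ^ (1 / p) * T ^ (1 / q) := by
    rw [← ENNReal.rpow_add _ _ h0 hTtop, one_div, one_div, hpq.inv_add_inv_eq_one, ENNReal.rpow_one]
  have hq0 : T ^ (1 / q) ≠ 0 := by simp [h0, hTtop]
  have hqt : T ^ (1 / q) ≠ ⊤ := ENNReal.rpow_ne_top_of_nonneg (by positivity) hTtop
  have hfin : T ^ (1 / p) ≤ B ^ (1 / p) := by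
    rw [← ENNReal.mul_le_mul_iff_left hq0 hqt, ← hTT]
    exact hle
  exact (ENNReal.rpow_le_rpow_iff (by positivity)).1 hfin

end

section

instance factTwoPiPos : Fact ((0 : ℝ) < 2 * π) := ⟨Real.two_pi_pos⟩

/-- The two-dimensional torus of period `2π`. -/
abbrev Torus := AddCircle (2 * π) × AddCircle (2 * π)

def torusMk (z : ℝ × ℝ) : Torus := ((z.1 : AddCircle (2 * π)), (z.2 : AddCircle (2 * π)))

def angleCos (n : ℕ) (ψ : ℝ) (x : Real.Angle) : ℝ :=
  Real.Angle.cos (n • x + (ψ : Real.Angle))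

def circleCos (n : ℕ) (ψ : ℝ) : C(AddCircle (2 * π), ℝ) where
  toFun := angleCos n ψ
  continuous_toFun := by
    have h : Continuous fun x : Real.Angle => n • x + (ψ : Real.Angle) :=
      (continuous_nsmul n).add continuous_const
    exact Real.Angle.continuous_cos.comp h

theorem circleCos_coe (n : ℕ) (ψ x : ℝ) : circleCos n ψ (x : AddCircle (2 * π)) = cos (n * x + ψ) := by
  change angleCos n ψ (x : Real.Angle) = _
  unfold angleCos
  rw [← Real.Angle.coe_nsmul, ← Real.Angle.coe_add, Real.Angle.cos_coe, nsmul_eq_mul]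

theorem circleCos_zero_zero (x : AddCircle (2 * π)) : circleCos 0 0 x = 1 := by
  induction x using QuotientAddGroup.induction_on with | H x =>
  rw [circleCos_coe]
  simp

theorem circleCos_mul (n m : ℕ) (ψ φ : ℝ) : ∃ (k : ℕ) (χ : ℝ), circleCos n ψ * circleCos m φ =
    (1 / 2 : ℝ) • (circleCos (n + m) (ψ + φ) + circleCos k χ) := by
  wlog h : m ≤ n generalizing n m ψ φ
  · obtain ⟨k, χ, hk⟩ := this m n φ ψ (by omega)
    exact ⟨k, χ, by
      rw [mul_comm (circleCos n ψ), hk, add_comm m, add_comm φ]⟩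
  refine ⟨n - m, ψ - φ, ?_⟩
  ext x
  induction x using QuotientAddGroup.induction_on with | H x =>
  simp only [ContinuousMap.mul_apply, ContinuousMap.smul_apply, ContinuousMap.add_apply,
    circleCos_coe, smul_eq_mul]
  push_cast [h]
  rw [show ((n:ℝ) + m) * x + (ψ + φ) = (n * x + ψ) + (m * x + φ) by ring,
    show ((n:ℝ) - m) * x + (ψ - φ) = (n * x + ψ) - (m * x + φ) by ring, cos_add (n * x + ψ),
    cos_sub (n * x + ψ)]
  ring

theorem circle_eq_of_circleCos {x y : AddCircle (2 * π)}
    (h : ∀ ψ, circleCos 1 ψ x = circleCos 1 ψ y) : x = y := by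
  induction x using QuotientAddGroup.induction_on with | H x =>
  induction y using QuotientAddGroup.induction_on with | H y =>
  have h0 := h 0
  have h1 := h (-(π / 2))
  simp only [circleCos_coe, Nat.cast_one, one_mul, add_zero, ← sub_eq_add_neg, cos_sub_pi_div_two]
    at h0 h1
  exact Real.Angle.cos_sin_inj h0 h1

/-- The product of two cosine modes on the torus. -/
def torusCos (n m : ℕ) (ψ φ : ℝ) : C(Torus, ℝ) :=
  (circleCos n ψ).comp ContinuousMap.fst * (circleCos m φ).comp ContinuousMap.snd

theorem torusCos_apply (n m : ℕ) (ψ φ : ℝ) (z : Torus) :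
    torusCos n m ψ φ z = circleCos n ψ z.1 * circleCos m φ z.2 := rfl

theorem torusCos_torusMk (n m : ℕ) (ψ φ : ℝ) (z : ℝ × ℝ) :
    torusCos n m ψ φ (torusMk z) = cos (n * z.1 + ψ) * cos (m * z.2 + φ) := by
  rw [torusCos_apply, torusMk, circleCos_coe, circleCos_coe]

def torusTrig : Submodule ℝ C(Torus, ℝ) :=
  Submodule.span ℝ {g | ∃ n m ψ φ, g = torusCos n m ψ φ}

theorem torusCos_mem (n m : ℕ) (ψ φ : ℝ) : torusCos n m ψ φ ∈ torusTrig :=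
  Submodule.subset_span ⟨n, m, ψ, φ, rfl⟩

theorem torusTrig_one_mem : (1 : C(Torus, ℝ)) ∈ torusTrig := by
  have : (1 : C(Torus, ℝ)) = torusCos 0 0 0 0 := by
    ext z
    simp [torusCos_apply, circleCos_zero_zero]
  rw [this]
  exact torusCos_mem 0 0 0 0

theorem torusTrig_mul_mem (f g : C(Torus, ℝ)) (hf : f ∈ torusTrig) (hg : g ∈ torusTrig) :
    f * g ∈ torusTrig := by
  have h := Submodule.mul_mem_mul hf hg
  rw [torusTrig, Submodule.span_mul_span] at h
  refine Submodule.span_le.2 ?_ h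
  rintro _ ⟨_, ⟨n, m, ψ, φ, rfl⟩, _, ⟨n', m', ψ', φ', rfl⟩, rfl⟩
  obtain ⟨k, χ, hk⟩ := circleCos_mul n n' ψ ψ'
  obtain ⟨l, χ', hl⟩ := circleCos_mul m m' φ φ'
  have : torusCos n m ψ φ * torusCos n' m' ψ' φ' = (1 / 4 : ℝ) •
      (torusCos (n + n') (m + m') (ψ + ψ') (φ + φ') + torusCos (n + n') l (ψ + ψ') χ' +
        torusCos k (m + m') χ (φ + φ') + torusCos k l χ χ') := by
    ext z
    have hk' := DFunLike.congr_fun hk z.1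
    have hl' := DFunLike.congr_fun hl z.2
    simp only [ContinuousMap.mul_apply, ContinuousMap.smul_apply, ContinuousMap.add_apply,
      smul_eq_mul] at hk' hl'
    simp only [ContinuousMap.mul_apply, ContinuousMap.smul_apply, ContinuousMap.add_apply,
      smul_eq_mul, torusCos_apply]
    linear_combination (circleCos m φ z.2 * circleCos m' φ' z.2) * hk' +
      (1 / 2) * (circleCos (n + n') (ψ + ψ') z.1 + circleCos k χ z.1) * hl'
  change torusCos n m ψ φ * torusCos n' m' ψ' φ' ∈ torusTrig
  rw [this]
  exact torusTrig.smul_mem _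
    (add_mem (add_mem (add_mem (torusCos_mem _ _ _ _) (torusCos_mem _ _ _ _))
    (torusCos_mem _ _ _ _)) (torusCos_mem _ _ _ _))

theorem exists_mem_torusTrig_norm_sub_lt (f : C(Torus, ℝ)) {ε : ℝ} (hε : 0 < ε) :
    ∃ g ∈ torusTrig, ‖g - f‖ < ε := by
  obtain ⟨g, hg⟩ := ContinuousMap.exists_mem_subalgebra_near_continuousMap_of_separatesPoints
    (torusTrig.toSubalgebra torusTrig_one_mem torusTrig_mul_mem) (by
      intro x y hxy
      by_contra! hcon
      refine hxy (Prod.ext (circle_eq_of_circleCos fun ψ => ?_) (circle_eq_of_circleCos fun φ => ?_))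
      · have := hcon _ ⟨_, torusCos_mem 1 0 ψ 0, rfl⟩
        simpa [torusCos_apply, circleCos_zero_zero] using this
      · have := hcon _ ⟨_, torusCos_mem 0 1 0 φ, rfl⟩
        simpa [torusCos_apply, circleCos_zero_zero] using this) f ε hε
  exact ⟨g, g.2, hg⟩

theorem measurable_torusMk : Measurable torusMk :=
  (AddCircle.measurable_mk'.comp measurable_fst).prodMk (AddCircle.measurable_mk'.comp measurable_snd)

theorem exists_torusTrig_eLpNorm_sub_le {q : ℝ≥0∞} (hq1 : 1 ≤ q) (hq : q ≠ ⊤) {g : ℝ × ℝ → ℝ}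
    (hg : MemLp g q squareMeasure) {ε : ℝ≥0∞} (hε : ε ≠ 0) :
    ∃ φ ∈ torusTrig, eLpNorm ((fun z => φ (torusMk z)) - g) q squareMeasure ≤ ε := by
  obtain ⟨g', hg'm, hgg'⟩ := hg.1
  set ν := squareMeasure.map torusMk with hν
  have hfin : IsFiniteMeasure ν := Measure.isFiniteMeasure_map _ _
  set σ : Torus → ℝ × ℝ := fun w => ((AddCircle.equivIoc (2 * π) 0 w.1 : ℝ),
    (AddCircle.equivIoc (2 * π) 0 w.2 : ℝ)) with hσ
  have hσ1 : Measurable fun w : AddCircle (2 * π) => (AddCircle.equivIoc (2 * π) 0 w : ℝ) :=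
    measurable_subtype_coe.comp (AddCircle.measurableEquivIoc (2 * π) 0).measurable
  have hσm : Measurable σ :=
    (hσ1.comp measurable_fst).prodMk (hσ1.comp measurable_snd)
  have hinv : ∀ x ∈ Set.Ioc 0 (2 * π), (AddCircle.equivIoc (2 * π) 0 (x : AddCircle (2 * π)) : ℝ) = x :=
    fun x hx => by
      have := (AddCircle.equivIoc (2 * π) 0).apply_symm_apply ⟨x, by simpa using hx⟩
      exact congrArg Subtype.val this
  have hσinv : ∀ᵐ z ∂squareMeasure, σ (torusMk z) = z := by
    have : ∀ᵐ z ∂squareMeasure, z ∈ Set.Ioc 0 (2 * π) ×ˢ Set.Ioc 0 (2 * π) := by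
      rw [squareMeasure, periodMeasure, Measure.prod_restrict]
      exact ae_restrict_mem (measurableSet_Ioc.prod measurableSet_Ioc)
    filter_upwards [this] with z hz
    exact Prod.ext (hinv _ hz.1) (hinv _ hz.2)
  have hgσ : (fun w => g' (σ w)) ∘ torusMk =ᵐ[squareMeasure] g := by
    filter_upwards [hσinv, hgg'] with z hz hz'
    simp only [Function.comp_apply]
    rw [hz, hz']
  have hmeas : StronglyMeasurable fun w => g' (σ w) := hg'm.comp_measurable hσm
  have hLp : MemLp (fun w => g' (σ w)) q ν :=
    (memLp_map_measure_iff hmeas.aestronglyMeasurable measurable_torusMk.aemeasurable).2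
      (hg.ae_eq hgσ.symm)
  obtain ⟨c, hc, -⟩ := hLp.exists_boundedContinuous_eLpNorm_sub_le hq
    (ENNReal.half_pos hε).ne'
  obtain ⟨η, hη, hηε⟩ := ENNReal.exists_nnreal_pos_mul_lt
    (a := ν Set.univ ^ q.toReal⁻¹) (b := ε / 2)
    (ENNReal.rpow_ne_top_of_nonneg (by positivity) (measure_ne_top _ _)) (ENNReal.half_pos hε).ne'
  obtain ⟨φ, hφ, hφc⟩ := exists_mem_torusTrig_norm_sub_lt c.toContinuousMap (ε := η) hη
  refine ⟨φ, hφ, ?_⟩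
  have hφm : StronglyMeasurable φ := φ.continuous.stronglyMeasurable
  set cf : Torus → ℝ := fun w => c w with hcf
  have hcm : StronglyMeasurable cf := c.continuous.stronglyMeasurable
  calc eLpNorm ((fun z => φ (torusMk z)) - g) q squareMeasure
      = eLpNorm ((fun w => φ w - g' (σ w)) ∘ torusMk) q squareMeasure := by
        refine eLpNorm_congr_ae ?_
        filter_upwards [hgσ] with z hz
        simp only [Pi.sub_apply, Function.comp_apply] at hz ⊢
        rw [hz]
    _ = eLpNorm ((fun w => φ w) - fun w => g' (σ w)) q ν :=
        (eLpNorm_map_measure (hφm.sub hmeas).aestronglyMeasurable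
          measurable_torusMk.aemeasurable).symm
    _ = eLpNorm (((fun w => φ w) - cf) - ((fun w => g' (σ w)) - cf)) q ν := by
        rw [sub_sub_sub_cancel_right]
    _ ≤ eLpNorm ((fun w => φ w) - cf) q ν + eLpNorm ((fun w => g' (σ w)) - cf) q ν :=
        eLpNorm_sub_le (hφm.sub hcm).aestronglyMeasurable
          (hmeas.sub hcm).aestronglyMeasurable hq1
    _ ≤ ε / 2 + ε / 2 := by
        refine add_le_add ?_ hc
        have hφw : ∀ w, ‖((fun w => φ w) - cf) w‖ ≤ η := fun w =>
          (ContinuousMap.norm_coe_le_norm (φ - c.toContinuousMap) w).trans hφc.le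
        refine (eLpNorm_le_of_ae_bound (C := η) (Filter.Eventually.of_forall hφw)).trans ?_
        rw [mul_comm, ENNReal.ofReal_coe_nnreal]
        exact hηε.le
    _ = ε := ENNReal.add_halves ε

end

section

theorem integrable_mul_continuous_torusMk {u : ℝ × ℝ → ℝ} (hu : Integrable u squareMeasure)
    (φ : C(Torus, ℝ)) : Integrable (fun z => u z * φ (torusMk z)) squareMeasure :=
  hu.mul_bdd (φ.continuous.measurable.comp measurable_torusMk).aestronglyMeasurable
    (c := ‖φ‖) (Filter.Eventually.of_forall fun _ => ContinuousMap.norm_coe_le_norm φ _)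

theorem lintegral_rpow_le_of_tendsto_cos {p : ℝ} (hp : 1 < p) {u : ℝ × ℝ → ℝ}
    (hu : AEMeasurable u squareMeasure) (hut : ∫⁻ z, ‖u z‖ₑ ^ p ∂squareMeasure ≠ ⊤)
    {v : ℕ → ℝ × ℝ → ℝ} {B : ℝ≥0∞} (hv : ∀ R, AEMeasurable (v R) squareMeasure)
    (hvB : ∀ R, ∫⁻ z, ‖v R z‖ₑ ^ p ∂squareMeasure ≤ B)
    (hlim : ∀ (n m : ℕ) (ψ φ : ℝ), Filter.Tendsto
      (fun R => ∫ z, v R z * (cos (n * z.1 + ψ) * cos (m * z.2 + φ)) ∂squareMeasure) Filter.atTop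
      (nhds (∫ z, u z * (cos (n * z.1 + ψ) * cos (m * z.2 + φ)) ∂squareMeasure))) :
    ∫⁻ z, ‖u z‖ₑ ^ p ∂squareMeasure ≤ B := by
  rcases eq_or_ne B ⊤ with rfl | hB
  · exact le_top
  have hui := integrable_of_lintegral_ne_top hp hu hut
  have hvi : ∀ R, Integrable (v R) squareMeasure := fun R =>
    integrable_of_lintegral_ne_top hp (hv R) (ne_top_of_le_ne_top hB (hvB R))
  have hpq := HolderConjugate.conjExponent hp
  set q := conjExponent p with hq
  refine lintegral_rpow_le_of_tendsto hpq (𝒢 := {g | ∃ φ ∈ torusTrig, g = fun z => φ (torusMk z)})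
    ?_ ?_ (memLp_of_lintegral_ne_top hp hu hut) hv hvB ?_
  · rintro _ ⟨φ, -, rfl⟩
    exact MemLp.of_bound (φ.continuous.measurable.comp measurable_torusMk).aestronglyMeasurable
      ‖φ‖ (Filter.Eventually.of_forall fun _ => ContinuousMap.norm_coe_le_norm φ _)
  · intro g hg ε hε
    obtain ⟨φ, hφ, h⟩ := exists_torusTrig_eLpNorm_sub_le
      (by simpa using hpq.symm.lt.le) (by simp) hg hε
    exact ⟨_, ⟨φ, hφ, rfl⟩, h⟩
  · rintro _ ⟨φ, hφ, rfl⟩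
    induction hφ using Submodule.span_induction with
    | mem g hg =>
      obtain ⟨n, m, ψ, φ, rfl⟩ := hg
      simpa only [torusCos_torusMk] using hlim n m ψ φ
    | zero => simp
    | add f g _ _ hf hg =>
      have h : ∀ w, Integrable w squareMeasure →
          ∫ z, w z * (f + g) (torusMk z) ∂squareMeasure =
          ∫ z, w z * f (torusMk z) ∂squareMeasure + ∫ z, w z * g (torusMk z) ∂squareMeasure :=
        fun w hw => by
          rw [← integral_add (integrable_mul_continuous_torusMk hw f)
            (integrable_mul_continuous_torusMk hw g)]
          simp only [ContinuousMap.add_apply, mul_add]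
      simp only [h _ hui, h _ (hvi _)]
      exact hf.add hg
    | smul c f _ hf =>
      have h : ∀ w : ℝ × ℝ → ℝ, ∫ z, w z * (c • f) (torusMk z) ∂squareMeasure =
          c * ∫ z, w z * f (torusMk z) ∂squareMeasure := fun w => by
        rw [← integral_const_mul]
        simp only [ContinuousMap.smul_apply, smul_eq_mul, mul_left_comm]
      simp only [h]
      exact hf.const_mul c

end

section

theorem tendsto_integral_mul_cos_period {g : ℝ → ℝ} (hg : Integrable g periodMeasure) :
    Filter.Tendsto (fun n : ℕ => ∫ x, g x * cos (n * x) ∂periodMeasure) Filter.atTop (nhds 0) := by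
  have h := Real.tendsto_integral_exp_smul_cocompact
    ((Set.Ioc 0 (2 * π)).indicator fun x => (g x : ℂ))
  have hn : Filter.Tendsto (fun n : ℕ => (n : ℝ) / (2 * π)) Filter.atTop (Filter.cocompact ℝ) :=
    (tendsto_natCast_atTop_atTop.atTop_div_const two_pi_pos).mono_right atTop_le_cocompact
  have h2 := (Complex.continuous_re.tendsto _).comp (h.comp hn)
  simp only [Complex.zero_re] at h2
  refine h2.congr fun n => ?_
  simp only [Function.comp_apply]
  have hgi : Integrable (fun x => (g x : ℂ)) periodMeasure := hg.ofReal
  have heq : ∀ v : ℝ, Real.fourierChar (-(v * (n / (2 * π)))) •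
      (Set.Ioc 0 (2 * π)).indicator (fun x => (g x : ℂ)) v =
      (Set.Ioc 0 (2 * π)).indicator (fun x => (g x : ℂ) * Complex.exp ((-(n * x) : ℝ) * Complex.I)) v := by
    intro v
    by_cases hv : v ∈ Set.Ioc 0 (2 * π)
    · rw [Set.indicator_of_mem hv, Set.indicator_of_mem hv, Circle.smul_def, Real.fourierChar_apply,
        smul_eq_mul, mul_comm]
      congr 4
      field_simp
    · rw [Set.indicator_of_notMem hv, Set.indicator_of_notMem hv, smul_zero]
  simp_rw [heq]
  rw [integral_indicator measurableSet_Ioc]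
  have hi : Integrable (fun x => (g x : ℂ) * Complex.exp ((-(n * x) : ℝ) * Complex.I)) periodMeasure := by
    refine hgi.mul_bdd (c := 1) (by fun_prop) (Filter.Eventually.of_forall fun x => ?_)
    rw [Complex.norm_exp_ofReal_mul_I]
  have := Complex.reCLM.integral_comp_comm hi
  simp only [Complex.reCLM_apply] at this
  rw [← this]
  refine integral_congr_ae (Filter.Eventually.of_forall fun x => ?_)
  simp only
  rw [Complex.re_ofReal_mul, Complex.exp_ofReal_mul_I_re, cos_neg]

variable {F : ℝ × ℝ → ℝ} {a : ℕ → ℕ → ℝ}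

theorem HasCosCoeff.tendsto_fst (h : HasCosCoeff F a) (hi : Integrable F squareMeasure) (m : ℕ) :
    Filter.Tendsto (fun n => a n m) Filter.atTop (nhds 0) := by
  have hG := (integrable_mul_cos_mul_cos hi 0 m 0 0).integral_prod_left
  have ht := tendsto_integral_mul_cos_period hG
  have hπ : (π ^ 2 : ℝ) ≠ 0 := by positivity
  have h0 := ht.div_const (π ^ 2)
  rw [zero_div] at h0
  refine h0.congr fun n => ?_
  rw [div_eq_iff hπ]
  have hn := h n m 0 0
  rw [integral_prod _ (integrable_mul_cos_mul_cos hi n m 0 0)] at hn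
  simp only [cos_zero, mul_one, add_zero] at hn
  rw [mul_comm (a n m), ← hn]
  refine integral_congr_ae (Filter.Eventually.of_forall fun x => ?_)
  simp only [Nat.cast_zero, zero_mul, add_zero, cos_zero, one_mul]
  rw [← integral_mul_const]
  refine integral_congr_ae (Filter.Eventually.of_forall fun y => ?_)
  simp only
  ring

theorem HasCosCoeff.swap (h : HasCosCoeff F a) :
    HasCosCoeff (F ∘ Prod.swap) (fun n m => a m n) := by
  intro n m ψ φ
  have h1 := h m n φ ψ
  rw [← integral_prod_swap] at h1
  rw [mul_comm (cos ψ), ← h1]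
  refine integral_congr_ae (Filter.Eventually.of_forall fun z => ?_)
  simp only [Function.comp_apply, Prod.fst_swap, Prod.snd_swap]
  ring

theorem HasCosCoeff.tendsto_snd (h : HasCosCoeff F a) (hi : Integrable F squareMeasure) (n : ℕ) :
    Filter.Tendsto (fun m => a n m) Filter.atTop (nhds 0) :=
  h.swap.tendsto_fst hi.swap n

variable {p : ℝ} {f : ℝ → ℝ → ℝ}

/-- The mixed difference of a double sequence. -/
def mixedDelta (a : ℕ → ℕ → ℝ) (n m : ℕ) : ℝ :=
  a n m - a (n + 1) m - a n (m + 1) + a (n + 1) (m + 1)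

structure MixedMonotone (a : ℕ → ℕ → ℝ) : Prop where
  nonneg : ∀ n m, 1 ≤ n → 1 ≤ m → 0 ≤ a n m
  anti_fst : ∀ n n' m, 1 ≤ n → n ≤ n' → 1 ≤ m → a n' m ≤ a n m
  anti_snd : ∀ n m m', 1 ≤ n → 1 ≤ m → m ≤ m' → a n m' ≤ a n m
  mixedDelta_nonneg : ∀ n m, 1 ≤ n → 1 ≤ m → 0 ≤ mixedDelta a n m
  tendsto_fst : ∀ m, 1 ≤ m → Filter.Tendsto (fun n => a n m) Filter.atTop (nhds 0)
  tendsto_snd : ∀ n, 1 ≤ n → Filter.Tendsto (fun m => a n m) Filter.atTop (nhds 0)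

theorem mixedMonotone_of_tendsto
    (hd : ∀ n m, 1 ≤ n → 1 ≤ m → 0 ≤ mixedDelta a n m)
    (h1 : ∀ m, 1 ≤ m → Filter.Tendsto (fun n => a n m) Filter.atTop (nhds 0))
    (h2 : ∀ n, 1 ≤ n → Filter.Tendsto (fun m => a n m) Filter.atTop (nhds 0)) :
    MixedMonotone a := by
  have key : ∀ s : ℕ → ℝ, (∀ n, 1 ≤ n → s (n + 1) ≤ s n) → ∀ n n', 1 ≤ n → n ≤ n' → s n' ≤ s n := by
    intro s hs n n' hn hnn'
    induction n', hnn' using Nat.le_induction with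
    | base => exact le_rfl
    | succ k hk ih => exact (hs k (hn.trans hk)).trans ih
  have key2 : ∀ s : ℕ → ℝ, (∀ n, 1 ≤ n → s (n + 1) ≤ s n) →
      Filter.Tendsto s Filter.atTop (nhds 0) → ∀ n, 1 ≤ n → 0 ≤ s n := by
    intro s hs ht n hn
    refine le_of_tendsto ht ?_
    filter_upwards [Filter.eventually_ge_atTop n] with k hk
    exact key s hs n k hn hk
  have hA : ∀ n m, 1 ≤ n → 1 ≤ m → a (n + 1) m ≤ a n m := by
    intro n m hn hm
    have := key2 (fun m => a n m - a (n + 1) m) (fun m hm => by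
      have := hd n m hn hm
      unfold mixedDelta at this
      linarith) (by simpa using (h2 n hn).sub (h2 (n + 1) (by omega))) m hm
    simpa using this
  have hB : ∀ n m, 1 ≤ n → 1 ≤ m → a n (m + 1) ≤ a n m := by
    intro n m hn hm
    have := key2 (fun n => a n m - a n (m + 1)) (fun n hn => by
      have := hd n m hn hm
      unfold mixedDelta at this
      linarith) (by simpa using (h1 m hm).sub (h1 (m + 1) (by omega))) n hn
    simpa using this
  exact ⟨fun n m hn hm => key2 (fun n => a n m) (fun n hn => hA n m hn hm) (h1 m hm) n hn,
    fun n n' m hn hnn hm => key (fun n => a n m) (fun n hn => hA n m hn hm) n n' hn hnn,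
    fun n m m' hn hm hmm => key (fun m => a n m) (fun m hm => hB n m hn hm) m m' hm hmm,
    hd, h1, h2⟩

theorem InMclass.mixedMonotone (h : InMclass p f a) (hp : 1 < p) : MixedMonotone a := by
  have hi := h.1.integrable hp
  have hc := h.hasCosCoeff hp
  have hax : ∀ n m, 1 ≤ n → 1 ≤ m → axisZero a n m = a n m := fun n m hn hm =>
    if_neg (by omega)
  refine mixedMonotone_of_tendsto h.2.2.2 (fun m hm => ?_) (fun n hn => ?_)
  · refine (hc.tendsto_fst hi m).congr' ?_
    filter_upwards [Filter.eventually_ge_atTop 1] with n hn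
    exact hax n m hn hm
  · refine (hc.tendsto_snd hi n).congr' ?_
    filter_upwards [Filter.eventually_ge_atTop 1] with m hm
    exact hax n m hn hm

end

section

theorem summable_diffCoeff_mul_sin {α : ℝ} (hα : 0 < α) (u : ℕ → ℝ) :
    Summable fun ν => diffCoeff α ν * sin (u ν) := by
  have := summable_diffCoeff_mul_cos hα fun ν => u ν - π / 2
  simpa only [cos_sub_pi_div_two] using this

theorem tsum_diffCoeff_cos_add {α : ℝ} (hα : 0 < α) (t : ℝ) (u : ℕ → ℝ) :
    ∑' ν, diffCoeff α ν * cos (t + u ν) =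
      (∑' ν, diffCoeff α ν * cos (u ν)) * cos t - (∑' ν, diffCoeff α ν * sin (u ν)) * sin t := by
  rw [← tsum_mul_right, ← tsum_mul_right, ← Summable.tsum_sub
    ((summable_diffCoeff_mul_cos hα _).mul_right _) ((summable_diffCoeff_mul_sin hα _).mul_right _)]
  refine tsum_congr fun ν => ?_
  rw [cos_add]
  ring

theorem integral_cos_mul_period (k : ℕ) (hk : 1 ≤ k) (A : ℝ) :
    ∫ x, cos (k * x + A) ∂periodMeasure = 0 := by
  have hk0 : (k : ℝ) ≠ 0 := by positivity
  rw [← intervalIntegral.integral_of_le two_pi_pos.le,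
    intervalIntegral.integral_comp_mul_add _ hk0, integral_cos, mul_zero, zero_add, add_comm,
    sin_add_nat_mul_two_pi, sub_self, smul_zero]

theorem integral_cos_add_mul_cos_add (k n : ℕ) (hk : 1 ≤ k) (A ψ : ℝ) :
    ∫ x, cos (k * x + A) * cos (n * x + ψ) ∂periodMeasure = if k = n then π * cos (A - ψ) else 0 := by
  have hi : ∀ (c B : ℝ), Integrable (fun x => cos (c * x + B)) periodMeasure := fun c B =>
    (by fun_prop : Continuous fun x : ℝ => cos (c * x + B)).integrableOn_Ioc
  have h1 : ∀ x : ℝ, cos (k * x + A) * cos (n * x + ψ) =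
      (1 / 2) * cos (((k + n : ℕ) : ℝ) * x + (A + ψ)) + (1 / 2) * cos (((k : ℝ) - n) * x + (A - ψ)) := by
    intro x
    push_cast
    rw [show ((k : ℝ) + n) * x + (A + ψ) = (k * x + A) + (n * x + ψ) by ring,
      show ((k : ℝ) - n) * x + (A - ψ) = (k * x + A) - (n * x + ψ) by ring,
      cos_add (k * x + A), cos_sub (k * x + A)]
    ring
  simp_rw [h1]
  rw [integral_add ((hi _ _).const_mul _) ((hi _ _).const_mul _), integral_const_mul,
    integral_const_mul, integral_cos_mul_period _ (by omega)]
  have h2 : ∫ x, cos (((k : ℝ) - n) * x + (A - ψ)) ∂periodMeasure =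
      if k = n then 2 * π * cos (A - ψ) else 0 := by
    rcases lt_trichotomy k n with h | h | h
    · rw [if_neg h.ne, ← integral_cos_mul_period (n - k) (by omega) (ψ - A)]
      refine integral_congr_ae (Filter.Eventually.of_forall fun x => ?_)
      simp only
      rw [← cos_neg]
      push_cast [h.le]
      congr 1
      ring
    · subst h
      simp [two_pi_pos.le]
    · rw [if_neg h.ne', ← integral_cos_mul_period (k - n) (by omega) (A - ψ)]
      push_cast [h.le]
      rfl
  rw [h2]
  split_ifs <;> ring

theorem diffDirichlet_eq_sum {α : ℝ} (hα : 0 < α) (h : ℝ) (N : ℕ) (x : ℝ) :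
    diffDirichlet α h N x = ∑ k ∈ Finset.Ico 1 (N + 1),
      ((∑' ν : ℕ, diffCoeff α ν * cos (k * ((α - ν) * h))) * cos (k * x + 0) -
        (∑' ν : ℕ, diffCoeff α ν * sin (k * ((α - ν) * h))) * cos (k * x + (-(π / 2)))) := by
  rw [diffDirichlet, Finset.sum_Ico_eq_sum_range]
  refine Finset.sum_congr (by simp) fun k _ => ?_
  rw [add_comm 1 k, add_zero, ← sub_eq_add_neg, cos_sub_pi_div_two, ← tsum_diffCoeff_cos_add hα]
  simp only [mul_add]

theorem continuous_diffDirichlet {α : ℝ} (hα : 0 < α) (h : ℝ) (N : ℕ) :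
    Continuous (diffDirichlet α h N) := by
  rw [funext (diffDirichlet_eq_sum hα h N)]
  fun_prop

theorem integral_diffDirichlet_mul_cos {α : ℝ} (hα : 0 < α) (h : ℝ) (N n : ℕ) (ψ : ℝ) :
    ∫ x, diffDirichlet α h N x * cos (n * x + ψ) ∂periodMeasure =
      if 1 ≤ n ∧ n ≤ N then π * diffMult α h n ψ else 0 := by
  have hi : ∀ (k : ℕ) (c B : ℝ), Integrable (fun x => c * (cos (k * x + B) * cos (n * x + ψ)))
      periodMeasure := fun k c B =>
    (by fun_prop : Continuous fun x : ℝ => c * (cos (k * x + B) * cos (n * x + ψ))).integrableOn_Ioc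
  have hs : ∀ x, diffDirichlet α h N x * cos (n * x + ψ) = ∑ k ∈ Finset.Ico 1 (N + 1),
      ((∑' ν : ℕ, diffCoeff α ν * cos (k * ((α - ν) * h))) * (cos (k * x + 0) * cos (n * x + ψ)) -
        (∑' ν : ℕ, diffCoeff α ν * sin (k * ((α - ν) * h))) *
          (cos (k * x + (-(π / 2))) * cos (n * x + ψ))) := by
    intro x
    rw [diffDirichlet_eq_sum hα, Finset.sum_mul]
    refine Finset.sum_congr rfl fun k _ => ?_
    ring
  simp_rw [hs]
  refine (integral_finsetSum _ fun k _ => Integrable.sub (hi k _ _) (hi k _ _)).trans ?_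
  have hk : ∀ k ∈ Finset.Ico 1 (N + 1),
      ∫ x, ((∑' ν : ℕ, diffCoeff α ν * cos (k * ((α - ν) * h))) * (cos (k * x + 0) * cos (n * x + ψ)) -
        (∑' ν : ℕ, diffCoeff α ν * sin (k * ((α - ν) * h))) *
          (cos (k * x + (-(π / 2))) * cos (n * x + ψ))) ∂periodMeasure =
      if k = n then π * diffMult α h n ψ else 0 := by
    intro k hk
    have hk1 := (Finset.mem_Ico.1 hk).1
    rw [integral_sub (hi _ _ _) (hi _ _ _), integral_const_mul, integral_const_mul,
      integral_cos_add_mul_cos_add k n hk1, integral_cos_add_mul_cos_add k n hk1]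
    split_ifs with hkn
    · subst hkn
      have := tsum_diffCoeff_cos_add hα (-ψ) fun ν : ℕ => k * ((α - ν) * h)
      have h2 : diffMult α h k ψ = ∑' ν : ℕ, diffCoeff α ν * cos (-ψ + k * ((α - ν) * h)) := by
        refine tsum_congr fun ν => ?_
        rw [← cos_neg]
        congr 2
        ring
      rw [h2, this, zero_sub, show -(π / 2) - ψ = -(ψ + π / 2) by ring, cos_neg (ψ + π / 2),
        cos_add_pi_div_two, sin_neg]
      ring
    · simp
  refine (Finset.sum_congr rfl hk).trans ?_
  rw [Finset.sum_ite_eq']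
  simp only [Finset.mem_Ico, Nat.lt_succ_iff]

end

section

def diffPartial (α₁ α₂ h₁ h₂ : ℝ) (a : ℕ → ℕ → ℝ) (N : ℕ) (z : ℝ × ℝ) : ℝ :=
  ∑ k ∈ Finset.Ico 1 N, ∑ l ∈ Finset.Ico 1 N,
    mixedDelta a k l * (diffDirichlet α₁ h₁ k z.1 * diffDirichlet α₂ h₂ l z.2)

theorem sum_Ico_sub_succ (s : ℕ → ℝ) {n N : ℕ} (h : n ≤ N) :
    ∑ k ∈ Finset.Ico n N, (s k - s (k + 1)) = s n - s N := by
  induction N, h using Nat.le_induction with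
  | base => simp
  | succ k hk ih => rw [Finset.sum_Ico_succ_top hk, ih]; ring

theorem sum_mixedDelta (a : ℕ → ℕ → ℝ) {n N m M : ℕ} (h : n ≤ N) (h' : m ≤ M) :
    ∑ k ∈ Finset.Ico n N, ∑ l ∈ Finset.Ico m M, mixedDelta a k l =
      a n m - a N m - a n M + a N M := by
  have : ∀ k, ∑ l ∈ Finset.Ico m M, mixedDelta a k l =
      (a k m - a k M) - (a (k + 1) m - a (k + 1) M) := by
    intro k
    have := sum_Ico_sub_succ (fun l => a k l - a (k + 1) l) h'
    rw [show (a k m - a k M) - (a (k + 1) m - a (k + 1) M) =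
      a k m - a (k + 1) m - (a k M - a (k + 1) M) by ring, ← this]
    refine Finset.sum_congr rfl fun l _ => ?_
    unfold mixedDelta
    ring
  rw [Finset.sum_congr rfl fun k _ => this k, sum_Ico_sub_succ (fun k => a k m - a k M) h]
  ring

theorem sum_Ico_one_ite (g : ℕ → ℝ) {n : ℕ} (hn : 1 ≤ n) (N : ℕ) :
    ∑ k ∈ Finset.Ico 1 N, (if 1 ≤ n ∧ n ≤ k then g k else 0) = ∑ k ∈ Finset.Ico n N, g k := by
  rw [← Finset.sum_filter]
  refine Finset.sum_congr ?_ fun _ _ => rfl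
  ext k
  simp only [Finset.mem_filter, Finset.mem_Ico]
  omega

theorem sum_Ico_one_two_pow {M : Type*} [AddCommMonoid M] (g : ℕ → M) (L : ℕ) :
    ∑ k ∈ Finset.Ico 1 (2 ^ L), g k =
      ∑ i ∈ Finset.range L, ∑ k ∈ Finset.Ico (2 ^ i) (2 ^ (i + 1)), g k := by
  induction L with
  | zero => simp
  | succ L ih =>
    rw [Finset.sum_range_succ, ← ih, Finset.sum_Ico_consecutive _ Nat.one_le_two_pow
      (Nat.pow_le_pow_right two_pos L.le_succ)]

variable {α₁ α₂ : ℝ} {a : ℕ → ℕ → ℝ}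

theorem continuous_diffPartial (h1 : 0 < α₁) (h2 : 0 < α₂) (h₁ h₂ : ℝ) (a : ℕ → ℕ → ℝ) (N : ℕ) :
    Continuous (diffPartial α₁ α₂ h₁ h₂ a N) := by
  unfold diffPartial
  have := continuous_diffDirichlet h1 h₁
  have := continuous_diffDirichlet h2 h₂
  fun_prop

theorem integral_diffPartial (h1 : 0 < α₁) (h2 : 0 < α₂) (h₁ h₂ : ℝ) (a : ℕ → ℕ → ℝ)
    (N n m : ℕ) (ψ φ : ℝ) :
    ∫ z, diffPartial α₁ α₂ h₁ h₂ a N z * (cos (n * z.1 + ψ) * cos (m * z.2 + φ)) ∂squareMeasure =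
      ∑ k ∈ Finset.Ico 1 N, ∑ l ∈ Finset.Ico 1 N, mixedDelta a k l *
        ((if 1 ≤ n ∧ n ≤ k then π * diffMult α₁ h₁ n ψ else 0) *
          (if 1 ≤ m ∧ m ≤ l then π * diffMult α₂ h₂ m φ else 0)) := by
  have hi1 : ∀ k : ℕ, Integrable (fun x => diffDirichlet α₁ h₁ k x * cos (n * x + ψ)) periodMeasure :=
    fun k => ((continuous_diffDirichlet h1 h₁ k).mul (by fun_prop)).integrableOn_Ioc
  have hi2 : ∀ k : ℕ, Integrable (fun x => diffDirichlet α₂ h₂ k x * cos (m * x + φ)) periodMeasure :=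
    fun k => ((continuous_diffDirichlet h2 h₂ k).mul (by fun_prop)).integrableOn_Ioc
  have hs : ∀ z, diffPartial α₁ α₂ h₁ h₂ a N z * (cos (n * z.1 + ψ) * cos (m * z.2 + φ)) =
      ∑ k ∈ Finset.Ico 1 N, ∑ l ∈ Finset.Ico 1 N, mixedDelta a k l *
        ((diffDirichlet α₁ h₁ k z.1 * cos (n * z.1 + ψ)) *
          (diffDirichlet α₂ h₂ l z.2 * cos (m * z.2 + φ))) := by
    intro z
    rw [diffPartial, Finset.sum_mul]
    refine Finset.sum_congr rfl fun k _ => ?_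
    rw [Finset.sum_mul]
    refine Finset.sum_congr rfl fun l _ => ?_
    ring
  have hi : ∀ k l : ℕ, Integrable (fun z : ℝ × ℝ => mixedDelta a k l *
        ((diffDirichlet α₁ h₁ k z.1 * cos (n * z.1 + ψ)) *
          (diffDirichlet α₂ h₂ l z.2 * cos (m * z.2 + φ)))) squareMeasure := fun k l =>
    ((hi1 k).mul_prod (hi2 l)).const_mul _
  simp_rw [hs]
  refine (integral_finsetSum _ fun k _ => integrable_finsetSum _ fun l _ => hi k l).trans ?_
  refine Finset.sum_congr rfl fun k _ => ?_
  refine (integral_finsetSum _ fun l _ => hi k l).trans ?_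
  refine Finset.sum_congr rfl fun l _ => ?_
  rw [integral_const_mul]
  congr 1
  refine (integral_prod_mul (μ := periodMeasure) (ν := periodMeasure)
    (fun x => diffDirichlet α₁ h₁ k x * cos (n * x + ψ))
    (fun y => diffDirichlet α₂ h₂ l y * cos (m * y + φ))).trans ?_
  rw [integral_diffDirichlet_mul_cos h1, integral_diffDirichlet_mul_cos h2]

theorem tendsto_integral_diffPartial (ha : MixedMonotone a) (h1 : 0 < α₁) (h2 : 0 < α₂)
    (h₁ h₂ : ℝ) (n m : ℕ) (ψ φ : ℝ) :
    Filter.Tendsto (fun N => ∫ z, diffPartial α₁ α₂ h₁ h₂ a N z *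
      (cos (n * z.1 + ψ) * cos (m * z.2 + φ)) ∂squareMeasure) Filter.atTop
      (nhds (π ^ 2 * axisZero a n m * (diffMult α₁ h₁ n ψ * diffMult α₂ h₂ m φ))) := by
  simp_rw [integral_diffPartial h1 h2]
  by_cases hnm : n = 0 ∨ m = 0
  · have : ∀ k l : ℕ, mixedDelta a k l *
        ((if 1 ≤ n ∧ n ≤ k then π * diffMult α₁ h₁ n ψ else 0) *
          (if 1 ≤ m ∧ m ≤ l then π * diffMult α₂ h₂ m φ else 0)) = 0 := by
      intro k l
      rcases hnm with h | h <;> simp [h]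
    simp only [this, Finset.sum_const_zero, axisZero, if_pos hnm, mul_zero, zero_mul]
    exact tendsto_const_nhds
  · have hn : 1 ≤ n := by omega
    have hm : 1 ≤ m := by omega
    rw [axisZero, if_neg hnm]
    have hdiag : Filter.Tendsto (fun N => a N N) Filter.atTop (nhds 0) := by
      refine squeeze_zero' ?_ ?_ (ha.tendsto_fst 1 le_rfl)
      · filter_upwards [Filter.eventually_ge_atTop 1] with N hN
        exact ha.nonneg N N hN hN
      · filter_upwards [Filter.eventually_ge_atTop 1] with N hN
        exact ha.anti_snd N 1 N hN le_rfl hN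
    have ht := ((((tendsto_const_nhds (x := a n m)).sub (ha.tendsto_fst m hm)).sub
      (ha.tendsto_snd n hn)).add hdiag).const_mul
      (π ^ 2 * (diffMult α₁ h₁ n ψ * diffMult α₂ h₂ m φ))
    rw [sub_zero, sub_zero, add_zero, mul_right_comm] at ht
    refine ht.congr' ?_
    filter_upwards [Filter.eventually_ge_atTop (max n m)] with N hN
    have hnN := (le_max_left _ _).trans hN
    have hmN := (le_max_right _ _).trans hN
    rw [← sum_mixedDelta a hnN hmN, ← sum_Ico_one_ite _ hn, Finset.mul_sum]
    refine Finset.sum_congr rfl fun k _ => ?_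
    rw [← sum_Ico_one_ite _ hm, ← ite_zero_mul]
    split_ifs with hk
    · rw [Finset.mul_sum]
      refine Finset.sum_congr rfl fun l _ => ?_
      split_ifs <;> ring
    · simp

end

section

def dyadicWeight (α δ : ℝ) (i : ℕ) : ℝ := (min 1 (2 ^ i * δ)) ^ α

theorem dyadicWeight_nonneg {α δ : ℝ} (hδ : 0 ≤ δ) (i : ℕ) : 0 ≤ dyadicWeight α δ i :=
  rpow_nonneg (le_min zero_le_one (by positivity)) _

def dyadicCoef (α₁ α₂ δ₁ δ₂ : ℝ) (a : ℕ → ℕ → ℝ) (i : ℕ × ℕ) : ℝ :=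
  a (2 ^ i.1) (2 ^ i.2) * (dyadicWeight α₁ δ₁ i.1 * dyadicWeight α₂ δ₂ i.2)

def dyadicSum (p α₁ α₂ δ₁ δ₂ : ℝ) (a : ℕ → ℕ → ℝ) : ℝ≥0∞ :=
  ∑' i : ℕ × ℕ, ENNReal.ofReal (dyadicCoef α₁ α₂ δ₁ δ₂ a i) ^ p *
    ENNReal.ofReal ((2 ^ i.1 * 2 ^ i.2) ^ (p - 1))

def shiftedEnvelope (α h : ℝ) (i : ℕ) (x : ℝ) : ℝ≥0∞ :=
  ∑' ν, ENNReal.ofReal (shiftWeight α ν) *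
    ENNReal.ofReal (kernelEnvelope (2 ^ i) (x + shiftStep α h ν))

theorem ofReal_abs_diffDirichlet_le {α : ℝ} (hα : 0 < α) {δ h : ℝ} (hδ : 0 < δ) (hh : |h| ≤ δ)
    {i k : ℕ} (hk : k ∈ Finset.Ico (2 ^ i) (2 ^ (i + 1))) (x : ℝ) :
    ENNReal.ofReal |diffDirichlet α h k x| ≤ ENNReal.ofReal ((4 + α) * 2 ^ α * 2) *
      (ENNReal.ofReal (dyadicWeight α δ i) * shiftedEnvelope α h i x) := by
  have hk2 : (k : ℝ) ≤ 2 * 2 ^ i := by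
    have := (Finset.mem_Ico.1 hk).2.le
    rw [pow_succ'] at this
    exact_mod_cast this
  have hN : (0 : ℝ) ≤ 2 ^ i := by positivity
  have hmin : min 1 (k * δ) ≤ 2 * min 1 (2 ^ i * δ) := by
    rw [mul_min_of_nonneg _ _ zero_le_two]
    refine min_le_min (by norm_num) ?_
    rw [← mul_assoc]
    gcongr
  have hw : (min 1 (k * δ)) ^ α ≤ 2 ^ α * dyadicWeight α δ i := by
    rw [dyadicWeight, ← mul_rpow zero_le_two (le_min zero_le_one (by positivity))]
    exact rpow_le_rpow (le_min zero_le_one (by positivity)) hmin hα.le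
  have hs := summable_shiftWeight_mul hα hN fun ν => x + shiftStep α h ν
  have hE : ∑' ν : ℕ, shiftWeight α ν * kernelEnvelope k (x + shiftStep α h ν) ≤
      2 * ∑' ν : ℕ, shiftWeight α ν * kernelEnvelope (2 ^ i) (x + shiftStep α h ν) := by
    rw [← tsum_mul_left]
    refine Summable.tsum_le_tsum (fun ν => ?_)
      (summable_shiftWeight_mul hα k.cast_nonneg _) (hs.mul_left 2)
    rw [mul_left_comm]
    refine mul_le_mul_of_nonneg_left ?_ (shiftWeight_nonneg _ _)
    exact (kernelEnvelope_mono k.cast_nonneg hk2 _).trans (kernelEnvelope_two_mul hN _)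
  have hSE : shiftedEnvelope α h i x =
      ENNReal.ofReal (∑' ν : ℕ, shiftWeight α ν * kernelEnvelope (2 ^ i) (x + shiftStep α h ν)) := by
    rw [ENNReal.ofReal_tsum_of_nonneg (fun ν => mul_nonneg (shiftWeight_nonneg _ _)
      (kernelEnvelope_nonneg hN _)) hs]
    exact tsum_congr fun ν => (ENNReal.ofReal_mul (shiftWeight_nonneg _ _)).symm
  have hw0 := dyadicWeight_nonneg (α := α) hδ.le i
  rw [hSE, ← ENNReal.ofReal_mul hw0, ← ENNReal.ofReal_mul (by positivity)]
  refine ENNReal.ofReal_le_ofReal ((abs_diffDirichlet_le_shift hα hδ hh k x).trans ?_)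
  calc _ ≤ (4 + α) * (2 ^ α * dyadicWeight α δ i) *
        (2 * ∑' ν : ℕ, shiftWeight α ν * kernelEnvelope (2 ^ i) (x + shiftStep α h ν)) := by
        refine mul_le_mul (mul_le_mul_of_nonneg_left hw (by positivity)) hE
          (tsum_nonneg fun ν => mul_nonneg (shiftWeight_nonneg _ _)
            (kernelEnvelope_nonneg k.cast_nonneg _)) (by positivity)
    _ = _ := by ring

variable {α₁ α₂ : ℝ} {a : ℕ → ℕ → ℝ}

theorem MixedMonotone.sum_block_le (ha : MixedMonotone a) (i j : ℕ) :
    ∑ k ∈ Finset.Ico (2 ^ i) (2 ^ (i + 1)), ∑ l ∈ Finset.Ico (2 ^ j) (2 ^ (j + 1)),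
      mixedDelta a k l ≤ a (2 ^ i) (2 ^ j) := by
  have h1 : ∀ i : ℕ, 1 ≤ 2 ^ i := fun i => Nat.one_le_two_pow
  have h2 : ∀ i : ℕ, 2 ^ i ≤ 2 ^ (i + 1) := fun i => Nat.pow_le_pow_right two_pos i.le_succ
  rw [sum_mixedDelta a (h2 i) (h2 j)]
  have := ha.anti_fst (2 ^ i) (2 ^ (i + 1)) (2 ^ (j + 1)) (h1 _) (h2 i) (h1 _)
  have := ha.nonneg (2 ^ (i + 1)) (2 ^ j) (h1 _) (h1 _)
  linarith

def envelopeSum (b : ℕ × ℕ → ℝ≥0∞) (z : ℝ × ℝ) : ℝ≥0∞ :=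
  ∑' i, b i * (ENNReal.ofReal (kernelEnvelope (2 ^ i.1) z.1) *
    ENNReal.ofReal (kernelEnvelope (2 ^ i.2) z.2))

theorem measurable_envelopeSum (b : ℕ × ℕ → ℝ≥0∞) : Measurable (envelopeSum b) := by
  have h : ∀ i : ℕ, Measurable (kernelEnvelope (2 ^ i)) := fun i =>
    (continuous_kernelEnvelope (by positivity)).measurable
  exact Measurable.tsum fun i => by fun_prop

theorem torusPeriodic_envelopeSum (b : ℕ × ℕ → ℝ≥0∞) : TorusPeriodic (envelopeSum b) := by
  constructor
  · intro x y
    simp only [envelopeSum, periodic_kernelEnvelope _ x]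
  · intro x y
    simp only [envelopeSum, periodic_kernelEnvelope _ y]

theorem enorm_diffPartial_le (ha : MixedMonotone a) (h1 : 0 < α₁) (h2 : 0 < α₂) {δ₁ δ₂ h₁ h₂ : ℝ}
    (hδ₁ : 0 < δ₁) (hδ₂ : 0 < δ₂) (hh₁ : |h₁| ≤ δ₁) (hh₂ : |h₂| ≤ δ₂) (L : ℕ) (z : ℝ × ℝ) :
    ‖diffPartial α₁ α₂ h₁ h₂ a (2 ^ L) z‖ₑ ≤
      ENNReal.ofReal ((4 + α₁) * 2 ^ α₁ * 2) * ENNReal.ofReal ((4 + α₂) * 2 ^ α₂ * 2) *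
      ∑' k : ℕ × ℕ, (ENNReal.ofReal (shiftWeight α₁ k.1) * ENNReal.ofReal (shiftWeight α₂ k.2)) *
        envelopeSum (fun i => ENNReal.ofReal (dyadicCoef α₁ α₂ δ₁ δ₂ a i))
          (z.1 + shiftStep α₁ h₁ k.1, z.2 + shiftStep α₂ h₂ k.2) := by
  set K₁ := ENNReal.ofReal ((4 + α₁) * 2 ^ α₁ * 2)
  set K₂ := ENNReal.ofReal ((4 + α₂) * 2 ^ α₂ * 2)
  have hpow : ∀ i : ℕ, 1 ≤ 2 ^ i := fun i => Nat.one_le_two_pow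
  have hblock : ∀ i j, ∑ k ∈ Finset.Ico (2 ^ i) (2 ^ (i + 1)), ∑ l ∈ Finset.Ico (2 ^ j) (2 ^ (j + 1)),
      ‖mixedDelta a k l * (diffDirichlet α₁ h₁ k z.1 * diffDirichlet α₂ h₂ l z.2)‖ₑ ≤
      K₁ * K₂ * (ENNReal.ofReal (dyadicCoef α₁ α₂ δ₁ δ₂ a (i, j)) *
        (shiftedEnvelope α₁ h₁ i z.1 * shiftedEnvelope α₂ h₂ j z.2)) := by
    intro i j
    calc _ ≤ ∑ k ∈ Finset.Ico (2 ^ i) (2 ^ (i + 1)), ∑ l ∈ Finset.Ico (2 ^ j) (2 ^ (j + 1)),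
          ENNReal.ofReal (mixedDelta a k l) *
            ((K₁ * (ENNReal.ofReal (dyadicWeight α₁ δ₁ i) * shiftedEnvelope α₁ h₁ i z.1)) *
            (K₂ * (ENNReal.ofReal (dyadicWeight α₂ δ₂ j) * shiftedEnvelope α₂ h₂ j z.2))) := by
          refine Finset.sum_le_sum fun k hk => Finset.sum_le_sum fun l hl => ?_
          rw [enorm_mul, enorm_mul]
          refine mul_le_mul' (le_of_eq ?_) (mul_le_mul' ?_ ?_)
          · exact Real.enorm_eq_ofReal (ha.mixedDelta_nonneg k l
              ((hpow i).trans (Finset.mem_Ico.1 hk).1) ((hpow j).trans (Finset.mem_Ico.1 hl).1))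
          · rw [enorm_eq_ofReal_abs]
            exact ofReal_abs_diffDirichlet_le h1 hδ₁ hh₁ hk _
          · rw [enorm_eq_ofReal_abs]
            exact ofReal_abs_diffDirichlet_le h2 hδ₂ hh₂ hl _
      _ = ENNReal.ofReal (∑ k ∈ Finset.Ico (2 ^ i) (2 ^ (i + 1)),
            ∑ l ∈ Finset.Ico (2 ^ j) (2 ^ (j + 1)), mixedDelta a k l) *
            ((K₁ * (ENNReal.ofReal (dyadicWeight α₁ δ₁ i) * shiftedEnvelope α₁ h₁ i z.1)) *
            (K₂ * (ENNReal.ofReal (dyadicWeight α₂ δ₂ j) * shiftedEnvelope α₂ h₂ j z.2))) := by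
          have hnn : ∀ k ∈ Finset.Ico (2 ^ i) (2 ^ (i + 1)), ∀ l ∈ Finset.Ico (2 ^ j) (2 ^ (j + 1)),
              0 ≤ mixedDelta a k l := fun k hk l hl => ha.mixedDelta_nonneg k l
              ((hpow i).trans (Finset.mem_Ico.1 hk).1) ((hpow j).trans (Finset.mem_Ico.1 hl).1)
          rw [ENNReal.ofReal_sum_of_nonneg fun k hk => Finset.sum_nonneg (hnn k hk), Finset.sum_mul]
          refine Finset.sum_congr rfl fun k hk => ?_
          rw [ENNReal.ofReal_sum_of_nonneg (hnn k hk), Finset.sum_mul]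
      _ ≤ ENNReal.ofReal (a (2 ^ i) (2 ^ j)) *
            ((K₁ * (ENNReal.ofReal (dyadicWeight α₁ δ₁ i) * shiftedEnvelope α₁ h₁ i z.1)) *
            (K₂ * (ENNReal.ofReal (dyadicWeight α₂ δ₂ j) * shiftedEnvelope α₂ h₂ j z.2))) := by
          gcongr
          exact ha.sum_block_le i j
      _ = _ := by
          rw [dyadicCoef, ENNReal.ofReal_mul (ha.nonneg _ _ (hpow _) (hpow _)),
            ENNReal.ofReal_mul (dyadicWeight_nonneg hδ₁.le _)]
          ring
  calc ‖diffPartial α₁ α₂ h₁ h₂ a (2 ^ L) z‖ₑ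
      ≤ ∑ k ∈ Finset.Ico 1 (2 ^ L), ∑ l ∈ Finset.Ico 1 (2 ^ L),
        ‖mixedDelta a k l * (diffDirichlet α₁ h₁ k z.1 * diffDirichlet α₂ h₂ l z.2)‖ₑ :=
        (enorm_sum_le _ _).trans (Finset.sum_le_sum fun k _ => enorm_sum_le _ _)
    _ = ∑ i ∈ Finset.range L, ∑ j ∈ Finset.range L, ∑ k ∈ Finset.Ico (2 ^ i) (2 ^ (i + 1)),
        ∑ l ∈ Finset.Ico (2 ^ j) (2 ^ (j + 1)),
        ‖mixedDelta a k l * (diffDirichlet α₁ h₁ k z.1 * diffDirichlet α₂ h₂ l z.2)‖ₑ := by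
        rw [sum_Ico_one_two_pow]
        refine Finset.sum_congr rfl fun i _ => ?_
        conv_rhs => rw [Finset.sum_comm]
        refine Finset.sum_congr rfl fun k _ => ?_
        rw [sum_Ico_one_two_pow]
    _ ≤ ∑ i ∈ Finset.range L, ∑ j ∈ Finset.range L, K₁ * K₂ *
        (ENNReal.ofReal (dyadicCoef α₁ α₂ δ₁ δ₂ a (i, j)) *
          (shiftedEnvelope α₁ h₁ i z.1 * shiftedEnvelope α₂ h₂ j z.2)) :=
        Finset.sum_le_sum fun i _ => Finset.sum_le_sum fun j _ => hblock i j
    _ ≤ ∑' i : ℕ × ℕ, K₁ * K₂ * (ENNReal.ofReal (dyadicCoef α₁ α₂ δ₁ δ₂ a i) *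
          (shiftedEnvelope α₁ h₁ i.1 z.1 * shiftedEnvelope α₂ h₂ i.2 z.2)) := by
        rw [← Finset.sum_product' (f := fun i j => K₁ * K₂ *
          (ENNReal.ofReal (dyadicCoef α₁ α₂ δ₁ δ₂ a (i, j)) *
          (shiftedEnvelope α₁ h₁ i z.1 * shiftedEnvelope α₂ h₂ j z.2)))]
        exact ENNReal.sum_le_tsum _
    _ = K₁ * K₂ * ∑' i : ℕ × ℕ, ∑' k : ℕ × ℕ,
          (ENNReal.ofReal (shiftWeight α₁ k.1) * ENNReal.ofReal (shiftWeight α₂ k.2)) *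
          (ENNReal.ofReal (dyadicCoef α₁ α₂ δ₁ δ₂ a i) *
          (ENNReal.ofReal (kernelEnvelope (2 ^ i.1) (z.1 + shiftStep α₁ h₁ k.1)) *
          ENNReal.ofReal (kernelEnvelope (2 ^ i.2) (z.2 + shiftStep α₂ h₂ k.2)))) := by
        rw [ENNReal.tsum_mul_left]
        congr 1
        refine tsum_congr fun i => ?_
        rw [shiftedEnvelope, shiftedEnvelope, ← ENNReal.tsum_mul_right]
        simp_rw [← ENNReal.tsum_mul_left]
        rw [ENNReal.tsum_prod']
        refine tsum_congr fun ν => tsum_congr fun μ => ?_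
        ring
    _ = _ := by
        rw [ENNReal.tsum_comm]
        simp_rw [ENNReal.tsum_mul_left, envelopeSum]

end

section

theorem tsum_ofReal_shiftWeight_ne_top {α : ℝ} (hα : 0 < α) :
    ∑' k, ENNReal.ofReal (shiftWeight α k) ≠ ⊤ := by
  rw [← ENNReal.ofReal_tsum_of_nonneg (fun k => shiftWeight_nonneg _ _) (summable_shiftWeight hα)]
  exact ENNReal.ofReal_ne_top

theorem exists_ofReal_ge {c : ℝ≥0∞} (hc : c ≠ ⊤) : ∃ C : ℝ, 0 < C ∧ c ≤ ENNReal.ofReal C :=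
  ⟨c.toReal + 1, by positivity, (ENNReal.ofReal_toReal hc).symm.le.trans
    (ENNReal.ofReal_le_ofReal (by linarith))⟩

theorem exists_lintegral_diffPartial_le {p α₁ α₂ : ℝ} (hp : 1 < p) (h1 : 0 < α₁) (h2 : 0 < α₂) :
    ∃ C : ℝ, 0 < C ∧ ∀ (a : ℕ → ℕ → ℝ) (δ₁ δ₂ h₁ h₂ : ℝ), MixedMonotone a → 0 < δ₁ → 0 < δ₂ →
      |h₁| ≤ δ₁ → |h₂| ≤ δ₂ → ∀ L : ℕ,
      ∫⁻ z, ‖diffPartial α₁ α₂ h₁ h₂ a (2 ^ L) z‖ₑ ^ p ∂squareMeasure ≤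
        ENNReal.ofReal C * dyadicSum p α₁ α₂ δ₁ δ₂ a := by
  obtain ⟨C₀, hC₀, H⟩ := lintegral_tsum_kernelEnvelope_le hp
  have hp0 : 0 ≤ p := by linarith
  set K := ENNReal.ofReal ((4 + α₁) * 2 ^ α₁ * 2) * ENNReal.ofReal ((4 + α₂) * 2 ^ α₂ * 2) with hK
  set W : ℝ≥0∞ := ∑' k : ℕ × ℕ,
    ENNReal.ofReal (shiftWeight α₁ k.1) * ENNReal.ofReal (shiftWeight α₂ k.2) with hW
  have hKt : K ≠ ⊤ := ENNReal.mul_ne_top ENNReal.ofReal_ne_top ENNReal.ofReal_ne_top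
  have hWt : W ≠ ⊤ := by
    rw [hW, ENNReal.tsum_prod']
    simp_rw [ENNReal.tsum_mul_left, ENNReal.tsum_mul_right]
    exact ENNReal.mul_ne_top (tsum_ofReal_shiftWeight_ne_top h1) (tsum_ofReal_shiftWeight_ne_top h2)
  obtain ⟨C, hC, hCle⟩ := exists_ofReal_ge (c := K ^ p * (W ^ p * ENNReal.ofReal C₀))
    (ENNReal.mul_ne_top (ENNReal.rpow_ne_top_of_nonneg hp0 hKt)
      (ENNReal.mul_ne_top (ENNReal.rpow_ne_top_of_nonneg hp0 hWt) ENNReal.ofReal_ne_top))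
  refine ⟨C, hC, fun a δ₁ δ₂ h₁ h₂ ha hδ₁ hδ₂ hh₁ hh₂ L => ?_⟩
  set b : ℕ × ℕ → ℝ≥0∞ := fun i => ENNReal.ofReal (dyadicCoef α₁ α₂ δ₁ δ₂ a i)
  have hmE := measurable_envelopeSum b
  have hE : ∫⁻ z, envelopeSum b z ^ p ∂squareMeasure ≤
      ENNReal.ofReal C₀ * dyadicSum p α₁ α₂ δ₁ δ₂ a := by
    rw [squareMeasure, lintegral_prod _ (by fun_prop)]
    exact H b
  calc _ ≤ ∫⁻ z, K ^ p * (∑' k : ℕ × ℕ,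
        (ENNReal.ofReal (shiftWeight α₁ k.1) * ENNReal.ofReal (shiftWeight α₂ k.2)) *
        envelopeSum b (z.1 + shiftStep α₁ h₁ k.1, z.2 + shiftStep α₂ h₂ k.2)) ^ p
        ∂squareMeasure := by
        refine lintegral_mono fun z => ?_
        rw [← ENNReal.mul_rpow_of_nonneg _ _ hp0]
        exact ENNReal.rpow_le_rpow (enorm_diffPartial_le ha h1 h2 hδ₁ hδ₂ hh₁ hh₂ L z) hp0
    _ ≤ K ^ p * (W ^ p * (ENNReal.ofReal C₀ * dyadicSum p α₁ α₂ δ₁ δ₂ a)) := by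
        rw [lintegral_const_mul' _ _ (ENNReal.rpow_ne_top_of_nonneg hp0 hKt)]
        gcongr
        refine (lintegral_rpow_tsum_shift_le hp _ (fun k : ℕ × ℕ => shiftStep α₁ h₁ k.1)
          (fun k : ℕ × ℕ => shiftStep α₂ h₂ k.2) hmE (torusPeriodic_envelopeSum b)).trans ?_
        gcongr
    _ = K ^ p * (W ^ p * ENNReal.ofReal C₀) * dyadicSum p α₁ α₂ δ₁ δ₂ a := by ring
    _ ≤ _ := by gcongr

theorem exists_mixedMod_rpow_le_dyadicSum {p α₁ α₂ : ℝ} (hp : 1 < p) (h1 : 0 < α₁) (h2 : 0 < α₂) :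
    ∃ C : ℝ, 0 < C ∧ ∀ (f : ℝ → ℝ → ℝ) (a : ℕ → ℕ → ℝ) (δ₁ δ₂ : ℝ), InMclass p f a →
      0 < δ₁ → 0 < δ₂ →
      mixedMod p α₁ α₂ δ₁ δ₂ f ^ p ≤ ENNReal.ofReal C * dyadicSum p α₁ α₂ δ₁ δ₂ a := by
  obtain ⟨C, hC, H⟩ := exists_lintegral_diffPartial_le hp h1 h2
  have hp0 : 0 < p := by linarith
  refine ⟨C, hC, fun f a δ₁ δ₂ hf hδ₁ hδ₂ => ?_⟩
  rw [← ENNReal.le_rpow_inv_iff hp0, mixedMod]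
  refine iSup_le fun h₁ => iSup_le fun hh₁ => iSup_le fun h₂ => iSup_le fun hh₂ => ?_
  have hm := hf.1.meas
  have hF := hf.1.torusPeriodic
  have hi := hf.1.integrable hp
  have hS := summable_mixedCoeff h1 h2
  have hmono := hf.mixedMonotone hp
  rw [Lp2Norm_diff_eq hp0 h1 h2 h₁ h₂ hm hF hi, one_div]
  refine ENNReal.rpow_le_rpow ?_ (by positivity)
  refine lintegral_rpow_le_of_tendsto_cos hp (aemeasurable_shiftSum hS hm hF hi) ?_
    (v := fun L => diffPartial α₁ α₂ h₁ h₂ a (2 ^ L))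
    (fun L => (continuous_diffPartial h1 h2 h₁ h₂ a _).measurable.aemeasurable)
    (fun L => H a δ₁ δ₂ h₁ h₂ hmono hδ₁ hδ₂ hh₁ hh₂ L) fun n m ψ φ => ?_
  · refine ne_top_of_le_ne_top ?_ (lintegral_rpow_shiftSum_le hp hm hF)
    exact ENNReal.mul_ne_top (ENNReal.rpow_ne_top_of_nonneg hp0.le
      (tsum_enorm_ne_top_of_summable_abs hS)) (hf.1.lintegral_ne_top hp)
  · have hlim := (tendsto_integral_diffPartial hmono h1 h2 h₁ h₂ n m ψ φ).comp
      (tendsto_pow_atTop_atTop_of_one_lt (r := 2) one_lt_two)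
    rw [← (hf.hasCosCoeff hp).integral_mixedDiff h1 h2 h₁ h₂ hm hF hi] at hlim
    exact hlim

end

section

/-- The frequencies `2 ^ i / 2 < n ≤ 2 ^ i`. -/
def dyadicBlock (i : ℕ) : Finset ℕ := Finset.Ioc (2 ^ i / 2) (2 ^ i)

theorem one_le_of_mem_dyadicBlock {i n : ℕ} (hn : n ∈ dyadicBlock i) : 1 ≤ n :=
  Nat.one_le_iff_ne_zero.2 fun h => by simp [dyadicBlock, h] at hn

theorem le_of_mem_dyadicBlock {i n : ℕ} (hn : n ∈ dyadicBlock i) : n ≤ 2 ^ i :=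
  (Finset.mem_Ioc.1 hn).2

theorem two_pow_le_of_mem_dyadicBlock {i n : ℕ} (hn : n ∈ dyadicBlock i) : (2 : ℝ) ^ i ≤ 2 * n := by
  have h := (Finset.mem_Ioc.1 hn).1
  have : 2 ^ i ≤ 2 * n := by omega
  exact_mod_cast this

theorem two_pow_le_card_dyadicBlock (i : ℕ) : (2 : ℝ) ^ i ≤ 2 * (dyadicBlock i).card := by
  have : 2 ^ i ≤ 2 * (dyadicBlock i).card := by
    rw [dyadicBlock, Nat.card_Ioc]
    omega
  exact_mod_cast this

/-- Steps `|h| ≤ δ` can be selected so that the multipliers of the difference operator with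
phases `n * (κ * h) + φ` dominate on average a multiple of the dyadic weights on the blocks `I`. -/
def HasSteps (α δ κ φ c : ℝ) (I : Set ℕ) : Prop :=
  ∃ M : ℕ → ℝ, (∀ i ∈ I, ∀ n ∈ dyadicBlock i, c * dyadicWeight α δ i ≤ M n) ∧
    ∀ {ι : Type} (S : Finset ι) (B : ι → ℝ) (n : ι → ℕ),
      ∃ h, |h| ≤ δ ∧ ∑ x ∈ S, B x * M (n x) ≤
        ∑ x ∈ S, B x * diffMult α h (n x) (n x * (κ * h) + φ)

theorem one_le_tsum_abs_diffCoeff {α : ℝ} (hα : 0 < α) : 1 ≤ ∑' ν, |diffCoeff α ν| := by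
  have := (summable_abs_diffCoeff hα).le_tsum 0 fun ν _ => abs_nonneg _
  simpa [diffCoeff_zero] using this

theorem diffMult_half {α h : ℝ} (hα : 0 < α) (hh : 0 ≤ h) {n : ℕ} (hn : n * h ≤ 1) :
    diffMult α h n (n * (α / 2 * h) + α * (π / 2)) = (2 * sin (n * h / 2)) ^ α := by
  have := tsum_diffCoeff_cos hα (θ := n * h) (by positivity) hn
    (-(α * ((π - n * h) / 2)))
  rw [neg_add_cancel, cos_zero, mul_one] at this
  rw [← this, diffMult]
  refine tsum_congr fun ν => ?_
  rw [← cos_neg]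
  ring_nf

theorem hasSteps_low {α δ K : ℝ} (hα : 0 < α) (hδ : 0 < δ) (hK : 1 ≤ K) :
    HasSteps α δ (α / 2) (α * (π / 2)) ((π * K)⁻¹ ^ α) {i | 2 ^ i * δ ≤ K} := by
  have hK0 : 0 < K := by linarith
  have hh : 0 ≤ δ / K := by positivity
  refine ⟨fun n => diffMult α (δ / K) n (n * (α / 2 * (δ / K)) + α * (π / 2)), fun i hi n hn => ?_,
    fun S B n => ⟨δ / K, ?_, le_rfl⟩⟩
  · have hn1 : (n : ℝ) ≤ 2 ^ i := by exact_mod_cast le_of_mem_dyadicBlock hn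
    have hn2 := two_pow_le_of_mem_dyadicBlock hn
    have hle : n * (δ / K) ≤ 1 := by
      rw [← mul_div_assoc, div_le_one hK0]
      exact (mul_le_mul_of_nonneg_right hn1 hδ.le).trans hi
    beta_reduce
    rw [diffMult_half hα hh hle, dyadicWeight, ← mul_rpow (by positivity)
      (le_min zero_le_one (by positivity))]
    refine rpow_le_rpow (mul_nonneg (by positivity) (le_min zero_le_one (by positivity))) ?_ hα.le
    have hs := mul_le_sin (x := n * (δ / K) / 2) (by positivity) (by linarith [pi_gt_three])
    calc (π * K)⁻¹ * min 1 (2 ^ i * δ) ≤ (π * K)⁻¹ * (2 * n * δ) := by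
          gcongr
          exact (min_le_right _ _).trans (by gcongr)
      _ = 2 * (2 / π * (n * (δ / K) / 2)) := by
          field_simp
      _ ≤ _ := by linarith
  · rw [abs_of_nonneg hh]
    exact div_le_self hδ.le hK

theorem diffMult_shift (α h : ℝ) (n : ℕ) :
    diffMult α h n (n * (α * h) + 0) = ∑' ν : ℕ, diffCoeff α ν * cos (n * ν * h) := by
  refine tsum_congr fun ν => ?_
  ring_nf

theorem continuous_diffMult_shift {α : ℝ} (hα : 0 < α) (n : ℕ) :
    Continuous fun h => diffMult α h n (n * (α * h) + 0) := by
  simp_rw [diffMult_shift]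
  refine continuous_tsum (fun ν => by fun_prop) (summable_abs_diffCoeff hα) fun ν h => ?_
  rw [norm_mul, Real.norm_eq_abs]
  exact mul_le_of_le_one_right (abs_nonneg _) (abs_cos_le_one _)

theorem le_setIntegral_diffMult_shift {α δ : ℝ} (hα : 0 < α) (hδ : 0 < δ) {n : ℕ} (hn : 1 ≤ n) :
    δ - (∑' ν, |diffCoeff α ν|) / n ≤
      ∫ h in Set.Ioc 0 δ, diffMult α h n (n * (α * h) + 0) := by
  have hn0 : (0 : ℝ) < n := by exact_mod_cast hn
  simp_rw [diffMult_shift]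
  have hint : ∀ ν : ℕ, IntegrableOn (fun h => diffCoeff α ν * cos (n * ν * h)) (Set.Ioc 0 δ) :=
    fun ν => (by fun_prop : Continuous fun h => diffCoeff α ν * cos (n * ν * h)).integrableOn_Ioc
  have hsum : Summable fun ν : ℕ => ∫ h in Set.Ioc 0 δ, ‖diffCoeff α ν * cos (n * ν * h)‖ := by
    refine Summable.of_nonneg_of_le (fun ν => integral_nonneg fun h => norm_nonneg _) (fun ν => ?_)
      ((summable_abs_diffCoeff hα).mul_left δ)
    calc _ ≤ ∫ h in Set.Ioc 0 δ, |diffCoeff α ν| := by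
          refine setIntegral_mono (hint ν).norm (integrable_const _) fun h => ?_
          rw [norm_mul, Real.norm_eq_abs]
          exact mul_le_of_le_one_right (abs_nonneg _) (abs_cos_le_one _)
      _ = _ := by simp [hδ.le]
  have key := hasSum_integral_of_summable_integral_norm hint hsum
  rw [← key.tsum_eq]
  have hlow : ∀ ν, (if ν = 0 then δ else 0) - |diffCoeff α ν| / n ≤
      ∫ h in Set.Ioc 0 δ, diffCoeff α ν * cos (n * ν * h) := by
    intro ν
    rw [integral_const_mul]
    rcases eq_or_ne ν 0 with rfl | hν
    · have : 0 ≤ 1 / (n : ℝ) := by positivity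
      simp [diffCoeff_zero, hδ.le]
    · have hν1 : (1 : ℝ) ≤ ν := by exact_mod_cast Nat.one_le_iff_ne_zero.2 hν
      have hnν : (0 : ℝ) < n * ν := by positivity
      rw [if_neg hν, zero_sub, ← intervalIntegral.integral_of_le hδ.le,
        intervalIntegral.integral_comp_mul_left (fun x => cos x) hnν.ne', integral_cos, mul_zero,
        sin_zero, sub_zero, smul_eq_mul]
      refine (abs_le.1 ?_).1
      rw [abs_mul, abs_mul, abs_of_pos (inv_pos.2 hnν), div_eq_mul_inv]
      refine mul_le_mul_of_nonneg_left ?_ (abs_nonneg _)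
      refine (mul_le_of_le_one_right (inv_nonneg.2 hnν.le) (abs_sin_le_one _)).trans ?_
      exact inv_anti₀ hn0 (le_mul_of_one_le_right hn0.le hν1)
  have hδs : HasSum (fun ν : ℕ => if ν = 0 then δ else 0) δ := hasSum_ite_eq 0 δ
  have hcs := (summable_abs_diffCoeff hα).hasSum.div_const (n : ℝ)
  exact hasSum_le hlow (hδs.sub hcs) key.summable.hasSum

theorem hasSteps_high {α δ : ℝ} (hα : 0 < α) (hδ : 0 < δ) :
    HasSteps α δ α 0 (1 / 2) {i | 4 * ∑' ν, |diffCoeff α ν| < 2 ^ i * δ} := by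
  refine ⟨fun n => δ⁻¹ * ∫ h in Set.Ioc 0 δ, diffMult α h n (n * (α * h) + 0),
    fun i hi n hn => ?_, fun S B n => ?_⟩
  · have hw : dyadicWeight α δ i ≤ 1 :=
      rpow_le_one (le_min zero_le_one (by positivity)) (min_le_left _ _) hα.le
    have hn1 := one_le_of_mem_dyadicBlock hn
    have hn0 : (0 : ℝ) < n := by exact_mod_cast hn1
    have hn2 := two_pow_le_of_mem_dyadicBlock hn
    have h := le_setIntegral_diffMult_shift hα hδ hn1
    have hi' : 4 * ∑' ν, |diffCoeff α ν| < 2 ^ i * δ := hi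
    have hK : (∑' ν, |diffCoeff α ν|) / n ≤ δ / 2 := by
      rw [div_le_iff₀ hn0]
      have := mul_le_mul_of_nonneg_right hn2 hδ.le
      linarith
    calc 1 / 2 * dyadicWeight α δ i ≤ δ⁻¹ * (δ / 2) := by
          rw [← mul_div_assoc, inv_mul_cancel₀ hδ.ne']
          linarith
      _ ≤ _ := mul_le_mul_of_nonneg_left (by linarith) (inv_nonneg.2 hδ.le)
  · have hc : ∀ x, Continuous fun h => B x * diffMult α h (n x) (n x * (α * h) + 0) := fun x =>
      continuous_const.mul (continuous_diffMult_shift hα (n x))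
    have hi : ∀ x, IntegrableOn (fun h => B x * diffMult α h (n x) (n x * (α * h) + 0))
        (Set.Ioc 0 δ) := fun x => (hc x).integrableOn_Ioc
    obtain ⟨h, hh, hle⟩ := exists_setAverage_le (μ := volume) (s := Set.Ioc 0 δ)
      (f := fun h => ∑ x ∈ S, B x * diffMult α h (n x) (n x * (α * h) + 0))
      (by simpa using hδ) (by simp) (integrable_finsetSum _ fun x _ => hi x)
    refine ⟨h, by rw [abs_of_pos hh.1]; exact hh.2, le_of_eq_of_le ?_ hle⟩
    rw [setAverage_eq, integral_finsetSum _ fun x _ => hi x, smul_eq_mul, Finset.mul_sum]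
    refine Finset.sum_congr rfl fun x _ => ?_
    rw [integral_const_mul]
    simp [hδ.le]
    ring

theorem exists_hasSteps {α : ℝ} (hα : 0 < α) : ∃ c : ℝ, 0 < c ∧ ∀ δ, 0 < δ → ∃ I : Set ℕ,
    HasSteps α δ (α / 2) (α * (π / 2)) c I ∧ HasSteps α δ α 0 c Iᶜ := by
  have hK := one_le_tsum_abs_diffCoeff hα
  set K := ∑' ν, |diffCoeff α ν|
  have hmono : ∀ {δ κ φ c c' : ℝ} {I : Set ℕ}, 0 < δ → c' ≤ c → HasSteps α δ κ φ c I →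
      HasSteps α δ κ φ c' I := by
    rintro δ κ φ c c' I hδ hc ⟨M, hM, hS⟩
    exact ⟨M, fun i hi n hn => (mul_le_mul_of_nonneg_right hc
      (dyadicWeight_nonneg hδ.le i)).trans (hM i hi n hn), hS⟩
  refine ⟨min ((π * (4 * K))⁻¹ ^ α) (1 / 2), by positivity, fun δ hδ => ⟨{i | 2 ^ i * δ ≤ 4 * K},
    hmono hδ (min_le_left _ _) (hasSteps_low hα hδ (by linarith)), ?_⟩⟩
  have : {i : ℕ | 2 ^ i * δ ≤ 4 * K}ᶜ = {i | 4 * K < 2 ^ i * δ} := by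
    ext i
    simp
  rw [this]
  exact hmono hδ (min_le_right _ _) (hasSteps_high hα hδ)

end

section

/-- The block of cosines of frequencies in `dyadicBlock i`, translated by `s`, with phase `φ`. -/
def blockCos (i : ℕ) (s φ x : ℝ) : ℝ := ∑ n ∈ dyadicBlock i, cos (n * x + (n * s + φ))

theorem abs_sum_Ioc_cos_le {m N : ℕ} (h : m ≤ N) (u φ : ℝ) :
    |∑ n ∈ Finset.Ioc m N, cos (n * u + φ)| ≤ 4 * kernelEnvelope N u := by
  have hE : ∑ n ∈ Finset.Ioc m N, cos (n * u + φ) =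
      (Complex.exp (φ * Complex.I) *
      ((∑ k ∈ Finset.range N, Complex.exp ((((k + 1 : ℕ) * u : ℝ) : ℂ) * Complex.I)) -
        ∑ k ∈ Finset.range m, Complex.exp ((((k + 1 : ℕ) * u : ℝ) : ℂ) * Complex.I))).re := by
    rw [← Finset.sum_Ico_eq_sub _ h, Finset.mul_sum, Complex.re_sum,
      ← Finset.Ico_add_one_add_one_eq_Ioc, ← Finset.sum_Ico_add' (fun n : ℕ => cos (n * u + φ)) m N 1]
    refine Finset.sum_congr rfl fun k _ => ?_
    rw [← Complex.exp_add, ← add_mul, ← Complex.ofReal_add, Complex.exp_ofReal_mul_I_re]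
    ring_nf
  rw [hE]
  refine (Complex.abs_re_le_norm _).trans ?_
  rw [norm_mul, Complex.norm_exp_ofReal_mul_I, one_mul]
  have h1 := norm_sum_cexp_le N u
  have h2 := norm_sum_cexp_le m u
  have h3 := kernelEnvelope_mono m.cast_nonneg (Nat.cast_le.2 h : (m : ℝ) ≤ N) u
  refine (norm_sub_le _ _).trans ?_
  linarith

theorem abs_blockCos_le (i : ℕ) (s φ x : ℝ) :
    |blockCos i s φ x| ≤ 4 * kernelEnvelope (2 ^ i) (x + s) := by
  have h := abs_sum_Ioc_cos_le (Nat.div_le_self (2 ^ i) 2) (x + s) φ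
  push_cast at h
  refine le_of_eq_of_le ?_ h
  rw [blockCos, dyadicBlock]
  congr 1
  refine Finset.sum_congr rfl fun n _ => ?_
  ring_nf

theorem continuous_blockCos (i : ℕ) (s φ : ℝ) : Continuous (blockCos i s φ) := by
  unfold blockCos
  fun_prop

/-- The combination of cosine blocks with coefficients `c` indexed by `J`. -/
def blockPoly (J : Finset (ℕ × ℕ)) (c : ℕ × ℕ → ℝ) (s φ s' φ' : ℝ) (z : ℝ × ℝ) : ℝ :=
  ∑ k ∈ J, c k * (blockCos k.1 s φ z.1 * blockCos k.2 s' φ' z.2)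

theorem continuous_blockPoly (J : Finset (ℕ × ℕ)) (c : ℕ × ℕ → ℝ) (s φ s' φ' : ℝ) :
    Continuous (blockPoly J c s φ s' φ') := by
  have := continuous_blockCos
  unfold blockPoly
  fun_prop

theorem enorm_blockPoly_le {J : Finset (ℕ × ℕ)} {c : ℕ × ℕ → ℝ} (hc : ∀ k ∈ J, 0 ≤ c k)
    (s φ s' φ' : ℝ) (z : ℝ × ℝ) :
    ‖blockPoly J c s φ s' φ' z‖ₑ ≤
      16 * envelopeSum (Set.indicator J fun k => ENNReal.ofReal (c k)) (z.1 + s, z.2 + s') := by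
  rw [envelopeSum, ← ENNReal.tsum_mul_left]
  refine le_trans ?_ (ENNReal.sum_le_tsum J)
  refine (enorm_sum_le _ _).trans (Finset.sum_le_sum fun k hk => ?_)
  rw [Set.indicator_of_mem (Finset.mem_coe.2 hk), enorm_mul, enorm_mul,
    Real.enorm_eq_ofReal (hc k hk), enorm_eq_ofReal_abs, enorm_eq_ofReal_abs]
  have h4 : ∀ (i : ℕ) (s φ x : ℝ), ENNReal.ofReal |blockCos i s φ x| ≤
      4 * ENNReal.ofReal (kernelEnvelope (2 ^ i) (x + s)) := fun i s φ x => by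
    rw [← ENNReal.ofReal_ofNat, ← ENNReal.ofReal_mul (by norm_num)]
    exact ENNReal.ofReal_le_ofReal (abs_blockCos_le i s φ x)
  calc _ ≤ ENNReal.ofReal (c k) * ((4 * ENNReal.ofReal (kernelEnvelope (2 ^ k.1) (z.1 + s))) *
        (4 * ENNReal.ofReal (kernelEnvelope (2 ^ k.2) (z.2 + s')))) := by
        gcongr <;> exact h4 _ _ _ _
    _ = _ := by ring

theorem lintegral_blockPoly_le {q C : ℝ} (hq : 1 < q)
    (H : ∀ b : ℕ × ℕ → ℝ≥0∞, ∫⁻ x in Set.Ioc 0 (2 * π), ∫⁻ y in Set.Ioc 0 (2 * π),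
      (∑' i, b i * (ENNReal.ofReal (kernelEnvelope (2 ^ i.1) x) *
        ENNReal.ofReal (kernelEnvelope (2 ^ i.2) y))) ^ q ≤
      ENNReal.ofReal C * ∑' i, b i ^ q * ENNReal.ofReal ((2 ^ i.1 * 2 ^ i.2) ^ (q - 1)))
    {J : Finset (ℕ × ℕ)} {c : ℕ × ℕ → ℝ} (hc : ∀ k ∈ J, 0 ≤ c k) (s φ s' φ' : ℝ) :
    ∫⁻ z, ‖blockPoly J c s φ s' φ' z‖ₑ ^ q ∂squareMeasure ≤
      16 ^ q * (ENNReal.ofReal C *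
        ENNReal.ofReal (∑ k ∈ J, c k ^ q * (2 ^ k.1 * 2 ^ k.2) ^ (q - 1))) := by
  have hq0 : 0 < q := by linarith
  set b : ℕ × ℕ → ℝ≥0∞ := Set.indicator J fun k => ENNReal.ofReal (c k)
  have hmE := measurable_envelopeSum b
  calc _ ≤ ∫⁻ z, 16 ^ q * envelopeSum b (z.1 + s, z.2 + s') ^ q ∂squareMeasure := by
        refine lintegral_mono fun z => ?_
        rw [← ENNReal.mul_rpow_of_nonneg _ _ hq0.le]
        exact ENNReal.rpow_le_rpow (enorm_blockPoly_le hc s φ s' φ' z) hq0.le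
    _ = 16 ^ q * ∫⁻ z, envelopeSum b z ^ q ∂squareMeasure := by
        rw [lintegral_const_mul' _ _ (ENNReal.rpow_ne_top_of_nonneg hq0.le (by norm_num))]
        rw [lintegral_square_add (F := fun z => envelopeSum b z ^ q) (by fun_prop)
          ((torusPeriodic_envelopeSum b).comp (· ^ q)) s s']
    _ ≤ 16 ^ q * (ENNReal.ofReal C *
          ∑' i, b i ^ q * ENNReal.ofReal ((2 ^ i.1 * 2 ^ i.2) ^ (q - 1))) := by
        rw [squareMeasure, lintegral_prod _ (by fun_prop)]
        gcongr
        exact H b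
    _ = _ := by
        rw [tsum_eq_sum (s := J), ENNReal.ofReal_sum_of_nonneg]
        · congr 2
          refine Finset.sum_congr rfl fun k hk => ?_
          rw [ENNReal.ofReal_mul (rpow_nonneg (hc k hk) _),
            ← ENNReal.ofReal_rpow_of_nonneg (hc k hk) hq0.le]
          simp only [b, Set.indicator_of_mem (Finset.mem_coe.2 hk)]
        · intro k hk
          have := hc k hk
          positivity
        · intro k hk
          simp [b, hk, hq0]

end

section

theorem ENNReal.le_of_mul_le_mul_rpow {p q : ℝ} (hpq : p.HolderConjugate q) {s ω K c : ℝ≥0∞}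
    (hs : s ≠ ⊤) (h : c * s ≤ ω * (K * s) ^ (1 / q)) :
    c ^ p * s ≤ K ^ (p - 1) * ω ^ p := by
  have hp := hpq.pos
  rcases eq_or_ne s 0 with rfl | hs0
  · simp
  have hpow := ENNReal.rpow_le_rpow h hp.le
  have hexp : 1 / q * p = p - 1 := by
    have := hpq.inv_add_inv_eq_one
    have h1 : 1 / q = 1 - p⁻¹ := by rw [one_div]; linarith
    rw [h1, sub_mul, inv_mul_cancel₀ hp.ne', one_mul]
  have hp1 : 0 ≤ p - 1 := by linarith [hpq.lt]
  rw [ENNReal.mul_rpow_of_nonneg _ _ hp.le, ENNReal.mul_rpow_of_nonneg _ _ hp.le,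
    ← ENNReal.rpow_mul, hexp, ENNReal.mul_rpow_of_nonneg _ _ hp1] at hpow
  have hsp : s ^ p = s * s ^ (p - 1) := by
    conv_rhs => rw [← ENNReal.rpow_one s, ← ENNReal.rpow_mul, one_mul,
      ← ENNReal.rpow_add _ _ hs0 hs, add_sub_cancel]
  rw [hsp] at hpow
  have h0 : s ^ (p - 1) ≠ 0 := (ENNReal.rpow_pos (pos_iff_ne_zero.2 hs0) hs).ne'
  have ht : s ^ (p - 1) ≠ ⊤ := ENNReal.rpow_ne_top_of_nonneg hp1 hs
  refine (ENNReal.mul_le_mul_iff_left h0 ht).1 ?_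
  calc c ^ p * s * s ^ (p - 1) = c ^ p * (s * s ^ (p - 1)) := by ring
    _ ≤ ω ^ p * (K ^ (p - 1) * s ^ (p - 1)) := hpow
    _ = _ := by ring

variable {p α₁ α₂ : ℝ} {f : ℝ → ℝ → ℝ} {a : ℕ → ℕ → ℝ}

theorem MemLp0.lintegral_mixedDiff_ne_top (h : MemLp0 p f) (hp : 1 < p) (h1 : 0 < α₁) (h2 : 0 < α₂)
    (h₁ h₂ : ℝ) :
    ∫⁻ z, ‖mixedDiff α₁ α₂ h₁ h₂ (Function.uncurry f) z‖ₑ ^ p ∂squareMeasure ≠ ⊤ :=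
  ne_top_of_le_ne_top (ENNReal.mul_ne_top (ENNReal.rpow_ne_top_of_nonneg (by linarith)
    (tsum_enorm_ne_top_of_summable_abs (summable_mixedCoeff h1 h2))) (h.lintegral_ne_top hp))
    (lintegral_rpow_shiftSum_le hp h.meas h.torusPeriodic)

theorem MemLp0.aemeasurable_mixedDiff (h : MemLp0 p f) (hp : 1 < p) (h1 : 0 < α₁) (h2 : 0 < α₂)
    (h₁ h₂ : ℝ) : AEMeasurable (mixedDiff α₁ α₂ h₁ h₂ (Function.uncurry f)) squareMeasure :=
  aemeasurable_shiftSum (summable_mixedCoeff h1 h2) h.meas h.torusPeriodic (h.integrable hp)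

theorem MemLp0.lintegral_mixedDiff_le (h : MemLp0 p f) (hp : 1 < p) (h1 : 0 < α₁) (h2 : 0 < α₂)
    {δ₁ δ₂ h₁ h₂ : ℝ} (hh₁ : |h₁| ≤ δ₁) (hh₂ : |h₂| ≤ δ₂) :
    (∫⁻ z, ‖mixedDiff α₁ α₂ h₁ h₂ (Function.uncurry f) z‖ₑ ^ p ∂squareMeasure) ^ (1 / p) ≤
      mixedMod p α₁ α₂ δ₁ δ₂ f := by
  rw [← Lp2Norm_diff_eq (by linarith) h1 h2 h₁ h₂ h.meas h.torusPeriodic (h.integrable hp), mixedMod]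
  exact le_iSup_of_le h₁ (le_iSup_of_le hh₁ (le_iSup_of_le h₂ (le_iSup_of_le hh₂ le_rfl)))

theorem InMclass.integral_mixedDiff_mul_blockPoly (hf : InMclass p f a) (hp : 1 < p) (h1 : 0 < α₁)
    (h2 : 0 < α₂) (h₁ h₂ : ℝ) (J : Finset (ℕ × ℕ)) (c : ℕ × ℕ → ℝ) (s φ s' φ' : ℝ) :
    ∫ z, mixedDiff α₁ α₂ h₁ h₂ (Function.uncurry f) z * blockPoly J c s φ s' φ' z
      ∂squareMeasure =
    ∑ x ∈ J.sigma fun k => dyadicBlock k.1 ×ˢ dyadicBlock k.2, π ^ 2 * (c x.1 * a x.2.1 x.2.2) *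
      (diffMult α₁ h₁ x.2.1 (x.2.1 * s + φ) * diffMult α₂ h₂ x.2.2 (x.2.2 * s' + φ')) := by
  have hi := integrable_of_lintegral_ne_top hp (hf.1.aemeasurable_mixedDiff hp h1 h2 h₁ h₂)
    (hf.1.lintegral_mixedDiff_ne_top hp h1 h2 h₁ h₂)
  have hexp : ∀ z, mixedDiff α₁ α₂ h₁ h₂ (Function.uncurry f) z * blockPoly J c s φ s' φ' z =
      ∑ x ∈ J.sigma fun k => dyadicBlock k.1 ×ˢ dyadicBlock k.2,
        c x.1 * (mixedDiff α₁ α₂ h₁ h₂ (Function.uncurry f) z *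
          (cos (x.2.1 * z.1 + (x.2.1 * s + φ)) * cos (x.2.2 * z.2 + (x.2.2 * s' + φ')))) := by
    intro z
    rw [blockPoly, Finset.mul_sum, Finset.sum_sigma]
    refine Finset.sum_congr rfl fun k _ => ?_
    rw [blockCos, blockCos, Finset.sum_mul_sum, ← Finset.sum_product', Finset.mul_sum,
      Finset.mul_sum]
    refine Finset.sum_congr rfl fun x _ => ?_
    ring
  simp_rw [hexp]
  rw [integral_finsetSum _ fun x _ => (integrable_mul_cos_mul_cos hi _ _ _ _).const_mul _]
  refine Finset.sum_congr rfl fun x hx => ?_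
  have hx' := Finset.mem_product.1 (Finset.mem_sigma.1 hx).2
  have hn := Nat.one_le_iff_ne_zero.1 (one_le_of_mem_dyadicBlock hx'.1)
  have hm := Nat.one_le_iff_ne_zero.1 (one_le_of_mem_dyadicBlock hx'.2)
  rw [integral_const_mul, (hf.hasCosCoeff hp).integral_mixedDiff h1 h2 h₁ h₂ hf.1.meas
    hf.1.torusPeriodic (hf.1.integrable hp), axisZero, if_neg (by tauto)]
  ring

theorem MixedMonotone.le_sum_dyadicBlock (ha : MixedMonotone a) (i j : ℕ) :
    2 ^ i * 2 ^ j * a (2 ^ i) (2 ^ j) ≤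
      4 * ∑ x ∈ dyadicBlock i ×ˢ dyadicBlock j, a x.1 x.2 := by
  have hA := ha.nonneg (2 ^ i) (2 ^ j) Nat.one_le_two_pow Nat.one_le_two_pow
  have hle : ∀ x ∈ dyadicBlock i ×ˢ dyadicBlock j, a (2 ^ i) (2 ^ j) ≤ a x.1 x.2 := by
    intro x hx
    obtain ⟨hx1, hx2⟩ := Finset.mem_product.1 hx
    exact (ha.anti_fst _ _ _ (one_le_of_mem_dyadicBlock hx1) (le_of_mem_dyadicBlock hx1)
      Nat.one_le_two_pow).trans (ha.anti_snd _ _ _ (one_le_of_mem_dyadicBlock hx1)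
      (one_le_of_mem_dyadicBlock hx2) (le_of_mem_dyadicBlock hx2))
  have h := Finset.card_nsmul_le_sum _ _ _ hle
  rw [nsmul_eq_mul, Finset.card_product, Nat.cast_mul] at h
  have h1 := two_pow_le_card_dyadicBlock i
  have h2 := two_pow_le_card_dyadicBlock j
  calc 2 ^ i * 2 ^ j * a (2 ^ i) (2 ^ j) ≤
      (2 * (dyadicBlock i).card) * (2 * (dyadicBlock j).card) * a (2 ^ i) (2 ^ j) := by gcongr
    _ ≤ _ := by linarith

theorem MixedMonotone.dyadicCoef_nonneg (ha : MixedMonotone a) {δ₁ δ₂ : ℝ} (hδ₁ : 0 ≤ δ₁)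
    (hδ₂ : 0 ≤ δ₂) (k : ℕ × ℕ) : 0 ≤ dyadicCoef α₁ α₂ δ₁ δ₂ a k :=
  mul_nonneg (ha.nonneg _ _ Nat.one_le_two_pow Nat.one_le_two_pow)
    (mul_nonneg (dyadicWeight_nonneg hδ₁ _) (dyadicWeight_nonneg hδ₂ _))

/-- The dyadic terms over a finite set of blocks that have steps are detected by pairing the
difference with a suitable cosine polynomial. -/
theorem InMclass.exists_le_integral_mul_blockPoly (hf : InMclass p f a) (hp : 1 < p) (h1 : 0 < α₁)
    (h2 : 0 < α₂) {δ₁ δ₂ κ₁ κ₂ φ₁ φ₂ c₁ c₂ : ℝ} {I₁ I₂ : Set ℕ} (hδ₁ : 0 < δ₁) (hδ₂ : 0 < δ₂)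
    (hc₁ : 0 < c₁) (hc₂ : 0 < c₂) (hI₁ : HasSteps α₁ δ₁ κ₁ φ₁ c₁ I₁)
    (hI₂ : HasSteps α₂ δ₂ κ₂ φ₂ c₂ I₂) {J : Finset (ℕ × ℕ)}
    (hJ : ∀ k ∈ J, k.1 ∈ I₁ ∧ k.2 ∈ I₂) {c : ℕ × ℕ → ℝ} (hc : ∀ k ∈ J, 0 ≤ c k) :
    ∃ h₁ h₂, |h₁| ≤ δ₁ ∧ |h₂| ≤ δ₂ ∧
      π ^ 2 * (c₁ * c₂ / 4) * ∑ k ∈ J, c k * (dyadicCoef α₁ α₂ δ₁ δ₂ a k * (2 ^ k.1 * 2 ^ k.2)) ≤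
      ∫ z, mixedDiff α₁ α₂ h₁ h₂ (Function.uncurry f) z *
        blockPoly J c (κ₁ * h₁) φ₁ (κ₂ * h₂) φ₂ z ∂squareMeasure := by
  obtain ⟨M₁, hM₁, hS₁⟩ := hI₁
  obtain ⟨M₂, hM₂, hS₂⟩ := hI₂
  have ha := hf.mixedMonotone hp
  set S := J.sigma fun k => dyadicBlock k.1 ×ˢ dyadicBlock k.2
  set b : (Σ _ : ℕ × ℕ, ℕ × ℕ) → ℝ := fun x => π ^ 2 * (c x.1 * a x.2.1 x.2.2) with hb
  obtain ⟨h₂, hh₂, hle₂⟩ := hS₂ S (fun x => b x * M₁ x.2.1) (fun x => x.2.2)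
  obtain ⟨h₁, hh₁, hle₁⟩ := hS₁ S
    (fun x => b x * diffMult α₂ h₂ x.2.2 (x.2.2 * (κ₂ * h₂) + φ₂)) (fun x => x.2.1)
  refine ⟨h₁, h₂, hh₁, hh₂, ?_⟩
  rw [hf.integral_mixedDiff_mul_blockPoly hp h1 h2]
  have hlow : π ^ 2 * (c₁ * c₂ / 4) *
      ∑ k ∈ J, c k * (dyadicCoef α₁ α₂ δ₁ δ₂ a k * (2 ^ k.1 * 2 ^ k.2)) ≤
      ∑ x ∈ S, b x * M₁ x.2.1 * M₂ x.2.2 := by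
    rw [Finset.mul_sum, Finset.sum_sigma]
    refine Finset.sum_le_sum fun k hk => ?_
    have hw₁ := dyadicWeight_nonneg (α := α₁) hδ₁.le k.1
    have hw₂ := dyadicWeight_nonneg (α := α₂) hδ₂.le k.2
    have hck := hc k hk
    calc _ = π ^ 2 * c k * (c₁ * dyadicWeight α₁ δ₁ k.1 * (c₂ * dyadicWeight α₂ δ₂ k.2)) / 4 *
          (2 ^ k.1 * 2 ^ k.2 * a (2 ^ k.1) (2 ^ k.2)) := by
          rw [dyadicCoef]
          ring
      _ ≤ π ^ 2 * c k * (c₁ * dyadicWeight α₁ δ₁ k.1 * (c₂ * dyadicWeight α₂ δ₂ k.2)) / 4 *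
          (4 * ∑ x ∈ dyadicBlock k.1 ×ˢ dyadicBlock k.2, a x.1 x.2) :=
          mul_le_mul_of_nonneg_left (ha.le_sum_dyadicBlock _ _) (by positivity)
      _ = ∑ x ∈ dyadicBlock k.1 ×ˢ dyadicBlock k.2, π ^ 2 * (c k * a x.1 x.2) *
          ((c₁ * dyadicWeight α₁ δ₁ k.1) * (c₂ * dyadicWeight α₂ δ₂ k.2)) := by
          rw [Finset.mul_sum, Finset.mul_sum]
          refine Finset.sum_congr rfl fun x _ => ?_
          ring
      _ ≤ _ := by
          refine Finset.sum_le_sum fun x hx => ?_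
          obtain ⟨hx1, hx2⟩ := Finset.mem_product.1 hx
          have hax := ha.nonneg x.1 x.2 (one_le_of_mem_dyadicBlock hx1)
            (one_le_of_mem_dyadicBlock hx2)
          simp only [hb]
          rw [mul_assoc _ (M₁ x.1)]
          have hm₁ := hM₁ k.1 (hJ k hk).1 x.1 hx1
          have hm₂ := hM₂ k.2 (hJ k hk).2 x.2 hx2
          have hm₁0 : 0 ≤ M₁ x.1 := le_trans (by positivity) hm₁
          gcongr
  refine hlow.trans (hle₂.trans (le_of_eq_of_le ?_ (hle₁.trans_eq ?_)))
  · exact Finset.sum_congr rfl fun x _ => by ring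
  · exact Finset.sum_congr rfl fun x _ => by ring

end

section

theorem exists_sum_dyadic_le_mixedMod {p c₁ c₂ : ℝ} (hp : 1 < p) (hc₁ : 0 < c₁) (hc₂ : 0 < c₂) :
    ∃ C : ℝ, 0 < C ∧ ∀ (α₁ α₂ δ₁ δ₂ κ₁ κ₂ φ₁ φ₂ : ℝ) (f : ℝ → ℝ → ℝ) (a : ℕ → ℕ → ℝ)
      (I₁ I₂ : Set ℕ), 0 < α₁ → 0 < α₂ → 0 < δ₁ → 0 < δ₂ → InMclass p f a →
      HasSteps α₁ δ₁ κ₁ φ₁ c₁ I₁ → HasSteps α₂ δ₂ κ₂ φ₂ c₂ I₂ →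
      ∀ J : Finset (ℕ × ℕ), (∀ k ∈ J, k.1 ∈ I₁ ∧ k.2 ∈ I₂) →
        ENNReal.ofReal (∑ k ∈ J,
          dyadicCoef α₁ α₂ δ₁ δ₂ a k ^ p * (2 ^ k.1 * 2 ^ k.2) ^ (p - 1)) ≤
        ENNReal.ofReal C * mixedMod p α₁ α₂ δ₁ δ₂ f ^ p := by
  set q := p.conjExponent
  have hpq : p.HolderConjugate q := Real.HolderConjugate.conjExponent hp
  have hq1 : 1 < q := hpq.symm.lt
  have hp0 : 0 < p := by linarith
  obtain ⟨C₀, hC₀, H⟩ := lintegral_tsum_kernelEnvelope_le hq1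
  set c₃ := π ^ 2 * (c₁ * c₂ / 4) with hc₃
  have hc₃0 : 0 < c₃ := by positivity
  set K : ℝ≥0∞ := 16 ^ q * ENNReal.ofReal C₀ with hK
  have hKt : K ≠ ⊤ := ENNReal.mul_ne_top (ENNReal.rpow_ne_top_of_nonneg (by linarith)
    (by norm_num)) ENNReal.ofReal_ne_top
  have hc₃t : ENNReal.ofReal c₃ ^ p ≠ ⊤ :=
    ENNReal.rpow_ne_top_of_nonneg hp0.le ENNReal.ofReal_ne_top
  have hc₃p : ENNReal.ofReal c₃ ^ p ≠ 0 :=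
    (ENNReal.rpow_pos (ENNReal.ofReal_pos.2 hc₃0) ENNReal.ofReal_ne_top).ne'
  obtain ⟨C, hC, hCle⟩ := exists_ofReal_ge (c := (ENNReal.ofReal c₃ ^ p)⁻¹ * K ^ (p - 1))
    (ENNReal.mul_ne_top (ENNReal.inv_ne_top.2 hc₃p)
      (ENNReal.rpow_ne_top_of_nonneg (by linarith) hKt))
  refine ⟨C, hC, fun α₁ α₂ δ₁ δ₂ κ₁ κ₂ φ₁ φ₂ f a I₁ I₂ h1 h2 hδ₁ hδ₂ hf hI₁ hI₂ J hJ => ?_⟩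
  have ha := hf.mixedMonotone hp
  set D : ℕ × ℕ → ℝ := dyadicCoef α₁ α₂ δ₁ δ₂ a
  have hD : ∀ k, 0 ≤ D k := ha.dyadicCoef_nonneg hδ₁.le hδ₂.le
  set c : ℕ × ℕ → ℝ := fun k => D k ^ (p - 1) * (2 ^ k.1 * 2 ^ k.2) ^ (p - 2) with hc
  have hN : ∀ k : ℕ × ℕ, (0 : ℝ) < 2 ^ k.1 * 2 ^ k.2 := fun k => by positivity
  have hc0 : ∀ k ∈ J, 0 ≤ c k := fun k _ =>
    mul_nonneg (rpow_nonneg (hD k) _) (rpow_nonneg (hN k).le _)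
  obtain ⟨h₁, h₂, hh₁, hh₂, hle⟩ := hf.exists_le_integral_mul_blockPoly hp h1 h2 hδ₁ hδ₂ hc₁ hc₂
    hI₁ hI₂ hJ hc0
  set s := ∑ k ∈ J, D k ^ p * (2 ^ k.1 * 2 ^ k.2) ^ (p - 1)
  have hs1 : ∑ k ∈ J, c k * (D k * (2 ^ k.1 * 2 ^ k.2)) = s := by
    refine Finset.sum_congr rfl fun k _ => ?_
    have e1 : D k ^ p = D k ^ (p - 1) * D k := by
      rw [← rpow_add_one' (hD k) (by linarith), sub_add_cancel]
    have e2 : (2 ^ k.1 * 2 ^ k.2 : ℝ) ^ (p - 1) =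
        (2 ^ k.1 * 2 ^ k.2) ^ (p - 2) * (2 ^ k.1 * 2 ^ k.2) := by
      rw [← rpow_add_one (hN k).ne']
      congr 1
      ring
    rw [e1, e2]
    simp only [hc]
    ring
  have hs2 : ∑ k ∈ J, c k ^ q * (2 ^ k.1 * 2 ^ k.2) ^ (q - 1) = s := by
    refine Finset.sum_congr rfl fun k _ => ?_
    have hexp : (p - 1) * q = p := hpq.sub_one_mul_conj
    simp only [hc]
    rw [mul_rpow (rpow_nonneg (hD k) _) (rpow_nonneg (hN k).le _), ← rpow_mul (hD k),
      ← rpow_mul (hN k).le, hexp, mul_assoc, ← rpow_add (hN k)]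
    congr 2
    linarith
  rw [hs1] at hle
  have hmain : ENNReal.ofReal c₃ * ENNReal.ofReal s ≤
      mixedMod p α₁ α₂ δ₁ δ₂ f * (K * ENNReal.ofReal s) ^ (1 / q) := by
    rw [← ENNReal.ofReal_mul hc₃0.le]
    calc _ ≤ ‖∫ z, mixedDiff α₁ α₂ h₁ h₂ (Function.uncurry f) z *
          blockPoly J c (κ₁ * h₁) φ₁ (κ₂ * h₂) φ₂ z ∂squareMeasure‖ₑ := by
          rw [enorm_eq_ofReal_abs]
          exact ENNReal.ofReal_le_ofReal (hle.trans (le_abs_self _))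
      _ ≤ _ := enorm_integral_mul_le hpq (hf.1.aemeasurable_mixedDiff hp h1 h2 h₁ h₂)
          (continuous_blockPoly _ _ _ _ _ _).measurable.aemeasurable
      _ ≤ _ := by
          refine mul_le_mul' (hf.1.lintegral_mixedDiff_le hp h1 h2 hh₁ hh₂)
            (ENNReal.rpow_le_rpow ?_ (by have := hpq.symm.pos; positivity))
          have := lintegral_blockPoly_le hq1 H hc0 (κ₁ * h₁) φ₁ (κ₂ * h₂) φ₂
          rwa [hs2, ← mul_assoc] at this
  have habs := ENNReal.le_of_mul_le_mul_rpow hpq ENNReal.ofReal_ne_top hmain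
  calc ENNReal.ofReal s = (ENNReal.ofReal c₃ ^ p)⁻¹ * (ENNReal.ofReal c₃ ^ p * ENNReal.ofReal s) := by
        rw [← mul_assoc, ENNReal.inv_mul_cancel hc₃p hc₃t, one_mul]
    _ ≤ (ENNReal.ofReal c₃ ^ p)⁻¹ * (K ^ (p - 1) * mixedMod p α₁ α₂ δ₁ δ₂ f ^ p) := by gcongr
    _ = (ENNReal.ofReal c₃ ^ p)⁻¹ * K ^ (p - 1) * mixedMod p α₁ α₂ δ₁ δ₂ f ^ p := by ring
    _ ≤ _ := by gcongr

theorem exists_dyadicSum_le_mixedMod_rpow {p α₁ α₂ : ℝ} (hp : 1 < p) (h1 : 0 < α₁) (h2 : 0 < α₂) :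
    ∃ C : ℝ, 0 < C ∧ ∀ (f : ℝ → ℝ → ℝ) (a : ℕ → ℕ → ℝ) (δ₁ δ₂ : ℝ), InMclass p f a →
      0 < δ₁ → 0 < δ₂ →
      dyadicSum p α₁ α₂ δ₁ δ₂ a ≤ ENNReal.ofReal C * mixedMod p α₁ α₂ δ₁ δ₂ f ^ p := by
  obtain ⟨c₁, hc₁, H₁⟩ := exists_hasSteps h1
  obtain ⟨c₂, hc₂, H₂⟩ := exists_hasSteps h2
  obtain ⟨C, hC, H⟩ := exists_sum_dyadic_le_mixedMod hp hc₁ hc₂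
  have hp0 : 0 < p := by linarith
  refine ⟨4 * C, by positivity, fun f a δ₁ δ₂ hf hδ₁ hδ₂ => ?_⟩
  obtain ⟨I₁, hl₁, hu₁⟩ := H₁ δ₁ hδ₁
  obtain ⟨I₂, hl₂, hu₂⟩ := H₂ δ₂ hδ₂
  generalize hI₁ : I₁ᶜ = I₁' at hu₁
  generalize hI₂ : I₂ᶜ = I₂' at hu₂
  have hD := (hf.mixedMonotone hp).dyadicCoef_nonneg (α₁ := α₁) (α₂ := α₂) hδ₁.le hδ₂.le
  set ω := mixedMod p α₁ α₂ δ₁ δ₂ f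
  classical
  refine ENNReal.summable.tsum_le_of_sum_le fun J => ?_
  have hJ : ∑ k ∈ J, ENNReal.ofReal (dyadicCoef α₁ α₂ δ₁ δ₂ a k) ^ p *
      ENNReal.ofReal ((2 ^ k.1 * 2 ^ k.2) ^ (p - 1)) =
      ENNReal.ofReal (∑ k ∈ J,
        dyadicCoef α₁ α₂ δ₁ δ₂ a k ^ p * (2 ^ k.1 * 2 ^ k.2) ^ (p - 1)) := by
    rw [ENNReal.ofReal_sum_of_nonneg fun k _ => mul_nonneg (rpow_nonneg (hD k) _) (by positivity)]
    refine Finset.sum_congr rfl fun k _ => ?_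
    rw [ENNReal.ofReal_mul (rpow_nonneg (hD k) _), ENNReal.ofReal_rpow_of_nonneg (hD k) hp0.le]
  have hq : ∀ {κ₁ κ₂ φ₁ φ₂ : ℝ} {I₁ I₂ : Set ℕ}, HasSteps α₁ δ₁ κ₁ φ₁ c₁ I₁ →
      HasSteps α₂ δ₂ κ₂ φ₂ c₂ I₂ →
      ENNReal.ofReal (∑ k ∈ J.filter fun k => k.1 ∈ I₁ ∧ k.2 ∈ I₂,
        dyadicCoef α₁ α₂ δ₁ δ₂ a k ^ p * (2 ^ k.1 * 2 ^ k.2) ^ (p - 1)) ≤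
      ENNReal.ofReal C * ω ^ p := fun hI₁ hI₂ =>
    H _ _ _ _ _ _ _ _ f a _ _ h1 h2 hδ₁ hδ₂ hf hI₁ hI₂ _ fun k hk => (Finset.mem_filter.1 hk).2
  have hsplit : ∀ g : ℕ × ℕ → ℝ, ∑ k ∈ J, g k =
      ((∑ k ∈ J.filter fun k => k.1 ∈ I₁ ∧ k.2 ∈ I₂, g k) +
        ∑ k ∈ J.filter fun k => k.1 ∈ I₁ ∧ k.2 ∈ I₂', g k) +
      ((∑ k ∈ J.filter fun k => k.1 ∈ I₁' ∧ k.2 ∈ I₂, g k) +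
        ∑ k ∈ J.filter fun k => k.1 ∈ I₁' ∧ k.2 ∈ I₂', g k) := by
    intro g
    simp_rw [Finset.sum_filter, ← Finset.sum_add_distrib]
    refine Finset.sum_congr rfl fun k _ => ?_
    by_cases hk₁ : k.1 ∈ I₁ <;> by_cases hk₂ : k.2 ∈ I₂ <;> simp [hk₁, hk₂, ← hI₁, ← hI₂]
  rw [hJ, hsplit]
  refine (ENNReal.ofReal_add_le.trans (add_le_add ENNReal.ofReal_add_le
    ENNReal.ofReal_add_le)).trans ?_
  refine (add_le_add (add_le_add (hq hl₁ hl₂) (hq hl₁ hu₂)) (add_le_add (hq hu₁ hl₂)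
    (hq hu₁ hu₂))).trans_eq ?_
  rw [ENNReal.ofReal_mul (by norm_num), ENNReal.ofReal_ofNat]
  ring

end

section

/-- The one-dimensional weighted integral of the dyadic weights of order `β`. -/
def weightIntegral (p α β δ : ℝ) (i : ℕ) : ℝ≥0∞ :=
  ∫⁻ t in Set.Ioo δ 1, ENNReal.ofReal ((t ^ (-α)) ^ p / t) *
    ENNReal.ofReal (dyadicWeight β t i) ^ p

theorem rpow_neg_rpow_div {t : ℝ} (ht : 0 < t) (α p : ℝ) :
    (t ^ (-α)) ^ p / t = t ^ (-(α * p) - 1) := by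
  rw [rpow_sub_one ht.ne', ← rpow_mul ht.le, neg_mul]

theorem ofReal_dyadicWeight_rpow {β t p : ℝ} (ht : 0 ≤ t) (hp : 0 ≤ p) (i : ℕ) :
    ENNReal.ofReal (dyadicWeight β t i) ^ p = ENNReal.ofReal (min 1 (2 ^ i * t) ^ (β * p)) := by
  rw [ENNReal.ofReal_rpow_of_nonneg (dyadicWeight_nonneg ht i) hp, dyadicWeight,
    ← rpow_mul (le_min zero_le_one (by positivity))]

theorem weightIntegral_le {p α β δ : ℝ} (hp : 0 < p) (hα : 0 < α) (hαβ : α < β) (hδ : 0 < δ)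
    (i : ℕ) :
    ENNReal.ofReal (δ ^ α) ^ p * weightIntegral p α β δ i ≤
      ENNReal.ofReal (1 / ((β - α) * p) + 1 / (α * p)) *
        ENNReal.ofReal (dyadicWeight α δ i) ^ p := by
  have hαp : 0 < α * p := by positivity
  have hβp : 0 < (β - α) * p := mul_pos (by linarith) hp
  have hβp' : 0 < β * p := mul_pos (by linarith) hp
  have htail : ∀ τ : ℝ, 0 < τ → ∫⁻ t in Set.Ioi τ, ENNReal.ofReal (t ^ (-(α * p) - 1)) =
      ENNReal.ofReal (τ ^ (-(α * p)) / (α * p)) := by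
    intro τ hτ
    rw [lintegral_Ioi_rpow hτ (by linarith)]
    congr 2 <;> ring_nf
  have hint1 : ∀ t : ℝ, 0 < t → ENNReal.ofReal ((t ^ (-α)) ^ p / t) *
      ENNReal.ofReal (dyadicWeight β t i) ^ p ≤ ENNReal.ofReal (t ^ (-(α * p) - 1)) := by
    intro t ht
    rw [rpow_neg_rpow_div ht, ofReal_dyadicWeight_rpow ht.le hp.le]
    refine mul_le_of_le_one_right' ?_
    rw [← ENNReal.ofReal_one]
    exact ENNReal.ofReal_le_ofReal
      (rpow_le_one (le_min zero_le_one (by positivity)) (min_le_left _ _) hβp'.le)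
  rw [ofReal_dyadicWeight_rpow hδ.le hp.le, ENNReal.ofReal_rpow_of_nonneg (by positivity) hp.le,
    ← rpow_mul hδ.le, ← ENNReal.ofReal_mul (by positivity)]
  have hK : 0 < 1 / ((β - α) * p) + 1 / (α * p) := by positivity
  rcases le_total 1 (2 ^ i * δ) with h1 | h1
  · calc _ ≤ ENNReal.ofReal (δ ^ (α * p)) *
          ∫⁻ t in Set.Ioi δ, ENNReal.ofReal (t ^ (-(α * p) - 1)) := by
          gcongr
          refine (setLIntegral_mono' measurableSet_Ioo fun t ht => hint1 t (hδ.trans ht.1)).trans ?_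
          exact lintegral_mono_set Set.Ioo_subset_Ioi_self
      _ = ENNReal.ofReal (1 / (α * p)) := by
          rw [htail δ hδ, ← ENNReal.ofReal_mul (by positivity), rpow_neg hδ.le]
          congr 1
          have : δ ^ (α * p) ≠ 0 := (rpow_pos_of_pos hδ _).ne'
          field_simp
      _ ≤ _ := by
          rw [min_eq_left h1, one_rpow, mul_one]
          exact ENNReal.ofReal_le_ofReal (le_add_of_nonneg_left (by positivity))
  · have h2 : (0 : ℝ) < 2 ^ i := by positivity
    set τ : ℝ := (2 ^ i)⁻¹ with hτ
    have hτ0 : 0 < τ := by positivity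
    have hhead : ∫⁻ t in Set.Ioc 0 τ, ENNReal.ofReal ((t ^ (-α)) ^ p / t) *
        ENNReal.ofReal (dyadicWeight β t i) ^ p ≤
        ENNReal.ofReal (τ ^ (-(α * p)) / ((β - α) * p)) := by
      calc _ ≤ ∫⁻ t in Set.Ioc 0 τ, ENNReal.ofReal ((2 ^ i) ^ (β * p)) *
            ENNReal.ofReal (t ^ ((β - α) * p - 1)) := by
            refine setLIntegral_mono' measurableSet_Ioc fun t ht => ?_
            have ht0 := ht.1
            rw [rpow_neg_rpow_div ht0, ofReal_dyadicWeight_rpow ht0.le hp.le,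
              ← ENNReal.ofReal_mul (by positivity), ← ENNReal.ofReal_mul (by positivity)]
            refine ENNReal.ofReal_le_ofReal ?_
            calc _ ≤ t ^ (-(α * p) - 1) * (2 ^ i * t) ^ (β * p) := by
                  gcongr
                  exact min_le_right _ _
              _ = _ := by
                  rw [mul_rpow h2.le ht0.le, mul_left_comm, ← rpow_add ht0]
                  congr 2
                  ring
        _ = _ := by
            rw [lintegral_const_mul' _ _ ENNReal.ofReal_ne_top, lintegral_Ioc_rpow hτ0
              (by linarith), ← ENNReal.ofReal_mul (by positivity), sub_add_cancel, mul_div_assoc',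
              ← inv_inv ((2 : ℝ) ^ i), ← hτ, inv_rpow hτ0.le, ← rpow_neg hτ0.le,
              ← rpow_add hτ0]
            ring_nf
    calc _ ≤ ENNReal.ofReal (δ ^ (α * p)) *
          (ENNReal.ofReal (τ ^ (-(α * p)) / ((β - α) * p)) +
            ENNReal.ofReal (τ ^ (-(α * p)) / (α * p))) := by
          gcongr
          refine (lintegral_mono_set (t := Set.Ioc 0 τ ∪ Set.Ioi τ) ?_).trans
            ((lintegral_union_le _ _ _).trans (add_le_add hhead ?_))
          · rw [Set.Ioc_union_Ioi_eq_Ioi hτ0.le]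
            exact fun t ht => hδ.trans ht.1
          · rw [← htail τ hτ0]
            exact setLIntegral_mono' measurableSet_Ioi fun t ht => hint1 t (hτ0.trans ht)
      _ ≤ _ := by
          rw [← ENNReal.ofReal_add (by positivity) (by positivity),
            ← ENNReal.ofReal_mul (by positivity), min_eq_right h1]
          refine ENNReal.ofReal_le_ofReal (le_of_eq ?_)
          rw [mul_rpow h2.le hδ.le, hτ, inv_rpow h2.le, ← rpow_neg h2.le, neg_neg]
          ring

theorem le_weightIntegral {p α β δ : ℝ} (hp : 0 < p) (hα : 0 < α) (hβ : 0 < β) (hδ : 0 < δ)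
    (hδ' : δ ≤ 1 / 2) (i : ℕ) :
    ENNReal.ofReal (dyadicWeight α δ i) ^ p ≤ ENNReal.ofReal (2 ^ (β * p + α * p + 1)) *
      (ENNReal.ofReal (δ ^ α) ^ p * weightIntegral p α β δ i) := by
  have hαp : 0 < α * p := by positivity
  have hβp : 0 < β * p := mul_pos hβ hp
  have h2 : (0 : ℝ) < 2 ^ i := by positivity
  set τ : ℝ := max δ ((2 * 2 ^ i)⁻¹) with hτ
  have hτ0 : 0 < τ := lt_max_of_lt_left hδ
  have hτ2 : τ ≤ 1 / 2 := by
    refine max_le hδ' ?_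
    rw [one_div]
    exact inv_anti₀ two_pos (by nlinarith [one_le_pow₀ (M₀ := ℝ) one_le_two (n := i)])
  have hW : ENNReal.ofReal ((2 * τ) ^ (-(α * p) - 1) * (1 / 2) ^ (β * p) * τ) ≤
      weightIntegral p α β δ i := by
    calc _ = ∫⁻ t in Set.Ioo τ (2 * τ),
          ENNReal.ofReal ((2 * τ) ^ (-(α * p) - 1) * (1 / 2) ^ (β * p)) := by
          rw [setLIntegral_const, Real.volume_Ioo, ← ENNReal.ofReal_mul (by positivity)]
          ring_nf
      _ ≤ ∫⁻ t in Set.Ioo τ (2 * τ), ENNReal.ofReal ((t ^ (-α)) ^ p / t) *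
          ENNReal.ofReal (dyadicWeight β t i) ^ p := by
          refine setLIntegral_mono' measurableSet_Ioo fun t ht => ?_
          have ht0 := hτ0.trans ht.1
          rw [rpow_neg_rpow_div ht0, ofReal_dyadicWeight_rpow ht0.le hp.le,
            ← ENNReal.ofReal_mul (by positivity)]
          refine ENNReal.ofReal_le_ofReal (mul_le_mul ?_ ?_ (by positivity) (by positivity))
          · exact rpow_le_rpow_of_nonpos ht0 ht.2.le (by linarith)
          · refine rpow_le_rpow (by norm_num) (le_min (by norm_num) ?_) hβp.le
            have h3 : (2 * 2 ^ i)⁻¹ ≤ t := (le_max_right _ _).trans ht.1.le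
            calc (1 / 2 : ℝ) = 2 ^ i * (2 * 2 ^ i)⁻¹ := by field_simp
              _ ≤ _ := by gcongr
      _ ≤ _ := lintegral_mono_set (Set.Ioo_subset_Ioo (le_max_left _ _) (by linarith))
  calc _ ≤ ENNReal.ofReal (2 ^ (β * p + α * p + 1)) * (ENNReal.ofReal (δ ^ α) ^ p *
        ENNReal.ofReal ((2 * τ) ^ (-(α * p) - 1) * (1 / 2) ^ (β * p) * τ)) := by
        rw [ofReal_dyadicWeight_rpow hδ.le hp.le, ENNReal.ofReal_rpow_of_nonneg (by positivity)
          hp.le, ← rpow_mul hδ.le, ← ENNReal.ofReal_mul (by positivity),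
          ← ENNReal.ofReal_mul (by positivity)]
        refine ENNReal.ofReal_le_ofReal ?_
        have e1 : (2 : ℝ) ^ (β * p + α * p + 1) * (δ ^ (α * p) *
            ((2 * τ) ^ (-(α * p) - 1) * (1 / 2) ^ (β * p) * τ)) = (δ / τ) ^ (α * p) := by
          rw [mul_rpow two_pos.le hτ0.le, rpow_sub_one hτ0.ne', rpow_sub_one two_ne_zero,
            rpow_neg hτ0.le, rpow_neg two_pos.le, div_rpow one_pos.le two_pos.le, one_rpow,
            rpow_add_one two_ne_zero, rpow_add two_pos, div_rpow hδ.le hτ0.le]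
          have := (rpow_pos_of_pos hτ0 (α * p)).ne'
          field_simp
        rw [e1]
        refine rpow_le_rpow (le_min zero_le_one (by positivity)) ?_ hαp.le
        rw [le_div_iff₀ hτ0, hτ, mul_max_of_nonneg _ _ (le_min zero_le_one (by positivity))]
        refine max_le (mul_le_of_le_one_left hδ.le (min_le_left _ _)) ?_
        calc _ ≤ 2 ^ i * δ * (2 * 2 ^ i)⁻¹ := by
              gcongr
              exact min_le_right _ _
          _ = δ / 2 := by field_simp
          _ ≤ δ := by linarith
    _ ≤ _ := by gcongr

end

section

/-- The weightless part of the terms of `dyadicSum`. -/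
def dyadicMass (p : ℝ) (a : ℕ → ℕ → ℝ) (k : ℕ × ℕ) : ℝ≥0∞ :=
  ENNReal.ofReal (a (2 ^ k.1) (2 ^ k.2)) ^ p * ENNReal.ofReal ((2 ^ k.1 * 2 ^ k.2) ^ (p - 1))

variable {p α₁ α₂ β₁ β₂ δ₁ δ₂ : ℝ} {a : ℕ → ℕ → ℝ}

theorem MixedMonotone.dyadicSum_eq (ha : MixedMonotone a) (hp : 0 < p) (hδ₁ : 0 ≤ δ₁) :
    dyadicSum p α₁ α₂ δ₁ δ₂ a = ∑' k : ℕ × ℕ, dyadicMass p a k *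
      (ENNReal.ofReal (dyadicWeight α₁ δ₁ k.1) ^ p *
        ENNReal.ofReal (dyadicWeight α₂ δ₂ k.2) ^ p) := by
  refine tsum_congr fun k => ?_
  rw [dyadicCoef, ENNReal.ofReal_mul (ha.nonneg _ _ Nat.one_le_two_pow Nat.one_le_two_pow),
    ENNReal.ofReal_mul (dyadicWeight_nonneg hδ₁ _), ENNReal.mul_rpow_of_nonneg _ _ hp.le,
    ENNReal.mul_rpow_of_nonneg _ _ hp.le, dyadicMass]
  ring

theorem measurable_dyadicWeight (β : ℝ) (i : ℕ) : Measurable fun t => dyadicWeight β t i := by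
  unfold dyadicWeight
  fun_prop

theorem lintegral_lintegral_tsum_mul (m : ℕ × ℕ → ℝ≥0∞) {g₁ g₂ : ℕ → ℝ → ℝ≥0∞}
    (hg₁ : ∀ i, Measurable (g₁ i)) (hg₂ : ∀ i, Measurable (g₂ i)) (μ ν : Measure ℝ) :
    ∫⁻ x, ∫⁻ y, ∑' k : ℕ × ℕ, m k * (g₁ k.1 x * g₂ k.2 y) ∂ν ∂μ =
      ∑' k : ℕ × ℕ, m k * ((∫⁻ x, g₁ k.1 x ∂μ) * ∫⁻ y, g₂ k.2 y ∂ν) := by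
  have inner : ∀ x, ∫⁻ y, ∑' k : ℕ × ℕ, m k * (g₁ k.1 x * g₂ k.2 y) ∂ν =
      ∑' k : ℕ × ℕ, m k * (g₁ k.1 x * ∫⁻ y, g₂ k.2 y ∂ν) := fun x => by
    rw [lintegral_tsum fun k : ℕ × ℕ =>
      (((hg₂ k.2).const_mul (g₁ k.1 x)).const_mul (m k)).aemeasurable]
    refine tsum_congr fun k => ?_
    rw [lintegral_const_mul _ ((hg₂ k.2).const_mul _), lintegral_const_mul _ (hg₂ k.2)]
  simp only [inner]
  rw [lintegral_tsum fun k : ℕ × ℕ =>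
    (((hg₁ k.1).mul_const (∫⁻ y, g₂ k.2 y ∂ν)).const_mul (m k)).aemeasurable]
  refine tsum_congr fun k => ?_
  rw [lintegral_const_mul _ ((hg₁ k.1).mul_const _), lintegral_mul_const _ (hg₁ k.1)]

theorem MixedMonotone.lintegral_dyadicSum (ha : MixedMonotone a) (hp : 0 < p) (hδ₁ : 0 < δ₁)
    (hδ₂ : 0 < δ₂) :
    ∫⁻ t₁ in Set.Ioo δ₁ 1, ∫⁻ t₂ in Set.Ioo δ₂ 1,
      ENNReal.ofReal ((t₁ ^ (-α₁) * t₂ ^ (-α₂)) ^ p / (t₁ * t₂)) * dyadicSum p β₁ β₂ t₁ t₂ a =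
    ∑' k : ℕ × ℕ, dyadicMass p a k *
      (weightIntegral p α₁ β₁ δ₁ k.1 * weightIntegral p α₂ β₂ δ₂ k.2) := by
  have hmg : ∀ (α β : ℝ) (i : ℕ), Measurable fun t : ℝ =>
      ENNReal.ofReal ((t ^ (-α)) ^ p / t) * ENNReal.ofReal (dyadicWeight β t i) ^ p :=
    fun α β i => by
      have := measurable_dyadicWeight β i
      fun_prop
  unfold weightIntegral
  rw [← lintegral_lintegral_tsum_mul _ (hmg α₁ β₁) (hmg α₂ β₂)]
  refine setLIntegral_congr_fun measurableSet_Ioo fun t₁ ht₁ =>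
    setLIntegral_congr_fun measurableSet_Ioo fun t₂ ht₂ => ?_
  have h1 : 0 < t₁ := hδ₁.trans ht₁.1
  have h2 : 0 < t₂ := hδ₂.trans ht₂.1
  simp only [ha.dyadicSum_eq hp h1.le, ← ENNReal.tsum_mul_left]
  refine tsum_congr fun k => ?_
  rw [mul_rpow (by positivity) (by positivity), mul_div_mul_comm,
    ENNReal.ofReal_mul (by positivity)]
  ring

theorem marchaudInt_rpow (hp : 0 < p) (hδ₁ : 0 < δ₁) (f : ℝ → ℝ → ℝ) :
    marchaudInt p α₁ α₂ β₁ β₂ δ₁ δ₂ p f ^ p =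
      ENNReal.ofReal (δ₁ ^ α₁) ^ p * ENNReal.ofReal (δ₂ ^ α₂) ^ p *
      ∫⁻ t₁ in Set.Ioo δ₁ 1, ∫⁻ t₂ in Set.Ioo δ₂ 1,
        ENNReal.ofReal ((t₁ ^ (-α₁) * t₂ ^ (-α₂)) ^ p / (t₁ * t₂)) *
          mixedMod p β₁ β₂ t₁ t₂ f ^ p := by
  rw [marchaudInt, ENNReal.mul_rpow_of_nonneg _ _ hp.le, ← ENNReal.rpow_mul,
    one_div_mul_cancel hp.ne', ENNReal.rpow_one, ENNReal.ofReal_mul (by positivity),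
    ENNReal.mul_rpow_of_nonneg _ _ hp.le]

theorem le_ofReal_mul_of_rpow_le {x y : ℝ≥0∞} {C : ℝ} (hp : 0 < p) (hC : 0 ≤ C)
    (h : x ^ p ≤ ENNReal.ofReal C * y ^ p) : x ≤ ENNReal.ofReal (C ^ (1 / p)) * y := by
  rw [← ENNReal.rpow_le_rpow_iff hp, ENNReal.mul_rpow_of_nonneg _ _ hp.le,
    ENNReal.ofReal_rpow_of_nonneg (by positivity) hp.le, ← rpow_mul hC, one_div_mul_cancel hp.ne',
    rpow_one]
  exact h

theorem exists_mixedMod_le_marchaudInt (hp : 1 < p) (hα₁ : 0 < α₁) (hα₂ : 0 < α₂)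
    (hαβ₁ : α₁ < β₁) (hαβ₂ : α₂ < β₂) :
    ∃ C : ℝ, 0 < C ∧ ∀ (f : ℝ → ℝ → ℝ) (a : ℕ → ℕ → ℝ) (δ₁ δ₂ : ℝ), InMclass p f a →
      δ₁ ∈ Set.Ioo (0 : ℝ) (1 / 2) → δ₂ ∈ Set.Ioo (0 : ℝ) (1 / 2) →
      mixedMod p α₁ α₂ δ₁ δ₂ f ^ p ≤
        ENNReal.ofReal C * marchaudInt p α₁ α₂ β₁ β₂ δ₁ δ₂ p f ^ p := by
  have hβ₁ := hα₁.trans hαβ₁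
  have hβ₂ := hα₂.trans hαβ₂
  have hp0 : 0 < p := by linarith
  obtain ⟨C₁, hC₁, H₁⟩ := exists_mixedMod_rpow_le_dyadicSum hp hα₁ hα₂
  obtain ⟨C₂, hC₂, H₂⟩ := exists_dyadicSum_le_mixedMod_rpow hp hβ₁ hβ₂
  set K₁ : ℝ := 2 ^ (β₁ * p + α₁ * p + 1)
  set K₂ : ℝ := 2 ^ (β₂ * p + α₂ * p + 1)
  have hK₁ : 0 < K₁ := by positivity
  have hK₂ : 0 < K₂ := by positivity
  refine ⟨C₁ * (K₁ * K₂ * C₂), by positivity, fun f a δ₁ δ₂ hf hδ₁ hδ₂ => ?_⟩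
  have ha := hf.mixedMonotone hp
  set d₁ := ENNReal.ofReal (δ₁ ^ α₁) ^ p
  set d₂ := ENNReal.ofReal (δ₂ ^ α₂) ^ p
  have hsum : dyadicSum p α₁ α₂ δ₁ δ₂ a ≤ ENNReal.ofReal (K₁ * K₂) * (d₁ * d₂ *
      ∑' k : ℕ × ℕ, dyadicMass p a k *
        (weightIntegral p α₁ β₁ δ₁ k.1 * weightIntegral p α₂ β₂ δ₂ k.2)) := by
    rw [ha.dyadicSum_eq hp0 hδ₁.1.le, ← ENNReal.tsum_mul_left, ← ENNReal.tsum_mul_left]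
    refine ENNReal.tsum_le_tsum fun k => ?_
    calc _ ≤ dyadicMass p a k * ((ENNReal.ofReal K₁ * (d₁ * weightIntegral p α₁ β₁ δ₁ k.1)) *
          (ENNReal.ofReal K₂ * (d₂ * weightIntegral p α₂ β₂ δ₂ k.2))) := by
          gcongr
          · exact le_weightIntegral hp0 hα₁ hβ₁ hδ₁.1 hδ₁.2.le _
          · exact le_weightIntegral hp0 hα₂ hβ₂ hδ₂.1 hδ₂.2.le _
      _ = _ := by
          rw [ENNReal.ofReal_mul hK₁.le]
          ring
  rw [← ha.lintegral_dyadicSum hp0 hδ₁.1 hδ₂.1] at hsum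
  calc _ ≤ _ := H₁ f a δ₁ δ₂ hf hδ₁.1 hδ₂.1
    _ ≤ ENNReal.ofReal C₁ * (ENNReal.ofReal (K₁ * K₂) * (d₁ * d₂ *
        (ENNReal.ofReal C₂ * ∫⁻ t₁ in Set.Ioo δ₁ 1, ∫⁻ t₂ in Set.Ioo δ₂ 1,
        ENNReal.ofReal ((t₁ ^ (-α₁) * t₂ ^ (-α₂)) ^ p / (t₁ * t₂)) *
          mixedMod p β₁ β₂ t₁ t₂ f ^ p))) := by
        refine mul_le_mul_right (hsum.trans (mul_le_mul_right (mul_le_mul_right ?_ _) _)) _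
        rw [← lintegral_const_mul' _ _ ENNReal.ofReal_ne_top]
        refine setLIntegral_mono' measurableSet_Ioo fun t₁ ht₁ => ?_
        rw [← lintegral_const_mul' _ _ ENNReal.ofReal_ne_top]
        refine setLIntegral_mono' measurableSet_Ioo fun t₂ ht₂ => ?_
        rw [mul_left_comm]
        gcongr
        exact H₂ f a t₁ t₂ hf (hδ₁.1.trans ht₁.1) (hδ₂.1.trans ht₂.1)
    _ = _ := by
        rw [marchaudInt_rpow hp0 hδ₁.1, ENNReal.ofReal_mul hC₁.le,
          ENNReal.ofReal_mul (mul_pos hK₁ hK₂).le]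
        ring

theorem exists_marchaudInt_le_mixedMod (hp : 1 < p) (hα₁ : 0 < α₁) (hα₂ : 0 < α₂)
    (hαβ₁ : α₁ < β₁) (hαβ₂ : α₂ < β₂) :
    ∃ C : ℝ, 0 < C ∧ ∀ (f : ℝ → ℝ → ℝ) (a : ℕ → ℕ → ℝ) (δ₁ δ₂ : ℝ), InMclass p f a →
      δ₁ ∈ Set.Ioo (0 : ℝ) (1 / 2) → δ₂ ∈ Set.Ioo (0 : ℝ) (1 / 2) →
      marchaudInt p α₁ α₂ β₁ β₂ δ₁ δ₂ p f ^ p ≤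
        ENNReal.ofReal C * mixedMod p α₁ α₂ δ₁ δ₂ f ^ p := by
  have hp0 : 0 < p := by linarith
  obtain ⟨C₁, hC₁, H₁⟩ := exists_dyadicSum_le_mixedMod_rpow hp hα₁ hα₂
  obtain ⟨C₂, hC₂, H₂⟩ := exists_mixedMod_rpow_le_dyadicSum hp (hα₁.trans hαβ₁) (hα₂.trans hαβ₂)
  set K₁ : ℝ := 1 / ((β₁ - α₁) * p) + 1 / (α₁ * p)
  set K₂ : ℝ := 1 / ((β₂ - α₂) * p) + 1 / (α₂ * p)
  have h₁ : 0 < β₁ - α₁ := by linarith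
  have h₂ : 0 < β₂ - α₂ := by linarith
  have hK₁ : 0 < K₁ := by positivity
  have hK₂ : 0 < K₂ := by positivity
  refine ⟨C₂ * (K₁ * K₂ * C₁), by positivity, fun f a δ₁ δ₂ hf hδ₁ hδ₂ => ?_⟩
  have ha := hf.mixedMonotone hp
  set d₁ := ENNReal.ofReal (δ₁ ^ α₁) ^ p with hd₁
  set d₂ := ENNReal.ofReal (δ₂ ^ α₂) ^ p with hd₂
  have hsum : d₁ * d₂ * ∑' k : ℕ × ℕ, dyadicMass p a k *
        (weightIntegral p α₁ β₁ δ₁ k.1 * weightIntegral p α₂ β₂ δ₂ k.2) ≤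
      ENNReal.ofReal (K₁ * K₂) * dyadicSum p α₁ α₂ δ₁ δ₂ a := by
    rw [ha.dyadicSum_eq hp0 hδ₁.1.le, ← ENNReal.tsum_mul_left, ← ENNReal.tsum_mul_left]
    refine ENNReal.tsum_le_tsum fun k => ?_
    calc _ = dyadicMass p a k * ((d₁ * weightIntegral p α₁ β₁ δ₁ k.1) *
          (d₂ * weightIntegral p α₂ β₂ δ₂ k.2)) := by ring
      _ ≤ dyadicMass p a k * ((ENNReal.ofReal K₁ * ENNReal.ofReal (dyadicWeight α₁ δ₁ k.1) ^ p) *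
          (ENNReal.ofReal K₂ * ENNReal.ofReal (dyadicWeight α₂ δ₂ k.2) ^ p)) := by
          exact mul_le_mul_right (mul_le_mul' (weightIntegral_le hp0 hα₁ hαβ₁ hδ₁.1 _)
            (weightIntegral_le hp0 hα₂ hαβ₂ hδ₂.1 _)) _
      _ = _ := by
          rw [ENNReal.ofReal_mul hK₁.le]
          ring
  rw [← ha.lintegral_dyadicSum hp0 hδ₁.1 hδ₂.1] at hsum
  rw [marchaudInt_rpow hp0 hδ₁.1, ← hd₁, ← hd₂]
  calc _ ≤ d₁ * d₂ * (ENNReal.ofReal C₂ * ∫⁻ t₁ in Set.Ioo δ₁ 1, ∫⁻ t₂ in Set.Ioo δ₂ 1,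
        ENNReal.ofReal ((t₁ ^ (-α₁) * t₂ ^ (-α₂)) ^ p / (t₁ * t₂)) *
          dyadicSum p β₁ β₂ t₁ t₂ a) := by
        refine mul_le_mul_right ?_ _
        rw [← lintegral_const_mul' _ _ ENNReal.ofReal_ne_top]
        refine setLIntegral_mono' measurableSet_Ioo fun t₁ ht₁ => ?_
        rw [← lintegral_const_mul' _ _ ENNReal.ofReal_ne_top]
        refine setLIntegral_mono' measurableSet_Ioo fun t₂ ht₂ => ?_
        rw [mul_left_comm]
        gcongr
        exact H₂ f a t₁ t₂ hf (hδ₁.1.trans ht₁.1) (hδ₂.1.trans ht₂.1)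
    _ ≤ ENNReal.ofReal C₂ * (ENNReal.ofReal (K₁ * K₂) *
        (ENNReal.ofReal C₁ * mixedMod p α₁ α₂ δ₁ δ₂ f ^ p)) := by
        rw [mul_left_comm]
        refine mul_le_mul_right (hsum.trans (mul_le_mul_right ?_ _)) _
        exact H₁ f a δ₁ δ₂ hf hδ₁.1 hδ₂.1
    _ = _ := by
        rw [ENNReal.ofReal_mul hC₂.le, ENNReal.ofReal_mul (mul_pos hK₁ hK₂).le]
        ring

end

/-- For `f ∈ M_p`, the mixed moduli of smoothness of different orders are related
by an equivalence with exponent `p` (Theorem 10.2). -/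
theorem sharp_marchaud_Mclass (p α₁ α₂ β₁ β₂ : ℝ) (hp : 1 < p)
    (hα₁ : 0 < α₁) (hα₂ : 0 < α₂) (hαβ₁ : α₁ < β₁) (hαβ₂ : α₂ < β₂) :
    ∃ C : ℝ, 0 < C ∧ ∀ (f : ℝ → ℝ → ℝ) (a : ℕ → ℕ → ℝ) (δ₁ δ₂ : ℝ),
      InMclass p f a → δ₁ ∈ Set.Ioo (0:ℝ) (1/2) → δ₂ ∈ Set.Ioo (0:ℝ) (1/2) →
      mixedMod p α₁ α₂ δ₁ δ₂ f ≤
          ENNReal.ofReal C * marchaudInt p α₁ α₂ β₁ β₂ δ₁ δ₂ p f ∧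
      marchaudInt p α₁ α₂ β₁ β₂ δ₁ δ₂ p f ≤
          ENNReal.ofReal C * mixedMod p α₁ α₂ δ₁ δ₂ f := by
  obtain ⟨C₁, hC₁, H₁⟩ := exists_mixedMod_le_marchaudInt hp hα₁ hα₂ hαβ₁ hαβ₂
  obtain ⟨C₂, hC₂, H₂⟩ := exists_marchaudInt_le_mixedMod hp hα₁ hα₂ hαβ₁ hαβ₂
  have hp0 : 0 < p := by linarith
  refine ⟨max (C₁ ^ (1 / p)) (C₂ ^ (1 / p)), lt_max_of_lt_left (by positivity),
    fun f a δ₁ δ₂ hf hδ₁ hδ₂ => ⟨?_, ?_⟩⟩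
  · exact (le_ofReal_mul_of_rpow_le hp0 hC₁.le (H₁ f a δ₁ δ₂ hf hδ₁ hδ₂)).trans
      (mul_le_mul' (ENNReal.ofReal_le_ofReal (le_max_left _ _)) le_rfl)
  · exact (le_ofReal_mul_of_rpow_le hp0 hC₂.le (H₂ f a δ₁ δ₂ hf hδ₁ hδ₂)).trans
      (mul_le_mul' (ENNReal.ofReal_le_ofReal (le_max_right _ _)) le_rfl)

end
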